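/- Let Ω ⊂ ℝ^d (d ≥ 2) be a bounded domain with boundary of class C^{2,γ} and let f ∈ C^∞(cl(Ω)×ℝ×ℝ^d, ℝ). Let p₁ and p₂ be two time-periodic classical solutions of ∂_t u = Δu + f(x, u, ∇u) with homogeneous Dirichlet boundary condition, of minimal periods ω₁ and ω₂, with p_i and ∇p_i uniformly bounded. Assume they do not describe the same periodic orbit, i.e. p₁(·,t) ≠ p₂(·,s) as functions on Ω for all (t,s) ∈ ℝ². Then there exists a dense open set of points (x₀,t₀) ∈ Ω×ℝ such that (p₁(x₀,t₀), ∇p₁(x₀,t₀)) ≠ (p₂(x₀,t), ∇p₂(x₀,t)) for all t ∈ ℝ. -/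

import Mathlib

open Set MeasureTheory

/-- The partial derivative of `f` in the `i`-th coordinate direction. -/
noncomputable def pd {d : ℕ} (i : Fin d) (f : (Fin d → ℝ) → ℝ) (x : Fin d → ℝ) : ℝ :=
  fderiv ℝ f x (Pi.single i 1)

/-- The Laplacian of `f`. -/
noncomputable def lap {d : ℕ} (f : (Fin d → ℝ) → ℝ) (x : Fin d → ℝ) : ℝ :=
  ∑ i, pd i (pd i f) x

/-- `Ω` is a domain with boundary of class `C^{2,γ}`: it admits a global defining
function `φ` of class `C²` whose second derivative is `γ`-Hölder continuous, with
nonvanishing gradient on the boundary. -/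
def HasC2HolderBoundary {d : ℕ} (Ω : Set (Fin d → ℝ)) (γ : NNReal) : Prop :=
  ∃ (φ : (Fin d → ℝ) → ℝ) (C : NNReal),
    ContDiff ℝ 2 φ ∧ HolderWith C γ (iteratedFDeriv ℝ 2 φ) ∧
    Ω = {x | φ x < 0} ∧ ∀ x ∈ frontier Ω, fderiv ℝ φ x ≠ 0

section part1
open Set MeasureTheory Filter Topology

/-- one dimensional second derivative test (necessary condition). -/
lemma sd_test {g g' : ℝ → ℝ} {c : ℝ} (hmax : IsLocalMax g 0)
    (hg : ∀ᶠ h in 𝓝 (0:ℝ), HasDerivAt g (g' h) h) (hg' : HasDerivAt g' c 0) : c ≤ 0 := by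
  by_contra hc
  push Not at hc
  have h0 : g' 0 = 0 := hmax.hasDerivAt_eq_zero hg.self_of_nhds
  have hder : deriv g =ᶠ[𝓝 0] g' := hg.mono fun h hh => hh.deriv
  have h2 : deriv (deriv g) 0 = c := by rw [hder.deriv_eq]; exact hg'.deriv
  have hmin : IsLocalMin g 0 := isLocalMin_of_deriv_deriv_pos (by rw [h2]; exact hc)
    (by rw [hder.self_of_nhds]; exact h0) hg.self_of_nhds.continuousAt
  have hconst : g =ᶠ[𝓝 0] fun _ => g 0 := by
    filter_upwards [hmax, hmin] with x h1 h2 using le_antisymm h1 h2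
  have hd0 : deriv g =ᶠ[𝓝 0] fun _ => 0 := by
    have := hconst.deriv
    simpa using this
  rw [hd0.deriv_eq] at h2
  simp at h2
  linarith

/-- derivative at a maximum from the left. -/
lemma left_max_deriv {g : ℝ → ℝ} {c : ℝ} (hg : HasDerivAt g c 0)
    (hmax : ∀ᶠ h in 𝓝[<] (0:ℝ), g h ≤ g 0) : 0 ≤ c := by
  have h1 : Tendsto (slope g 0) (𝓝[<] 0) (𝓝 c) :=
    (hasDerivAt_iff_tendsto_slope.mp hg).mono_left (nhdsWithin_mono _ (fun x hx => ne_of_lt hx))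
  refine ge_of_tendsto h1 ?_
  filter_upwards [hmax, self_mem_nhdsWithin] with h h2 h3
  rw [slope_def_field]
  apply div_nonneg_of_nonpos
  · linarith
  · simpa using le_of_lt h3

lemma right_le_deriv {g : ℝ → ℝ} {c L : ℝ} (hg : HasDerivAt g c 0)
    (hmax : ∀ᶠ h in 𝓝[>] (0:ℝ), g h - g 0 ≤ L * h) : c ≤ L := by
  have h1 : Tendsto (slope g 0) (𝓝[>] 0) (𝓝 c) :=
    (hasDerivAt_iff_tendsto_slope.mp hg).mono_left (nhdsWithin_mono _ (fun x hx => ne_of_gt hx))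
  refine le_of_tendsto h1 ?_
  filter_upwards [hmax, self_mem_nhdsWithin] with h h2 h3
  rw [slope_def_field, sub_zero, div_le_iff₀ (by simpa using h3)]
  exact h2

section calc1
variable {d : ℕ} {Ω : Set (Fin d → ℝ)}

/-- space-time regularity class of classical solutions. -/
structure Cl (Ω : Set (Fin d → ℝ)) (u : (Fin d → ℝ) → ℝ → ℝ) : Prop where
  c : ContinuousOn (fun q : (Fin d → ℝ) × ℝ => u q.1 q.2) (Ω ×ˢ (univ : Set ℝ))
  x : ∀ t : ℝ, ContDiffOn ℝ 2 (fun x => u x t) Ω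
  t : ∀ x ∈ Ω, Differentiable ℝ (u x)

/-- the heat operator -/
noncomputable def Pt (u : (Fin d → ℝ) → ℝ → ℝ) (x : Fin d → ℝ) (t : ℝ) : ℝ :=
  deriv (u x) t - lap (fun y => u y t) x

lemma c2_diff (hΩ : IsOpen Ω) {v : (Fin d → ℝ) → ℝ} (hv : ContDiffOn ℝ 2 v Ω)
    {x : Fin d → ℝ} (hx : x ∈ Ω) : DifferentiableAt ℝ v x :=
  ((hv.contDiffAt (hΩ.mem_nhds hx)).differentiableAt (by norm_num))

lemma c2_pd (hΩ : IsOpen Ω) {v : (Fin d → ℝ) → ℝ} (hv : ContDiffOn ℝ 2 v Ω) (i : Fin d) :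
    ContDiffOn ℝ 1 (pd i v) Ω := by
  have h1 : ContDiffOn ℝ 1 (fderiv ℝ v) Ω := hv.fderiv_of_isOpen hΩ (by norm_num)
  exact h1.clm_apply contDiffOn_const

lemma c2_pd_diff (hΩ : IsOpen Ω) {v : (Fin d → ℝ) → ℝ} (hv : ContDiffOn ℝ 2 v Ω) (i : Fin d)
    {x : Fin d → ℝ} (hx : x ∈ Ω) : DifferentiableAt ℝ (pd i v) x :=
  (((c2_pd hΩ hv i).contDiffAt (hΩ.mem_nhds hx)).differentiableAt (by norm_num))

lemma pd_congr {v w : (Fin d → ℝ) → ℝ} {x : Fin d → ℝ} (h : v =ᶠ[𝓝 x] w) (i : Fin d) :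
    pd i v x = pd i w x := by
  unfold pd; rw [h.fderiv_eq]

lemma pd_congr' {v w : (Fin d → ℝ) → ℝ} {x : Fin d → ℝ} (h : v =ᶠ[𝓝 x] w) (i : Fin d) :
    pd i v =ᶠ[𝓝 x] pd i w := by
  filter_upwards [h.eventuallyEq_nhds] with y hy using pd_congr hy i

lemma lap_congr {v w : (Fin d → ℝ) → ℝ} {x : Fin d → ℝ} (h : v =ᶠ[𝓝 x] w) :
    lap v x = lap w x := by
  unfold lap
  exact Finset.sum_congr rfl fun i _ => pd_congr (pd_congr' h i) i

lemma pd_line {v : (Fin d → ℝ) → ℝ} {x : Fin d → ℝ} {h : ℝ} (i : Fin d)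
    (hv : DifferentiableAt ℝ v (x + h • Pi.single i 1)) :
    HasDerivAt (fun k : ℝ => v (x + k • Pi.single i 1)) (pd i v (x + h • Pi.single i 1)) h := by
  have h1 : HasDerivAt (fun k : ℝ => x + k • (Pi.single i 1 : Fin d → ℝ)) (Pi.single i 1) h := by
    simpa using ((hasDerivAt_id h).smul_const (Pi.single i 1 : Fin d → ℝ)).const_add x
  exact hv.hasFDerivAt.comp_hasDerivAt h h1

lemma pd_line_neg {v : (Fin d → ℝ) → ℝ} {x : Fin d → ℝ} (i : Fin d)
    (hv : DifferentiableAt ℝ v x) :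
    HasDerivAt (fun k : ℝ => v (x + k • Pi.single i 1)) (pd i v x) 0 := by
  have := pd_line (v := v) (x := x) (h := 0) i (by simpa using hv)
  simpa using this

lemma line_mem (hΩ : IsOpen Ω) {x : Fin d → ℝ} (hx : x ∈ Ω) (i : Fin d) :
    ∀ᶠ h in 𝓝 (0:ℝ), x + h • (Pi.single i 1 : Fin d → ℝ) ∈ Ω := by
  have : ContinuousAt (fun h : ℝ => x + h • (Pi.single i 1 : Fin d → ℝ)) 0 := by fun_prop
  exact this.eventually_mem (hΩ.mem_nhds (by simpa using hx))

/-- second derivative along a line, packaged -/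
lemma line2 (hΩ : IsOpen Ω) {v : (Fin d → ℝ) → ℝ} (hv : ContDiffOn ℝ 2 v Ω) (i : Fin d)
    {x : Fin d → ℝ} (hx : x ∈ Ω) :
    (∀ᶠ h in 𝓝 (0:ℝ), HasDerivAt (fun k : ℝ => v (x + k • Pi.single i 1))
        (pd i v (x + h • Pi.single i 1)) h) ∧
    HasDerivAt (fun k : ℝ => pd i v (x + k • Pi.single i 1)) (pd i (pd i v) x) 0 := by
  constructor
  · filter_upwards [line_mem hΩ hx i] with h hh using pd_line i (c2_diff hΩ hv hh)
  · exact pd_line_neg i (c2_pd_diff hΩ hv i hx)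


lemma pd_const (c : ℝ) (i : Fin d) (x : Fin d → ℝ) : pd i (fun _ => c) x = 0 := by
  simp [pd]

lemma pd_add {v w : (Fin d → ℝ) → ℝ} {x : Fin d → ℝ} (i : Fin d) (hv : DifferentiableAt ℝ v x)
    (hw : DifferentiableAt ℝ w x) : pd i (fun y => v y + w y) x = pd i v x + pd i w x := by
  unfold pd; rw [fderiv_fun_add hv hw]; rfl

lemma pd_sub {v w : (Fin d → ℝ) → ℝ} {x : Fin d → ℝ} (i : Fin d) (hv : DifferentiableAt ℝ v x)
    (hw : DifferentiableAt ℝ w x) : pd i (fun y => v y - w y) x = pd i v x - pd i w x := by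
  unfold pd; rw [fderiv_fun_sub hv hw]; rfl

lemma pd_neg {v : (Fin d → ℝ) → ℝ} {x : Fin d → ℝ} (i : Fin d) :
    pd i (fun y => - v y) x = - pd i v x := by
  unfold pd; rw [fderiv_fun_neg]; rfl

lemma pd_mul {v w : (Fin d → ℝ) → ℝ} {x : Fin d → ℝ} (i : Fin d) (hv : DifferentiableAt ℝ v x)
    (hw : DifferentiableAt ℝ w x) :
    pd i (fun y => v y * w y) x = v x * pd i w x + pd i v x * w x := by
  unfold pd; rw [fderiv_fun_mul hv hw]; simp [mul_comm]

lemma pd_const_mul {v : (Fin d → ℝ) → ℝ} {x : Fin d → ℝ} (i : Fin d) (c : ℝ)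
    (hv : DifferentiableAt ℝ v x) :
    pd i (fun y => c * v y) x = c * pd i v x := by
  unfold pd; rw [fderiv_const_mul hv]; simp

lemma lap_add (hΩ : IsOpen Ω) {v w : (Fin d → ℝ) → ℝ} (hv : ContDiffOn ℝ 2 v Ω)
    (hw : ContDiffOn ℝ 2 w Ω) {x : Fin d → ℝ} (hx : x ∈ Ω) :
    lap (fun y => v y + w y) x = lap v x + lap w x := by
  unfold lap
  rw [← Finset.sum_add_distrib]
  refine Finset.sum_congr rfl fun i _ => ?_
  have h1 : pd i (fun y => v y + w y) =ᶠ[𝓝 x] fun y => pd i v y + pd i w y := by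
    filter_upwards [hΩ.mem_nhds hx] with y hy using pd_add i (c2_diff hΩ hv hy) (c2_diff hΩ hw hy)
  rw [pd_congr h1, pd_add i (c2_pd_diff hΩ hv i hx) (c2_pd_diff hΩ hw i hx)]

lemma lap_sub (hΩ : IsOpen Ω) {v w : (Fin d → ℝ) → ℝ} (hv : ContDiffOn ℝ 2 v Ω)
    (hw : ContDiffOn ℝ 2 w Ω) {x : Fin d → ℝ} (hx : x ∈ Ω) :
    lap (fun y => v y - w y) x = lap v x - lap w x := by
  unfold lap
  rw [← Finset.sum_sub_distrib]
  refine Finset.sum_congr rfl fun i _ => ?_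
  have h1 : pd i (fun y => v y - w y) =ᶠ[𝓝 x] fun y => pd i v y - pd i w y := by
    filter_upwards [hΩ.mem_nhds hx] with y hy using pd_sub i (c2_diff hΩ hv hy) (c2_diff hΩ hw hy)
  rw [pd_congr h1, pd_sub i (c2_pd_diff hΩ hv i hx) (c2_pd_diff hΩ hw i hx)]

lemma lap_neg {v : (Fin d → ℝ) → ℝ} {x : Fin d → ℝ} :
    lap (fun y => - v y) x = - lap v x := by
  unfold lap
  rw [← Finset.sum_neg_distrib]
  refine Finset.sum_congr rfl fun i _ => ?_
  have h1 : pd i (fun y => - v y) = fun y => - pd i v y := by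
    funext y; exact pd_neg i
  rw [h1, pd_neg]

lemma lap_mul (hΩ : IsOpen Ω) {v w : (Fin d → ℝ) → ℝ} (hv : ContDiffOn ℝ 2 v Ω)
    (hw : ContDiffOn ℝ 2 w Ω) {x : Fin d → ℝ} (hx : x ∈ Ω) :
    lap (fun y => v y * w y) x
      = v x * lap w x + 2 * (∑ i, pd i v x * pd i w x) + lap v x * w x := by
  unfold lap
  rw [Finset.mul_sum, Finset.mul_sum, Finset.sum_mul, ← Finset.sum_add_distrib,
    ← Finset.sum_add_distrib]
  refine Finset.sum_congr rfl fun i _ => ?_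
  have h1 : pd i (fun y => v y * w y) =ᶠ[𝓝 x] fun y => v y * pd i w y + pd i v y * w y := by
    filter_upwards [hΩ.mem_nhds hx] with y hy using pd_mul i (c2_diff hΩ hv hy) (c2_diff hΩ hw hy)
  have a1 := c2_diff hΩ hv hx
  have a2 := c2_diff hΩ hw hx
  have a3 := c2_pd_diff hΩ hv i hx
  have a4 := c2_pd_diff hΩ hw i hx
  rw [pd_congr h1, pd_add i (a1.fun_mul a4) (a3.fun_mul a2), pd_mul i a1 a4, pd_mul i a3 a2]
  ring

lemma pd_eq_zero_of_max {v : (Fin d → ℝ) → ℝ} {x : Fin d → ℝ} (h : IsLocalMax v x) (i : Fin d) :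
    pd i v x = 0 := by
  unfold pd; rw [h.fderiv_eq_zero]; rfl

lemma lap_nonpos_of_max (hΩ : IsOpen Ω) {v : (Fin d → ℝ) → ℝ} (hv : ContDiffOn ℝ 2 v Ω)
    {x : Fin d → ℝ} (hx : x ∈ Ω) (h : IsLocalMax v x) : lap v x ≤ 0 := by
  unfold lap
  refine Finset.sum_nonpos fun i _ => ?_
  obtain ⟨h1, h2⟩ := line2 hΩ hv i hx
  refine sd_test ?_ h1 h2
  have hc : ContinuousAt (fun h : ℝ => x + h • (Pi.single i 1 : Fin d → ℝ)) 0 := by fun_prop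
  have : Tendsto (fun h : ℝ => x + h • (Pi.single i 1 : Fin d → ℝ)) (𝓝 0) (𝓝 x) := by
    simpa [ContinuousAt] using hc
  have := this.eventually h
  filter_upwards [this] with k hk
  simpa using hk

lemma Cl.mono {Ω' : Set (Fin d → ℝ)} {u : (Fin d → ℝ) → ℝ → ℝ} (h : Cl Ω u) (hs : Ω' ⊆ Ω) :
    Cl Ω' u :=
  ⟨h.c.mono (prod_mono hs subset_rfl), fun t => (h.x t).mono hs, fun x hx => h.t x (hs hx)⟩

lemma Cl.sub {u w : (Fin d → ℝ) → ℝ → ℝ} (hu : Cl Ω u) (hw : Cl Ω w) :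
    Cl Ω (fun x t => u x t - w x t) :=
  ⟨hu.c.sub hw.c, fun t => (hu.x t).sub (hw.x t), fun x hx => (hu.t x hx).sub (hw.t x hx)⟩

lemma Cl.neg {u : (Fin d → ℝ) → ℝ → ℝ} (hu : Cl Ω u) : Cl Ω (fun x t => - u x t) :=
  ⟨hu.c.neg, fun t => (hu.x t).neg, fun x hx => (hu.t x hx).neg⟩

lemma Cl.mul {u w : (Fin d → ℝ) → ℝ → ℝ} (hu : Cl Ω u) (hw : Cl Ω w) :
    Cl Ω (fun x t => u x t * w x t) :=
  ⟨hu.c.mul hw.c, fun t => (hu.x t).mul (hw.x t), fun x hx => (hu.t x hx).mul (hw.t x hx)⟩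

lemma Cl.shift {u : (Fin d → ℝ) → ℝ → ℝ} (hu : Cl Ω u) (h : ℝ) :
    Cl Ω (fun x t => u x (t + h)) :=
  ⟨hu.c.comp (f := fun q : (Fin d → ℝ) × ℝ => (q.1, q.2 + h)) (by fun_prop)
    (fun q hq => ⟨hq.1, mem_univ _⟩), fun t => hu.x (t + h),
    fun x hx => (hu.t x hx).comp (by fun_prop)⟩

lemma Pt_sub (hΩ : IsOpen Ω) {u w : (Fin d → ℝ) → ℝ → ℝ} (hu : Cl Ω u) (hw : Cl Ω w)
    {x : Fin d → ℝ} (hx : x ∈ Ω) (t : ℝ) :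
    Pt (fun x t => u x t - w x t) x t = Pt u x t - Pt w x t := by
  unfold Pt
  rw [lap_sub hΩ (hu.x t) (hw.x t) hx]
  have := deriv_fun_sub (hu.t x hx t) (hw.t x hx t)
  rw [this]; ring

lemma Pt_neg {u : (Fin d → ℝ) → ℝ → ℝ}
    {x : Fin d → ℝ} (t : ℝ) :
    Pt (fun x t => - u x t) x t = - Pt u x t := by
  unfold Pt
  rw [lap_neg, deriv.fun_neg]; ring

lemma Pt_shift (u : (Fin d → ℝ) → ℝ → ℝ) (h : ℝ)
    (x : Fin d → ℝ) (t : ℝ) :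
    Pt (fun x t => u x (t + h)) x t = Pt u x (t + h) := by
  unfold Pt
  rw [deriv_comp_add_const (f := u x)]

lemma Pt_mul (hΩ : IsOpen Ω) {u w : (Fin d → ℝ) → ℝ → ℝ} (hu : Cl Ω u) (hw : Cl Ω w)
    {x : Fin d → ℝ} (hx : x ∈ Ω) (t : ℝ) :
    Pt (fun x t => u x t * w x t) x t = u x t * Pt w x t + Pt u x t * w x t
      - 2 * ∑ i, pd i (fun y => u y t) x * pd i (fun y => w y t) x := by
  unfold Pt
  rw [lap_mul hΩ (hu.x t) (hw.x t) hx]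
  have := deriv_fun_mul (hu.t x hx t) (hw.t x hx t)
  rw [this]; ring

end calc1
end part1

section part2
open Set MeasureTheory Filter Topology

section lemB
variable {d : ℕ} {Ω : Set (Fin d → ℝ)}

lemma quad_line (x x0 : Fin d → ℝ) (j : Fin d) (h : ℝ) :
    ∑ k, ((x + h • (Pi.single j 1 : Fin d → ℝ)) k - x0 k)^2
      = ∑ k, (x k - x0 k)^2 + 2 * h * (x j - x0 j) + h^2 := by
  have : ∀ k, ((x + h • (Pi.single j 1 : Fin d → ℝ)) k - x0 k)^2
      = (x k - x0 k)^2 + (if k = j then (2 * h * (x j - x0 j) + h^2) else 0) := by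
    intro k
    by_cases hk : k = j
    · subst hk; simp; ring
    · simp [hk]
  simp_rw [this, Finset.sum_add_distrib]
  simp
  ring

lemma lemB_aux (hΩ : IsOpen Ω) {u : (Fin d → ℝ) → ℝ → ℝ} (hu : Cl Ω u) {x0 : Fin d → ℝ}
    {t0 r δ M K κ1 κ2 ρ0 L : ℝ} (hr : 0 < r) (hδ : 0 < δ) (hball : Metric.closedBall x0 r ⊆ Ω)
    (hb : ∀ x ∈ Metric.closedBall x0 r, ∀ s ∈ Icc (t0 - r) t0, |u x s| ≤ δ)
    (hP : ∀ x ∈ Metric.closedBall x0 r, ∀ s ∈ Icc (t0 - r) t0, |Pt u x s| ≤ M)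
    (hκ1 : κ1 = 8 * δ / r^2) (hκ2 : κ2 = 2 * δ / r) (hK : 2 * M + κ2 + 2 * d * κ1 < 4 * K)
    (hK0 : 0 < K) (hρ0 : 0 < ρ0) (hρr : ρ0 ≤ r / 2) (hL : L = 2 * δ / ρ0 + K * ρ0)
    (i : Fin d) :
    ∀ x ∈ Metric.closedBall x0 (r/2), ∀ ρ ∈ Icc 0 ρ0, ∀ s ∈ Icc (t0 - r) t0,
      u (x + ρ • Pi.single i 1) s - u x s - (L * ρ - K * ρ^2) - κ1 * ∑ k, (x k - x0 k)^2
        - κ2 * (t0 - s) ≤ 0 := by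
  set E : (Fin d → ℝ) × ℝ × ℝ → ℝ := fun q => u (q.1 + q.2.1 • Pi.single i 1) q.2.2 - u q.1 q.2.2
    - (L * q.2.1 - K * q.2.1^2) - κ1 * ∑ k, (q.1 k - x0 k)^2 - κ2 * (t0 - q.2.2) with hE
  set S : Set ((Fin d → ℝ) × ℝ × ℝ) :=
    Metric.closedBall x0 (r/2) ×ˢ (Icc 0 ρ0 ×ˢ Icc (t0 - r) t0) with hS
  have hScomp : IsCompact S :=
    (isCompact_closedBall _ _).prod (isCompact_Icc.prod isCompact_Icc)
  have hκpa : 0 < κ1 := by rw [hκ1]; positivity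
  have hκpb : 0 < κ2 := by rw [hκ2]; positivity
  have hmemA : ∀ x ρ, x ∈ Metric.closedBall x0 (r/2) → ρ ∈ Icc 0 ρ0 →
      x + ρ • (Pi.single i 1 : Fin d → ℝ) ∈ Metric.closedBall x0 r := by
    intro x ρ hx hρ
    rw [mem_closedBall_iff_norm] at hx ⊢
    have h1 : ‖ρ • (Pi.single i 1 : Fin d → ℝ)‖ ≤ r / 2 := by
      rw [norm_smul, Pi.norm_single, norm_one, mul_one, Real.norm_eq_abs, abs_of_nonneg hρ.1]
      linarith [hρ.2]
    calc ‖x + ρ • (Pi.single i 1 : Fin d → ℝ) - x0‖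
        = ‖(x - x0) + ρ • (Pi.single i 1 : Fin d → ℝ)‖ := by congr 1; abel
      _ ≤ r / 2 + r / 2 := (norm_add_le _ _).trans (add_le_add hx h1)
      _ = r := by ring
  have hmemB : ∀ x, x ∈ Metric.closedBall x0 (r/2) → x ∈ Metric.closedBall x0 r :=
    fun x hx => Metric.closedBall_subset_closedBall (by linarith) hx
  have hEc : ContinuousOn E S := by
    have hc1 : ContinuousOn (fun q : (Fin d → ℝ) × ℝ × ℝ =>
        u (q.1 + q.2.1 • Pi.single i 1) q.2.2) S := by
      refine hu.c.comp (f := fun q : (Fin d → ℝ) × ℝ × ℝ =>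
        (q.1 + q.2.1 • (Pi.single i 1 : Fin d → ℝ), q.2.2)) (by fun_prop) ?_
      intro q hq
      exact ⟨hball (hmemA _ _ hq.1 hq.2.1), mem_univ _⟩
    have hc2 : ContinuousOn (fun q : (Fin d → ℝ) × ℝ × ℝ => u q.1 q.2.2) S := by
      refine hu.c.comp (f := fun q : (Fin d → ℝ) × ℝ × ℝ => (q.1, q.2.2)) (by fun_prop) ?_
      intro q hq
      exact ⟨hball (hmemB _ hq.1), mem_univ _⟩
    refine ContinuousOn.sub (ContinuousOn.sub (ContinuousOn.sub (hc1.sub hc2) ?_) ?_) ?_ <;> fun_prop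
  have hne : S.Nonempty := ⟨(x0, 0, t0), by simp; positivity, by simp [hρ0.le], by simp [hr.le]⟩
  obtain ⟨⟨x, ρ, s⟩, hmS, hmax⟩ := hScomp.exists_isMaxOn hne hEc
  suffices hle : E (x, ρ, s) ≤ 0 by
    intro y hy ρ' hρ' s' hs'
    exact (hmax (show (y, ρ', s') ∈ S from ⟨hy, hρ', hs'⟩)).trans hle
  by_contra hpos
  push Not at hpos
  obtain ⟨hx, hρ, hs⟩ := hmS
  simp only at hx hρ hs
  have hA := hmemA x ρ hx hρ
  have hB := hmemB x hx
  have hAΩ := hball hA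
  have hBΩ := hball hB
  have hud : u (x + ρ • Pi.single i 1) s - u x s ≤ 2 * δ := by
    have h1 := abs_le.mp (hb _ hA s hs)
    have h2 := abs_le.mp (hb _ hB s hs)
    linarith [h1.2, h2.1]
  have hEv : E (x, ρ, s) = u (x + ρ • Pi.single i 1) s - u x s
    - (L * ρ - K * ρ^2) - κ1 * ∑ k, (x k - x0 k)^2 - κ2 * (t0 - s) := rfl
  have hρn : 0 ≤ L * ρ - K * ρ^2 := by
    have h1 : 0 ≤ 2 * δ / ρ0 := by positivity
    have h2 : K * ρ ≤ K * ρ0 := mul_le_mul_of_nonneg_left hρ.2 hK0.le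
    have : L * ρ - K * ρ^2 = (2 * δ / ρ0 + (K * ρ0 - K * ρ)) * ρ := by rw [hL]; ring
    rw [this]
    exact mul_nonneg (by linarith) hρ.1
  have hsum : 0 ≤ κ1 * ∑ k, (x k - x0 k)^2 := by positivity
  have hsn : 0 ≤ κ2 * (t0 - s) := mul_nonneg hκpb.le (by linarith [hs.2])
  have hρpos : 0 < ρ := by
    rcases hρ.1.eq_or_lt with h | h
    · exfalso
      rw [← h] at hEv hpos
      simp only [zero_smul, add_zero, sub_self] at hEv
      nlinarith
    · exact h
  have hρlt : ρ < ρ0 := by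
    rcases hρ.2.eq_or_lt with h | h
    · exfalso
      have : L * ρ - K * ρ^2 = 2 * δ := by rw [h, hL]; field_simp; ring
      linarith
    · exact h
  have hslt : t0 - r < s := by
    rcases hs.1.eq_or_lt with h | h
    · exfalso
      have : κ2 * (t0 - s) = 2 * δ := by rw [← h, hκ2]; field_simp; ring
      linarith
    · exact h
  have hxlt : x ∈ Metric.ball x0 (r/2) := by
    rw [Metric.mem_ball, dist_pi_lt_iff (by positivity)]
    intro k
    by_contra hk
    push Not at hk
    rw [Real.dist_eq] at hk
    have h1 : (r/2)^2 ≤ (x k - x0 k)^2 := by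
      rw [← sq_abs (x k - x0 k)]; exact pow_le_pow_left₀ (by positivity) hk 2
    have h2 : (x k - x0 k)^2 ≤ ∑ k, (x k - x0 k)^2 :=
      Finset.single_le_sum (f := fun k => (x k - x0 k)^2) (fun _ _ => sq_nonneg _) (Finset.mem_univ k)
    have h3 : κ1 * (r/2)^2 = 2 * δ := by rw [hκ1]; field_simp; ring
    have h4 : κ1 * (r/2)^2 ≤ κ1 * ∑ k, (x k - x0 k)^2 :=
      mul_le_mul_of_nonneg_left (h1.trans h2) hκpa.le
    linarith
  -- curves staying in S
  have hcurve : ∀ (c : ℝ → (Fin d → ℝ) × ℝ × ℝ), ContinuousAt c 0 → c 0 = (x, ρ, s) →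
      (∀ᶠ h in 𝓝 (0:ℝ), (c h).2.2 = s) → ∀ᶠ h in 𝓝 (0:ℝ), E (c h) ≤ E (c 0) := by
    intro c hc h0 hcs
    have ho : IsOpen (Metric.ball x0 (r/2) ×ˢ (Ioo 0 ρ0 ×ˢ (univ : Set ℝ))) :=
      Metric.isOpen_ball.prod (isOpen_Ioo.prod isOpen_univ)
    have := hc.eventually_mem (ho.mem_nhds (by rw [h0]; exact ⟨hxlt, ⟨hρpos, hρlt⟩, mem_univ _⟩))
    filter_upwards [this, hcs] with h h1 h2
    rw [h0]
    refine hmax (show c h ∈ S from ⟨Metric.ball_subset_closedBall h1.1, Ioo_subset_Icc_self h1.2.1, ?_⟩)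
    rw [h2]; exact hs
  have hlA := fun j => line2 hΩ (hu.x s) j hAΩ
  have hlB := fun j => line2 hΩ (hu.x s) j hBΩ
  set a := x + ρ • (Pi.single i 1 : Fin d → ℝ) with ha
  -- direction j ≠ i (moving both)
  have hj : ∀ j, pd j (pd j (fun y => u y s)) a - pd j (pd j (fun y => u y s)) x - 2 * κ1 ≤ 0 := by
    intro j
    have hm := hcurve (fun h => (x + h • Pi.single j 1, ρ, s)) (by fun_prop) (by simp)
      (by simp)
    refine sd_test (g := fun h => E (x + h • Pi.single j 1, ρ, s))
      (g' := fun h => pd j (fun y => u y s) (a + h • Pi.single j 1)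
        - pd j (fun y => u y s) (x + h • Pi.single j 1) - κ1 * (2 * (x j - x0 j) + 2 * h)) hm ?_ ?_
    · filter_upwards [(hlA j).1, (hlB j).1] with h h1 h2
      have hq : HasDerivAt (fun h : ℝ => κ1 * (∑ k, (x k - x0 k)^2 + 2 * h * (x j - x0 j) + h^2))
          (κ1 * (2 * (x j - x0 j) + 2 * h)) h := by
        have e1 : HasDerivAt (fun h : ℝ => 2 * h * (x j - x0 j)) (2 * 1 * (x j - x0 j)) h :=
          ((hasDerivAt_id h).const_mul 2).mul_const _
        have e2 : HasDerivAt (fun h : ℝ => h^2) (2 * h) h := by simpa using hasDerivAt_pow 2 h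
        have := ((e1.const_add (∑ k, (x k - x0 k)^2)).add e2).const_mul κ1
        exact this.congr_deriv (by ring)
      have := (((h1.sub h2).sub_const (L * ρ - K * ρ^2)).sub hq).sub_const (κ2 * (t0 - s))
      refine this.congr_of_eventuallyEq (Eventually.of_forall fun k => ?_)
      simp only [hE, quad_line, Pi.sub_apply]
      rw [add_right_comm]
    · have e2 : HasDerivAt (fun h : ℝ => κ1 * (2 * (x j - x0 j) + 2 * h)) (2 * κ1) 0 := by
        have := (((hasDerivAt_id (0:ℝ)).const_mul 2).const_add (2 * (x j - x0 j))).const_mul κ1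
        exact this.congr_deriv (by ring)
      exact ((hlA j).2.sub (hlB j).2).sub e2
  have hia : pd i (pd i (fun y => u y s)) a + 2 * K ≤ 0 := by
    have hm := hcurve (fun h => (x, ρ + h, s)) (by fun_prop) (by simp)
      (by simp)
    refine sd_test (g := fun h => E (x, ρ + h, s))
      (g' := fun h => pd i (fun y => u y s) (a + h • Pi.single i 1)
        - (L - K * (2 * (ρ + h)))) hm ?_ ?_
    · filter_upwards [(hlA i).1] with h h1
      have hq : HasDerivAt (fun h : ℝ => L * (ρ + h) - K * (ρ + h)^2)
          (L - K * (2 * (ρ + h))) h := by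
        have e1 : HasDerivAt (fun h : ℝ => ρ + h) 1 h := (hasDerivAt_id h).const_add ρ
        have := (e1.const_mul L).sub ((e1.pow 2).const_mul K)
        exact this.congr_deriv (by simp)
      have := (((h1.sub_const (u x s)).sub hq).sub_const (κ1 * ∑ k, (x k - x0 k)^2)).sub_const
        (κ2 * (t0 - s))
      refine this.congr_of_eventuallyEq (Eventually.of_forall fun k => ?_)
      simp only [hE, Pi.sub_apply, ha, add_smul, add_assoc]
    · have e2 : HasDerivAt (fun h : ℝ => L - K * (2 * (ρ + h))) (- (2 * K)) 0 := by
        have := ((((hasDerivAt_id (0:ℝ)).const_add ρ).const_mul 2).const_mul K).const_sub L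
        exact this.congr_deriv (by ring)
      have := (hlA i).2.sub e2
      exact this.congr_deriv (by ring)
  have hib : - pd i (pd i (fun y => u y s)) x + 2 * K - 2 * κ1 ≤ 0 := by
    have hm := hcurve (fun h => (x + h • Pi.single i 1, ρ - h, s)) (by fun_prop) (by simp)
      (by simp)
    refine sd_test (g := fun h => E (x + h • Pi.single i 1, ρ - h, s))
      (g' := fun h => - pd i (fun y => u y s) (x + h • Pi.single i 1)
        - (- L + K * (2 * (ρ - h))) - κ1 * (2 * (x i - x0 i) + 2 * h)) hm ?_ ?_
    · filter_upwards [(hlB i).1] with h h1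
      have hq : HasDerivAt (fun h : ℝ => L * (ρ - h) - K * (ρ - h)^2)
          (- L + K * (2 * (ρ - h))) h := by
        have e1 : HasDerivAt (fun h : ℝ => ρ - h) (-1) h := (hasDerivAt_id h).const_sub ρ
        have := (e1.const_mul L).sub ((e1.pow 2).const_mul K)
        exact this.congr_deriv (by simp)
      have hq2 : HasDerivAt (fun h : ℝ => κ1 * (∑ k, (x k - x0 k)^2 + 2 * h * (x i - x0 i) + h^2))
          (κ1 * (2 * (x i - x0 i) + 2 * h)) h := by
        have e1 : HasDerivAt (fun h : ℝ => 2 * h * (x i - x0 i)) (2 * 1 * (x i - x0 i)) h :=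
          ((hasDerivAt_id h).const_mul 2).mul_const _
        have e2 : HasDerivAt (fun h : ℝ => h^2) (2 * h) h := by simpa using hasDerivAt_pow 2 h
        have := ((e1.const_add (∑ k, (x k - x0 k)^2)).add e2).const_mul κ1
        exact this.congr_deriv (by ring)
      have := ((((h1.const_sub (u a s))).sub hq).sub hq2).sub_const (κ2 * (t0 - s))
      refine this.congr_of_eventuallyEq (Eventually.of_forall fun k => ?_)
      simp only [hE, quad_line, Pi.sub_apply, ha, sub_smul]
      have : x + k • (Pi.single i 1 : Fin d → ℝ) + (ρ • (Pi.single i 1 : Fin d → ℝ)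
        - k • (Pi.single i 1 : Fin d → ℝ)) = x + ρ • (Pi.single i 1 : Fin d → ℝ) := by abel
      rw [this]
    · have e2 : HasDerivAt (fun h : ℝ => - L + K * (2 * (ρ - h))) (- (2 * K)) 0 := by
        have := ((((hasDerivAt_id (0:ℝ)).const_sub ρ).const_mul 2).const_mul K).const_add (-L)
        exact this.congr_deriv (by ring)
      have e3 : HasDerivAt (fun h : ℝ => κ1 * (2 * (x i - x0 i) + 2 * h)) (2 * κ1) 0 := by
        have := (((hasDerivAt_id (0:ℝ)).const_mul 2).const_add (2 * (x i - x0 i))).const_mul κ1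
        exact this.congr_deriv (by ring)
      have := ((hlB i).2.neg.sub e2).sub e3
      exact this.congr_deriv (by ring)
  have hti : 0 ≤ deriv (u a) s - deriv (u x) s + κ2 := by
    have h1 : HasDerivAt (fun h : ℝ => u a (s + h)) (deriv (u a) s) 0 := by
      have := (hu.t a hAΩ s).hasDerivAt
      exact HasDerivAt.comp_const_add (f := u a) s 0 (by simpa using this)
    have h2 : HasDerivAt (fun h : ℝ => u x (s + h)) (deriv (u x) s) 0 := by
      have := (hu.t x hBΩ s).hasDerivAt
      exact HasDerivAt.comp_const_add (f := u x) s 0 (by simpa using this)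
    have h3 : HasDerivAt (fun h : ℝ => κ2 * (t0 - (s + h))) (-κ2) 0 := by
      have := ((((hasDerivAt_id (0:ℝ)).const_add s).const_sub t0)).const_mul κ2
      exact this.congr_deriv (by ring)
    have h4 := (((h1.sub h2).sub_const (L * ρ - K * ρ^2)).sub_const
      (κ1 * ∑ k, (x k - x0 k)^2)).sub h3
    have h5 := left_max_deriv h4 ?_
    · linarith
    · have : ∀ᶠ h in 𝓝[<] (0:ℝ), t0 - r - s < h :=
        nhdsWithin_le_nhds (lt_mem_nhds (by linarith))
      filter_upwards [this, self_mem_nhdsWithin] with h h6 h7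
      have h7 : h < 0 := h7
      have := hmax (show (x, ρ, s + h) ∈ S from ⟨hx, hρ, by linarith, by linarith [hs.2]⟩)
      simpa [hE] using this
  have hPa := abs_le.mp (hP a hA s hs)
  have hPb := abs_le.mp (hP x hB s hs)
  unfold Pt at hPa hPb
  have hlap : lap (fun y => u y s) a - lap (fun y => u y s) x ≤ 2 * d * κ1 - 4 * K := by
    unfold lap
    rw [← Finset.sum_sub_distrib, ← Finset.add_sum_erase _ _ (Finset.mem_univ i)]
    have h1 : ∑ j ∈ Finset.univ.erase i, (pd j (pd j (fun y => u y s)) a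
        - pd j (pd j (fun y => u y s)) x) ≤ ∑ j ∈ Finset.univ.erase i, 2 * κ1 :=
      Finset.sum_le_sum fun j _ => by linarith [hj j]
    rw [Finset.sum_const, Finset.card_erase_of_mem (Finset.mem_univ i), Finset.card_univ,
      Fintype.card_fin, nsmul_eq_mul] at h1
    have hdp : 0 < d := i.pos
    rw [Nat.cast_sub (by omega)] at h1
    push_cast at h1
    nlinarith
  linarith [hPa.2, hPb.1]

/-- The bound constant in the gradient interpolation. -/
noncomputable def KB (d : ℕ) (r δ M : ℝ) : ℝ := M + 2 * δ / r + d * (8 * δ / r^2) + 4 * δ / r^2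

lemma lemB_one (hΩ : IsOpen Ω) {u : (Fin d → ℝ) → ℝ → ℝ} (hu : Cl Ω u) {x0 : Fin d → ℝ}
    {t0 r δ M : ℝ} (hr : 0 < r) (hδ : 0 < δ) (hball : Metric.closedBall x0 r ⊆ Ω)
    (hb : ∀ x ∈ Metric.closedBall x0 r, ∀ s ∈ Icc (t0 - r) t0, |u x s| ≤ δ)
    (hP : ∀ x ∈ Metric.closedBall x0 r, ∀ s ∈ Icc (t0 - r) t0, |Pt u x s| ≤ M) (i : Fin d) :
    pd i (fun y => u y t0) x0 ≤ 3 * √(δ * KB d r δ M) := by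
  have hM : 0 ≤ M := (abs_nonneg _).trans
    (hP x0 (Metric.mem_closedBall_self hr.le) t0 ⟨by linarith, le_rfl⟩)
  set K := KB d r δ M with hKdef
  have hK0 : 0 < K := by unfold K KB; positivity
  set ρ0 := √(δ / K) with hρ0
  have hρp : 0 < ρ0 := Real.sqrt_pos.mpr (by positivity)
  have hρr : ρ0 ≤ r / 2 := by
    rw [hρ0, Real.sqrt_le_left (by positivity), div_le_iff₀ hK0]
    have h1 : 4 * δ / r^2 ≤ K := by
      unfold K KB
      have : 0 ≤ M + 2 * δ / r + d * (8 * δ / r^2) := by positivity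
      linarith
    have h2 : (r/2)^2 * (4 * δ / r^2) = δ := by field_simp; ring
    calc δ = (r/2)^2 * (4 * δ / r^2) := h2.symm
      _ ≤ _ := mul_le_mul_of_nonneg_left h1 (by positivity)
  have key := lemB_aux hΩ hu (κ1 := 8 * δ / r^2) (κ2 := 2 * δ / r) (K := K) (ρ0 := ρ0)
    (L := 2 * δ / ρ0 + K * ρ0) hr hδ hball hb hP rfl rfl ?_ hK0 hρp hρr rfl i x0
    (Metric.mem_closedBall_self (by positivity))
  · have hder := pd_line_neg (v := fun y => u y t0) (x := x0) i
      (c2_diff hΩ (hu.x t0) (hball (Metric.mem_closedBall_self hr.le)))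
    have hLL : 2 * δ / ρ0 + K * ρ0 = 3 * √(δ * K) := by
      have e1 : ρ0 * √(δ * K) = δ := by
        rw [hρ0, ← Real.sqrt_mul (by positivity)]
        rw [show δ / K * (δ * K) = δ^2 by field_simp]
        exact Real.sqrt_sq hδ.le
      have e2 : K * ρ0 = √(δ * K) := by
        have : ρ0 * (K * ρ0) = δ := by
          have : ρ0 * ρ0 = δ / K := Real.mul_self_sqrt (by positivity)
          calc ρ0 * (K * ρ0) = K * (ρ0 * ρ0) := by ring
            _ = δ := by rw [this]; field_simp
        exact mul_left_cancel₀ hρp.ne' (this.trans e1.symm)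
      have e3 : 2 * δ / ρ0 = 2 * √(δ * K) := by
        rw [div_eq_iff hρp.ne']; linarith
      rw [e2, e3]; ring
    rw [← hLL]
    refine right_le_deriv hder ?_
    filter_upwards [Ioo_mem_nhdsGT hρp] with h hh
    have := key h ⟨hh.1.le, hh.2.le⟩ t0 ⟨by linarith, le_rfl⟩
    simp only [sub_self, mul_zero, zero_pow (two_ne_zero), Finset.sum_const_zero, sub_zero] at this
    simp only [zero_smul, add_zero]
    have h2 : 0 ≤ K * h^2 := by positivity
    linarith
  · have h1 : 0 < 4 * δ / r^2 := by positivity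
    have h2 : 0 < 2 * δ / r := by positivity
    have h3 : 0 ≤ d * (8 * δ / r^2) := by positivity
    rw [hKdef, KB]
    linarith

lemma lemB (hΩ : IsOpen Ω) {u : (Fin d → ℝ) → ℝ → ℝ} (hu : Cl Ω u) {x0 : Fin d → ℝ}
    {t0 r δ M : ℝ} (hr : 0 < r) (hδ : 0 < δ) (hball : Metric.closedBall x0 r ⊆ Ω)
    (hb : ∀ x ∈ Metric.closedBall x0 r, ∀ s ∈ Icc (t0 - r) t0, |u x s| ≤ δ)
    (hP : ∀ x ∈ Metric.closedBall x0 r, ∀ s ∈ Icc (t0 - r) t0, |Pt u x s| ≤ M) (i : Fin d) :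
    |pd i (fun y => u y t0) x0| ≤ 3 * √(δ * KB d r δ M) := by
  rw [abs_le]
  constructor
  · have := lemB_one hΩ hu.neg hr hδ hball (by simpa using hb)
      (by intro x hx s hs; rw [Pt_neg, abs_neg]; exact hP x hx s hs) i
    rw [pd_neg] at this
    linarith
  · exact lemB_one hΩ hu hr hδ hball hb hP i
end lemB
end part2

section part3
open Set MeasureTheory Filter Topology

section R1
variable {d : ℕ} {Ω : Set (Fin d → ℝ)}

lemma KB_small (d : ℕ) (r M : ℝ) {ε : ℝ} (hε : 0 < ε) :
    ∃ δ > 0, 3 * √(δ * KB d r δ M) < ε := by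
  have hc : Continuous (fun δ => 3 * √(δ * KB d r δ M)) := by
    unfold KB; fun_prop
  have h0 : (fun δ => 3 * √(δ * KB d r δ M)) 0 < ε := by simpa using hε
  have := (hc.tendsto 0).eventually (gt_mem_nhds h0)
  have h2 : ∀ᶠ δ in 𝓝[>] (0:ℝ), 3 * √(δ * KB d r δ M) < ε := nhdsWithin_le_nhds this
  obtain ⟨δ, h3, h4⟩ := (h2.and self_mem_nhdsWithin).exists
  exact ⟨δ, h4, h3⟩

lemma pd_joint (hΩ : IsOpen Ω) {u : (Fin d → ℝ) → ℝ → ℝ} (hu : Cl Ω u) {M : ℝ}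
    (hP : ∀ x ∈ Ω, ∀ t, |Pt u x t| ≤ M) (i : Fin d) :
    ContinuousOn (fun q : (Fin d → ℝ) × ℝ => pd i (fun y => u y q.2) q.1) (Ω ×ˢ univ) := by
  rintro ⟨x0, t0⟩ ⟨hx0, -⟩
  refine ContinuousAt.continuousWithinAt ?_
  simp only at hx0
  obtain ⟨r', hr', hball'⟩ := Metric.nhds_basis_closedBall.mem_iff.mp (hΩ.mem_nhds hx0)
  obtain ⟨r, hr, hrr⟩ : ∃ r > 0, r' = 2 * r := ⟨r' / 2, by positivity, by ring⟩
  subst hrr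
  rw [Metric.continuousAt_iff]
  intro ε hε
  obtain ⟨δ, hδ, hδε⟩ := KB_small d r (2 * M) (half_pos hε)
  have hcomp : IsCompact (Metric.closedBall x0 (2 * r) ×ˢ Icc (t0 - 2 - r) (t0 + 2)) :=
    (isCompact_closedBall _ _).prod isCompact_Icc
  have huc := hcomp.uniformContinuousOn_of_continuous
    (hu.c.mono (prod_mono hball' (subset_univ _)))
  rw [Metric.uniformContinuousOn_iff] at huc
  obtain ⟨h0, hh0, huc⟩ := huc δ hδ
  have hxc : ContinuousAt (pd i (fun y => u y t0)) x0 :=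
    (c2_pd_diff hΩ (hu.x t0) i hx0).continuousAt
  rw [Metric.continuousAt_iff] at hxc
  obtain ⟨η, hη, hxc⟩ := hxc (ε/2) (half_pos hε)
  refine ⟨min (min h0 1) (min r η), by positivity, ?_⟩
  rintro ⟨x, t⟩ hq
  rw [Prod.dist_eq, max_lt_iff] at hq
  obtain ⟨hx, ht⟩ := hq
  simp only [lt_min_iff] at hx ht
  obtain ⟨⟨-, -⟩, hxr, hxη⟩ := hx
  obtain ⟨⟨hth, ht1⟩, -, -⟩ := ht
  rw [Real.dist_eq] at hth ht1
  have ht1' := abs_lt.mp ht1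
  have hsub : Metric.closedBall x r ⊆ Metric.closedBall x0 (2 * r) :=
    Metric.closedBall_subset_closedBall' (by linarith)
  have hB := lemB (r := r) (δ := δ) (M := 2 * M) (x0 := x) (t0 := t0) hΩ
    ((hu.shift (t - t0)).sub hu) hr hδ (hsub.trans hball') ?_ ?_ i
  · have hxΩ : x ∈ Ω := hball' (hsub (Metric.mem_closedBall_self hr.le))
    have h1 : pd i (fun y => u y (t0 + (t - t0)) - u y t0) x
        = pd i (fun y => u y t) x - pd i (fun y => u y t0) x := by
      rw [show t0 + (t - t0) = t by ring]
      exact pd_sub i (c2_diff hΩ (hu.x t) hxΩ) (c2_diff hΩ (hu.x t0) hxΩ)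
    rw [h1] at hB
    have h2 := hxc hxη
    rw [Real.dist_eq] at h2 ⊢
    simp only
    calc _ = |(pd i (fun y => u y t) x - pd i (fun y => u y t0) x)
          + (pd i (fun y => u y t0) x - pd i (fun y => u y t0) x0)| := by congr 1; ring
      _ ≤ _ := abs_add_le _ _
      _ < ε := by linarith
  · intro y hy s hs
    have := huc (y, s + (t - t0)) ⟨hsub hy, by constructor <;> simp only <;> linarith [hs.1, hs.2]⟩
      (y, s) ⟨hsub hy, by constructor <;> simp only <;> linarith [hs.1, hs.2]⟩
      (by rw [Prod.dist_eq]; simp [Real.dist_eq, hth, hh0])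
    rw [Real.dist_eq] at this
    exact this.le
  · intro y hy s hs
    have hyΩ := hball' (hsub hy)
    rw [Pt_sub hΩ (hu.shift _) hu hyΩ, Pt_shift]
    calc _ ≤ _ := abs_sub _ _
      _ ≤ 2 * M := by linarith [hP y hyΩ (s + (t - t0)), hP y hyΩ s]

end R1
end part3

section part4
open Set MeasureTheory Filter Topology
open scoped ContDiff

section trig
variable {d : ℕ} {Ω : Set (Fin d → ℝ)}

lemma exists_cutoff {K O : Set ((Fin d → ℝ) × ℝ)} (hK : IsClosed K) (hO : IsOpen O) (hKO : K ⊆ O) :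
    ∃ χ : (Fin d → ℝ) × ℝ → ℝ, ContDiff ℝ ∞ χ ∧ (∀ q ∈ K, ∀ᶠ p in 𝓝 q, χ p = 1) ∧
      tsupport χ ⊆ O ∧ ∀ q, χ q ∈ Icc (0:ℝ) 1 := by
  obtain ⟨f, h0, h1, h2⟩ := exists_contMDiffMap_zero_one_nhds_of_isClosed
    (modelWithCornersSelf ℝ ((Fin d → ℝ) × ℝ)) (n := (⊤ : ℕ∞)) hO.isClosed_compl hK
    (disjoint_compl_left_iff_subset.mpr hKO)
  refine ⟨f, contMDiff_iff_contDiff.mp f.contMDiff, fun q hq => ?_, ?_, h2⟩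
  · exact Filter.Eventually.filter_mono (nhds_le_nhdsSet hq) h1
  · intro q hq
    by_contra hqO
    have h3 : ∀ᶠ p in 𝓝 q, f p = 0 := Filter.Eventually.filter_mono (nhds_le_nhdsSet hqO) h0
    exact (notMem_tsupport_iff_eventuallyEq.mpr h3) hq

lemma Cl_of_contDiff {V : (Fin d → ℝ) → ℝ → ℝ}
    (hV : ContDiff ℝ ∞ (fun q : (Fin d → ℝ) × ℝ => V q.1 q.2)) : Cl (univ : Set (Fin d → ℝ)) V :=
  ⟨hV.continuous.continuousOn,
   fun t => ((hV.comp (contDiff_id.prodMk contDiff_const :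
      ContDiff ℝ ∞ (fun x : Fin d → ℝ => (x, t)))).of_le (WithTop.coe_le_coe.mpr (le_top : (2:ℕ∞) ≤ ⊤))).contDiffOn,
   fun x _ => (hV.comp (contDiff_const.prodMk contDiff_id :
      ContDiff ℝ ∞ (fun t : ℝ => (x, t)))).differentiable (by norm_num)⟩

lemma Pt_add (hΩ : IsOpen Ω) {u w : (Fin d → ℝ) → ℝ → ℝ} (hu : Cl Ω u) (hw : Cl Ω w)
    {x : Fin d → ℝ} (hx : x ∈ Ω) (t : ℝ) :
    Pt (fun x t => u x t + w x t) x t = Pt u x t + Pt w x t := by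
  unfold Pt
  rw [lap_add hΩ (hu.x t) (hw.x t) hx]
  have := deriv_fun_add (hu.t x hx t) (hw.t x hx t)
  rw [this]; ring

lemma Pt_const_mul (hΩ : IsOpen Ω) {u : (Fin d → ℝ) → ℝ → ℝ} (hu : Cl Ω u) (c : ℝ)
    {x : Fin d → ℝ} (hx : x ∈ Ω) (t : ℝ) :
    Pt (fun x t => c * u x t) x t = c * Pt u x t := by
  unfold Pt lap
  have h1 : ∀ i, pd i (pd i (fun y => c * u y t)) x = c * pd i (pd i (fun y => u y t)) x := by
    intro i
    have h1 : pd i (fun y => c * u y t) =ᶠ[𝓝 x] fun y => c * pd i (fun y => u y t) y := by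
      filter_upwards [hΩ.mem_nhds hx] with y hy using pd_const_mul i c (c2_diff hΩ (hu.x t) hy)
    rw [pd_congr h1, pd_const_mul i c (c2_pd_diff hΩ (hu.x t) i hx)]
  simp_rw [h1, ← Finset.mul_sum]
  have := deriv_const_mul c (hu.t x hx t)
  rw [this]; ring

/-- smooth functions, periodic with respect to the integer lattice -/
structure Good (V : (Fin d → ℝ) → ℝ → ℝ) : Prop where
  smooth : ContDiff ℝ ∞ (fun q : (Fin d → ℝ) × ℝ => V q.1 q.2)
  per : ∀ x t (m : Fin d → ℤ) (k : ℤ), V (fun j => x j + m j) (t + k) = V x t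

lemma Good.cl {V : (Fin d → ℝ) → ℝ → ℝ} (h : Good V) : Cl univ V := Cl_of_contDiff h.smooth

/-- the projection to the torus -/
noncomputable def tor (x : Fin d → ℝ) (t : ℝ) : UnitAddTorus (Option (Fin d)) :=
  fun o => ((o.elim t x : ℝ) : UnitAddCircle)

lemma Good.lin {V W : (Fin d → ℝ) → ℝ → ℝ} (hV : Good V) (hW : Good W) (a b : ℝ) :
    Good (fun x t => a * V x t + b * W x t) ∧ ∀ x t,
      Pt (fun x t => a * V x t + b * W x t) x t = a * Pt V x t + b * Pt W x t := by
  have h1 : Good (fun x t => a * V x t) :=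
    ⟨contDiff_const.mul hV.smooth, fun x t m k => by rw [hV.per]⟩
  have h2 : Good (fun x t => b * W x t) :=
    ⟨contDiff_const.mul hW.smooth, fun x t m k => by rw [hW.per]⟩
  refine ⟨⟨h1.smooth.add h2.smooth, fun x t m k => by rw [hV.per, hW.per]⟩, fun x t => ?_⟩
  rw [Pt_add isOpen_univ h1.cl h2.cl (mem_univ x), Pt_const_mul isOpen_univ hV.cl a (mem_univ x),
    Pt_const_mul isOpen_univ hW.cl b (mem_univ x)]

/-- phase -/
noncomputable def phase (n : Option (Fin d) → ℤ) (x : Fin d → ℝ) (t : ℝ) : ℝ :=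
  2 * Real.pi * (∑ j, n (some j) * x j + n none * t)

lemma phase_smooth (n : Option (Fin d) → ℤ) :
    ContDiff ℝ ∞ (fun q : (Fin d → ℝ) × ℝ => phase n q.1 q.2) := by
  unfold phase
  fun_prop

lemma phase_per (n : Option (Fin d) → ℤ) (x t) (m : Fin d → ℤ) (k : ℤ) :
    ∃ N : ℤ, phase n (fun j => x j + m j) (t + k) = phase n x t + N * (2 * Real.pi) := by
  refine ⟨∑ j, n (some j) * m j + n none * k, ?_⟩
  unfold phase
  push_cast
  simp_rw [mul_add, Finset.sum_add_distrib]
  ring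

lemma phase_line (n : Option (Fin d) → ℤ) (x t) (i : Fin d) (h : ℝ) :
    phase n (x + h • Pi.single i 1) t = phase n x t + h * (2 * Real.pi * n (some i)) := by
  unfold phase
  have : ∀ j, (n (some j) : ℝ) * (x + h • (Pi.single i 1 : Fin d → ℝ)) j
    = n (some j) * x j + (if j = i then h * n (some i) else 0) := by
    intro j
    by_cases hj : j = i
    · subst hj; simp; ring
    · simp [hj]
  simp_rw [this, Finset.sum_add_distrib]
  simp
  ring

lemma pd_phase {F F' : ℝ → ℝ} (hF : ∀ s, HasDerivAt F (F' s) s) (n : Option (Fin d) → ℤ) (x t)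
    (i : Fin d) :
    pd i (fun y => F (phase n y t)) x = (2 * Real.pi * n (some i)) * F' (phase n x t) := by
  have hdiff : DifferentiableAt ℝ (fun y => F (phase n y t)) x := by
    have h1 : DifferentiableAt ℝ (fun y => phase n y t) x :=
      ((phase_smooth n).comp (contDiff_id.prodMk contDiff_const :
        ContDiff ℝ ∞ (fun x : Fin d → ℝ => (x, t)))).differentiable (by norm_num) x
    exact (hF _).differentiableAt.comp x h1
  have h1 := pd_line_neg i hdiff
  have h2 : HasDerivAt (fun k : ℝ => F (phase n (x + k • Pi.single i 1) t))
      ((2 * Real.pi * n (some i)) * F' (phase n x t)) 0 := by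
    simp_rw [phase_line]
    have h3 : HasDerivAt (fun h : ℝ => phase n x t + h * (2 * Real.pi * n (some i)))
        (1 * (2 * Real.pi * n (some i))) 0 :=
      ((hasDerivAt_id (0:ℝ)).mul_const _).const_add _
    have h4 := HasDerivAt.comp (0:ℝ) (by simpa using hF (phase n x t)) h3
    exact h4.congr_deriv (by ring)
  exact h1.unique h2

lemma deriv_phase {F F' : ℝ → ℝ} (hF : ∀ s, HasDerivAt F (F' s) s) (n : Option (Fin d) → ℤ)
    (x : Fin d → ℝ) (t : ℝ) :
    deriv (fun t => F (phase n x t)) t = (2 * Real.pi * n none) * F' (phase n x t) := by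
  have h3 : HasDerivAt (fun t : ℝ => phase n x t) (2 * Real.pi * (n none * 1)) t := by
    unfold phase
    exact (((hasDerivAt_id t).const_mul _).const_add _).const_mul _
  have h4 := HasDerivAt.comp t (hF (phase n x t)) h3
  exact (h4.congr_deriv (by ring)).deriv

lemma lap_phase {F F' F'' : ℝ → ℝ} (hF : ∀ s, HasDerivAt F (F' s) s)
    (hF' : ∀ s, HasDerivAt F' (F'' s) s) (n : Option (Fin d) → ℤ) (x t) :
    lap (fun y => F (phase n y t)) x
      = (∑ i, (2 * Real.pi * n (some i))^2) * F'' (phase n x t) := by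
  unfold lap
  rw [Finset.sum_mul]
  refine Finset.sum_congr rfl fun i _ => ?_
  have h1 : pd i (fun y => F (phase n y t))
      = fun y => (2 * Real.pi * n (some i)) * F' (phase n y t) :=
    funext fun y => pd_phase hF n y t i
  rw [h1]
  have := pd_phase (F := fun s => (2 * Real.pi * n (some i)) * F' s)
    (F' := fun s => (2 * Real.pi * n (some i)) * F'' s) (fun s => (hF' s).const_mul _) n x t i
  rw [this]; ring

lemma mFourier_tor (n : Option (Fin d) → ℤ) (x : Fin d → ℝ) (t : ℝ) :
    UnitAddTorus.mFourier n (tor x t) = Complex.exp (phase n x t * Complex.I) := by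
  simp only [UnitAddTorus.mFourier, ContinuousMap.coe_mk, tor, fourier_coe_apply]
  rw [← Complex.exp_sum]
  congr 1
  rw [Fintype.sum_option]
  simp only [Option.elim, phase]
  push_cast
  rw [mul_add, add_mul, Finset.mul_sum, Finset.sum_mul, add_comm]
  congr 1
  · refine Finset.sum_congr rfl fun j _ => ?_
    ring
  · ring

lemma trig_solve : ∀ g ∈ Submodule.span ℂ
      (range (UnitAddTorus.mFourier (d := Option (Fin d)))),
    ∃ V₁ V₂ : (Fin d → ℝ) → ℝ → ℝ, Good V₁ ∧ Good V₂ ∧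
      (∀ x t, Pt V₁ x t + V₁ x t = (g (tor x t)).re) ∧
      (∀ x t, Pt V₂ x t + V₂ x t = (g (tor x t)).im) := by
  intro g hg
  induction hg using Submodule.span_induction with
  | mem g hg =>
    obtain ⟨n, rfl⟩ := hg
    have hc : Good (fun (x : Fin d → ℝ) t => Real.cos (phase n x t)) := by
      refine ⟨(phase_smooth n).cos, fun x t m k => ?_⟩
      obtain ⟨N, hN⟩ := phase_per n x t m k
      rw [hN, Real.cos_add_int_mul_two_pi]
    have hs : Good (fun (x : Fin d → ℝ) t => Real.sin (phase n x t)) := by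
      refine ⟨(phase_smooth n).sin, fun x t m k => ?_⟩
      obtain ⟨N, hN⟩ := phase_per n x t m k
      rw [hN, Real.sin_add_int_mul_two_pi]
    have hd1 := fun s => Real.hasDerivAt_cos s
    have hd2 := fun s => Real.hasDerivAt_sin s
    have hd3 : ∀ s, HasDerivAt (fun s => - Real.sin s) (- Real.cos s) s := fun s => (hd2 s).neg
    set S := ∑ i, (2 * Real.pi * n (some i))^2 with hS
    have hS0 : 0 ≤ S := Finset.sum_nonneg fun _ _ => sq_nonneg _
    set β := 2 * Real.pi * n none
    have hPc : ∀ (x : Fin d → ℝ) t, Pt (fun x t => Real.cos (phase n x t)) x t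
        = - β * Real.sin (phase n x t) + S * Real.cos (phase n x t) := by
      intro x t
      unfold Pt
      rw [deriv_phase hd1, lap_phase hd1 hd3]
      ring
    have hPs : ∀ (x : Fin d → ℝ) t, Pt (fun x t => Real.sin (phase n x t)) x t
        = β * Real.cos (phase n x t) + S * Real.sin (phase n x t) := by
      intro x t
      unfold Pt
      rw [deriv_phase hd2, lap_phase hd2 hd1]
      ring
    set α := 1 + S with hα
    have hne : α^2 + β^2 ≠ 0 := by positivity
    have h1 := hc.lin hs (α / (α^2 + β^2)) (β / (α^2 + β^2))
    have h2 := hc.lin hs (-β / (α^2 + β^2)) (α / (α^2 + β^2))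
    refine ⟨_, _, h1.1, h2.1, fun x t => ?_, fun x t => ?_⟩
    · rw [h1.2, hPc, hPs, mFourier_tor, Complex.exp_ofReal_mul_I_re]
      field_simp
      rw [hα]; ring
    · rw [h2.2, hPc, hPs, mFourier_tor, Complex.exp_ofReal_mul_I_im]
      field_simp
      rw [hα]; ring
  | zero =>
    have h0 : Good (fun (x : Fin d → ℝ) (t : ℝ) => (0:ℝ)) := ⟨contDiff_const, fun _ _ _ _ => rfl⟩
    have := h0.lin h0 0 0
    refine ⟨_, _, this.1, this.1, fun x t => ?_, fun x t => ?_⟩ <;> rw [this.2] <;> simp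
  | add g g' _ _ h h' =>
    obtain ⟨V₁, V₂, a1, a2, a3, a4⟩ := h
    obtain ⟨W₁, W₂, b1, b2, b3, b4⟩ := h'
    have h1 := a1.lin b1 1 1
    have h2 := a2.lin b2 1 1
    refine ⟨_, _, h1.1, h2.1, fun x t => ?_, fun x t => ?_⟩
    · rw [h1.2]; simp [← a3, ← b3]; ring
    · rw [h2.2]; simp [← a4, ← b4]; ring
  | smul c g _ h =>
    obtain ⟨V₁, V₂, a1, a2, a3, a4⟩ := h
    have h1 := a1.lin a2 c.re (-c.im)
    have h2 := a1.lin a2 c.im c.re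
    refine ⟨_, _, h1.1, h2.1, fun x t => ?_, fun x t => ?_⟩
    · rw [h1.2]; simp [← a3, ← a4]; ring
    · rw [h2.2]; simp [← a3, ← a4]; ring

end trig
end part4

section part5
open Set MeasureTheory Filter Topology
open scoped ContDiff

section torus
variable {d : ℕ}

/-- coordinates on space-time -/
def co (q : (Fin d → ℝ) × ℝ) (o : Option (Fin d)) : ℝ := o.elim q.2 q.1

lemma co_le_dist (q c : (Fin d → ℝ) × ℝ) (o : Option (Fin d)) : |co q o - co c o| ≤ dist q c := by
  rw [Prod.dist_eq]
  cases o with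
  | none => exact le_max_right _ _
  | some j => exact (dist_le_pi_dist q.1 c.1 j).trans (le_max_left _ _)

lemma dist_le_of_co {q c : (Fin d → ℝ) × ℝ} {r : ℝ} (hr : 0 ≤ r)
    (h : ∀ o, |co q o - co c o| ≤ r) : dist q c ≤ r := by
  rw [Prod.dist_eq, max_le_iff]
  exact ⟨(dist_pi_le_iff hr).mpr fun j => h (some j), h none⟩

lemma exists_co {q c : (Fin d → ℝ) × ℝ} {r : ℝ} (hr : 0 ≤ r)
    (h : r < dist q c) : ∃ o, r < |co q o - co c o| := by
  by_contra hc
  push Not at hc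
  exact absurd (dist_le_of_co hr hc) (not_le.mpr h)

instance factone : Fact ((0:ℝ) < 1) := ⟨one_pos⟩

/-- representative of a torus point near `c` -/
noncomputable def repo (c : (Fin d → ℝ) × ℝ) (θ : UnitAddTorus (Option (Fin d)))
    (o : Option (Fin d)) : ℝ := AddCircle.equivIco (1:ℝ) (co c o - 1/2) (θ o)

/-- representative of a torus point near `c` -/
noncomputable def rept (c : (Fin d → ℝ) × ℝ) (θ : UnitAddTorus (Option (Fin d))) :
    (Fin d → ℝ) × ℝ := (fun j => repo c θ (some j), repo c θ none)

lemma co_rept (c : (Fin d → ℝ) × ℝ) (θ : UnitAddTorus (Option (Fin d))) (o) :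
    co (rept c θ) o = repo c θ o := by
  cases o <;> rfl

lemma repo_norm (c : (Fin d → ℝ) × ℝ) (θ : UnitAddTorus (Option (Fin d))) (o) :
    |repo c θ o - co c o| = ‖θ o - ((co c o : ℝ) : UnitAddCircle)‖ := by
  have h1 : ((repo c θ o : ℝ) : UnitAddCircle) = θ o := AddCircle.coe_equivIco
  have h2 : repo c θ o ∈ Ico (co c o - 1/2) (co c o - 1/2 + 1) :=
    (AddCircle.equivIco (1:ℝ) (co c o - 1/2) (θ o)).2
  rw [← h1]
  have h3 : ‖((repo c θ o - co c o : ℝ) : UnitAddCircle)‖ = |repo c θ o - co c o| := by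
    refine (AddCircle.norm_coe_eq_abs_iff (1:ℝ) (by norm_num)).mpr ?_
    rw [abs_le]
    constructor <;> norm_num <;> linarith [h2.1, h2.2]
  rw [← h3]; rfl

lemma tor_norm (c q : (Fin d → ℝ) × ℝ) (o) (h : |co q o - co c o| ≤ 1/2) :
    ‖tor q.1 q.2 o - ((co c o : ℝ) : UnitAddCircle)‖ = |co q o - co c o| := by
  have h3 : ‖((co q o - co c o : ℝ) : UnitAddCircle)‖ = |co q o - co c o| := by
    refine (AddCircle.norm_coe_eq_abs_iff (1:ℝ) (by norm_num)).mpr ?_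
    simpa using h
  rw [← h3]; rfl

lemma lift_torus {H : (Fin d → ℝ) × ℝ → ℝ} (hH : Continuous H) {c : (Fin d → ℝ) × ℝ}
    (hH0 : ∀ q, 1/4 < dist q c → H q = 0) :
    ∃ G : C(UnitAddTorus (Option (Fin d)), ℂ), ∀ q, dist q c ≤ 1/2 →
      G (tor q.1 q.2) = (H q : ℂ) := by
  have hzero : ∀ θ o, 1/4 < ‖θ o - ((co c o : ℝ) : UnitAddCircle)‖ → H (rept c θ) = 0 := by
    intro θ o ho
    apply hH0
    rw [← repo_norm, ← co_rept] at ho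
    exact ho.trans_le (co_le_dist _ _ _)
  have hcont : Continuous fun θ => H (rept c θ) := by
    rw [continuous_iff_continuousAt]
    intro θ
    by_cases hθ : ∃ o, 1/4 < ‖θ o - ((co c o : ℝ) : UnitAddCircle)‖
    · obtain ⟨o, ho⟩ := hθ
      have hc : Continuous fun θ : UnitAddTorus (Option (Fin d)) =>
          ‖θ o - ((co c o : ℝ) : UnitAddCircle)‖ :=
        ((continuous_apply o).sub continuous_const).norm
      have : ∀ᶠ θ' in 𝓝 θ, H (rept c θ') = 0 := by
        filter_upwards [hc.continuousAt.eventually (lt_mem_nhds ho)] with θ' h using hzero θ' o h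
      exact (continuousAt_congr this).mpr continuousAt_const
    · push Not at hθ
      have hr : ∀ o, ContinuousAt (fun θ => repo c θ o) θ := by
        intro o
        have h1 : θ o ≠ ((co c o - 1/2 : ℝ) : AddCircle (1:ℝ)) := by
          intro h
          have h2 := hθ o
          rw [h] at h2
          have h3 : ‖(((co c o - 1/2) - co c o : ℝ) : UnitAddCircle)‖ ≤ 1/4 := h2
          rw [(AddCircle.norm_coe_eq_abs_iff (1:ℝ) (by norm_num)).mpr] at h3
          · norm_num at h3
          · norm_num
        have h2 := AddCircle.continuousAt_equivIco (p := (1:ℝ)) (a := co c o - 1/2) h1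
        have h3 : ContinuousAt (fun θ : UnitAddTorus (Option (Fin d)) => θ o) θ :=
          (continuous_apply o).continuousAt
        exact continuous_subtype_val.continuousAt.comp
          (ContinuousAt.comp (f := fun θ : UnitAddTorus (Option (Fin d)) => θ o) h2 h3)
      refine hH.continuousAt.comp (ContinuousAt.prodMk ?_ (hr none))
      exact continuousAt_pi.mpr fun j => hr (some j)
  refine ⟨⟨fun θ => (H (rept c θ) : ℂ), Complex.continuous_ofReal.comp hcont⟩, fun q hq => ?_⟩
  simp only [ContinuousMap.coe_mk]
  congr 1
  have hq' : ∀ o, |co q o - co c o| ≤ 1/2 := fun o => (co_le_dist q c o).trans hq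
  by_cases hd : ∃ o, 1/4 < |co q o - co c o|
  · obtain ⟨o, ho⟩ := hd
    rw [hzero _ o (by rw [tor_norm c q o (hq' o)]; exact ho), hH0 q (ho.trans_le (co_le_dist _ _ _))]
  · push Not at hd
    congr 1
    have h1 : ∀ o, repo c (tor q.1 q.2) o = co q o := by
      intro o
      have h2 := abs_le.mp (hd o)
      have := AddCircle.equivIco_coe_eq (p := (1:ℝ)) (a := co c o - 1/2) (x := co q o)
        ⟨by linarith, by linarith⟩
      exact congrArg Subtype.val this
    exact Prod.ext (funext fun j => h1 (some j)) (h1 none)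

lemma approx_torus {H : (Fin d → ℝ) × ℝ → ℝ} (hH : Continuous H) {c : (Fin d → ℝ) × ℝ}
    (hH0 : ∀ q, 1/4 < dist q c → H q = 0) {ε : ℝ} (hε : 0 < ε) :
    ∃ V : (Fin d → ℝ) → ℝ → ℝ, Good V ∧ ∀ q, dist q c ≤ 1/2 →
      |H q - (Pt V q.1 q.2 + V q.1 q.2)| ≤ ε := by
  obtain ⟨G, hG⟩ := lift_torus hH hH0
  have hmem : G ∈ (Submodule.span ℂ
      (range (UnitAddTorus.mFourier (d := Option (Fin d))))).topologicalClosure := by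
    rw [UnitAddTorus.span_mFourier_closure_eq_top]; trivial
  have hmem' : G ∈ closure ((Submodule.span ℂ
      (range (UnitAddTorus.mFourier (d := Option (Fin d))))) : Set _) := hmem
  obtain ⟨g, hg, hdist⟩ := Metric.mem_closure_iff.mp hmem' ε hε
  obtain ⟨V₁, V₂, a1, a2, a3, a4⟩ := trig_solve g hg
  refine ⟨V₁, a1, fun q hq => ?_⟩
  rw [a3]
  have h1 : H q - (g (tor q.1 q.2)).re = (G (tor q.1 q.2) - g (tor q.1 q.2)).re := by
    rw [hG q hq]; simp
  rw [h1]
  refine (Complex.abs_re_le_norm _).trans ?_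
  rw [← dist_eq_norm]
  exact (ContinuousMap.dist_apply_le_dist _).trans hdist.le

lemma round_far {s : ℝ} (h1 : 1/4 < |s|) (h2 : |s| < 3/4) : 1/4 < |s - round s| := by
  rcases lt_trichotomy (round s) 0 with h | h | h
  · have h3 : round s ≤ -1 := by omega
    have h4 : ((round s : ℤ) : ℝ) ≤ -1 := by exact_mod_cast h3
    have := (abs_lt.mp h2).1
    exact lt_of_lt_of_le (by linarith) (le_abs_self _)
  · rw [h]; simpa using h1
  · have h3 : 1 ≤ round s := by omega
    have h4 : (1:ℝ) ≤ ((round s : ℤ) : ℝ) := by exact_mod_cast h3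
    have := (abs_lt.mp h2).2
    exact lt_of_lt_of_le (by linarith) (neg_le_abs _)

lemma torus_max {w V : (Fin d → ℝ) → ℝ → ℝ} (hw : Cl univ w) (hV : Good V)
    {c : (Fin d → ℝ) × ℝ} (hw0 : ∀ q, 1/4 < dist q c → w q.1 q.2 = 0) {ε : ℝ}
    (hle : ∀ q : (Fin d → ℝ) × ℝ, dist q c ≤ 1/2 →
      Pt w q.1 q.2 + w q.1 q.2 - (Pt V q.1 q.2 + V q.1 q.2) ≤ ε) :
    ∀ q : (Fin d → ℝ) × ℝ, dist q c ≤ 1/2 → w q.1 q.2 - V q.1 q.2 ≤ ε := by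
  have hZ : Cl univ (fun x t => w x t - V x t) := hw.sub hV.cl
  have hcont : Continuous fun q : (Fin d → ℝ) × ℝ => w q.1 q.2 - V q.1 q.2 := by
    have := hZ.c
    rwa [univ_prod_univ, continuousOn_univ] at this
  obtain ⟨q, hqm, hmax⟩ := (isCompact_closedBall c (1/2 : ℝ)).exists_isMaxOn
    ⟨c, Metric.mem_closedBall_self (by norm_num)⟩ hcont.continuousOn
  have hlm : IsLocalMax (fun q : (Fin d → ℝ) × ℝ => w q.1 q.2 - V q.1 q.2) q := by
    rcases (Metric.mem_closedBall.mp hqm).lt_or_eq with h | h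
    · filter_upwards [Metric.isOpen_ball.mem_nhds (Metric.mem_ball.mpr h)] with p hp
      exact hmax (Metric.ball_subset_closedBall hp)
    · have hcd : Continuous fun p => dist p c := by fun_prop
      filter_upwards [hcd.continuousAt.eventually (lt_mem_nhds (show (1/4 : ℝ) < dist q c by rw [h]; norm_num)),
        hcd.continuousAt.eventually (gt_mem_nhds (show dist q c < 3/4 by rw [h]; norm_num))] with p h1 h2
      set p' : (Fin d → ℝ) × ℝ := (fun j => p.1 j + ((- round (p.1 j - c.1 j) : ℤ) : ℝ),
        p.2 + ((- round (p.2 - c.2) : ℤ) : ℝ)) with hp'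
      have hco : ∀ o, co p' o - co c o = (co p o - co c o) - round (co p o - co c o) := by
        intro o
        cases o <;> simp [hp', co] <;> ring
      have hVp : V p'.1 p'.2 = V p.1 p.2 := hV.per _ _ _ _
      have hp'm : p' ∈ Metric.closedBall c (1/2) := by
        refine dist_le_of_co (by norm_num) fun o => ?_
        rw [hco]; exact abs_sub_round _
      obtain ⟨o, ho⟩ := exists_co (by norm_num) h1
      have hfar : 1/4 < dist p' c := by
        refine lt_of_lt_of_le ?_ (co_le_dist p' c o)
        rw [hco]
        exact round_far ho ((co_le_dist p c o).trans_lt h2)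
      have := hmax hp'm
      simp only [mem_setOf_eq] at this
      rw [hw0 p' hfar, hVp] at this
      rw [hw0 p h1]
      exact this
  have hm : w q.1 q.2 - V q.1 q.2 ≤ ε := by
    have hx : IsLocalMax (fun x => w x q.2 - V x q.2) q.1 := by
      have hc : Tendsto (fun x : Fin d → ℝ => (x, q.2)) (𝓝 q.1) (𝓝 q) := by
        have : Continuous (fun x : Fin d → ℝ => (x, q.2)) := by fun_prop
        exact this.tendsto q.1
      exact hc.eventually hlm
    have ht : IsLocalMax (fun t => w q.1 t - V q.1 t) q.2 := by
      have hc : Tendsto (fun t : ℝ => (q.1, t)) (𝓝 q.2) (𝓝 q) := by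
        have : Continuous (fun t : ℝ => (q.1, t)) := by fun_prop
        exact this.tendsto q.2
      exact hc.eventually hlm
    have h1 : lap (fun x => w x q.2 - V x q.2) q.1 ≤ 0 :=
      lap_nonpos_of_max isOpen_univ (hZ.x q.2) (mem_univ _) hx
    have h2 : deriv (fun t => w q.1 t - V q.1 t) q.2 = 0 := ht.deriv_eq_zero
    have h3 : 0 ≤ Pt (fun x t => w x t - V x t) q.1 q.2 := by
      unfold Pt; rw [h2]; linarith
    rw [Pt_sub isOpen_univ hw hV.cl (mem_univ _)] at h3
    have := hle q hqm
    linarith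
  intro p hp
  exact (hmax (show p ∈ Metric.closedBall c (1/2) from hp)).trans hm

end torus
end part5

section part6
open Set MeasureTheory Filter Topology
open scoped ContDiff

section approx
variable {d : ℕ}

/-- space derivative on space-time -/
noncomputable def dd (i : Fin d) (U : (Fin d → ℝ) × ℝ → ℝ) (q : (Fin d → ℝ) × ℝ) : ℝ :=
  fderiv ℝ U q (Pi.single i 1, 0)

/-- time derivative on space-time -/
noncomputable def dt (U : (Fin d → ℝ) × ℝ → ℝ) (q : (Fin d → ℝ) × ℝ) : ℝ :=
  fderiv ℝ U q (0, 1)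

lemma pd_eq_dd {U : (Fin d → ℝ) × ℝ → ℝ} {x : Fin d → ℝ} {t : ℝ}
    (hU : DifferentiableAt ℝ U (x, t)) (i : Fin d) :
    pd i (fun y => U (y, t)) x = dd i U (x, t) := by
  unfold pd dd
  have h1 : HasFDerivAt (fun y : Fin d → ℝ => (y, t))
      ((ContinuousLinearMap.id ℝ (Fin d → ℝ)).prod 0) x :=
    (hasFDerivAt_id x).prodMk (hasFDerivAt_const t x)
  have h2 := (hU.hasFDerivAt.comp x h1).fderiv
  have h3 : (U ∘ fun y => (y, t)) = fun y => U (y, t) := rfl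
  rw [h3] at h2
  rw [h2]; simp

lemma deriv_eq_dt {U : (Fin d → ℝ) × ℝ → ℝ} {x : Fin d → ℝ} {t : ℝ}
    (hU : DifferentiableAt ℝ U (x, t)) :
    deriv (fun s => U (x, s)) t = dt U (x, t) := by
  unfold dt
  have h1 : HasDerivAt (fun s : ℝ => (x, s)) ((0 : Fin d → ℝ), (1:ℝ)) t :=
    (hasDerivAt_const t x).prodMk (hasDerivAt_id t)
  exact (hU.hasFDerivAt.comp_hasDerivAt t h1).deriv

lemma dd_smooth {U : (Fin d → ℝ) × ℝ → ℝ} (hU : ContDiff ℝ ∞ U) (i : Fin d) :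
    ContDiff ℝ ∞ (dd i U) :=
  (hU.fderiv_right (m := ∞) (by simp)).clm_apply contDiff_const

lemma dt_smooth {U : (Fin d → ℝ) × ℝ → ℝ} (hU : ContDiff ℝ ∞ U) :
    ContDiff ℝ ∞ (dt U) :=
  (hU.fderiv_right (m := ∞) (by simp)).clm_apply contDiff_const

lemma Pt_eq {U : (Fin d → ℝ) × ℝ → ℝ} (hU : ContDiff ℝ ∞ U) (x : Fin d → ℝ) (t : ℝ) :
    Pt (fun x t => U (x, t)) x t = dt U (x, t) - ∑ i, dd i (dd i U) (x, t) := by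
  unfold Pt lap
  have hd := hU.differentiable (by norm_num)
  rw [deriv_eq_dt (hd _)]
  congr 1
  refine Finset.sum_congr rfl fun i _ => ?_
  have h1 : pd i (fun y => U (y, t)) = fun y => dd i U (y, t) :=
    funext fun y => pd_eq_dd (hd _) i
  rw [h1, pd_eq_dd ((dd_smooth hU i).differentiable (by norm_num) _) i]

lemma dd_zero_of_notMem {U : (Fin d → ℝ) × ℝ → ℝ} {q} (hq : q ∉ tsupport U) (i : Fin d) :
    dd i U q = 0 := by
  unfold dd
  rw [(notMem_tsupport_iff_eventuallyEq.mp hq).fderiv_eq]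
  simp

lemma dt_zero_of_notMem {U : (Fin d → ℝ) × ℝ → ℝ} {q} (hq : q ∉ tsupport U) :
    dt U q = 0 := by
  unfold dt
  rw [(notMem_tsupport_iff_eventuallyEq.mp hq).fderiv_eq]
  simp

lemma tsupport_dd (U : (Fin d → ℝ) × ℝ → ℝ) (i : Fin d) : tsupport (dd i U) ⊆ tsupport U := by
  refine closure_minimal (fun q hq => ?_) isClosed_closure
  by_contra h
  exact hq (dd_zero_of_notMem h i)

lemma tsupport_dt (U : (Fin d → ℝ) × ℝ → ℝ) : tsupport (dt U) ⊆ tsupport U := by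
  refine closure_minimal (fun q hq => ?_) isClosed_closure
  by_contra h
  exact hq (dt_zero_of_notMem h)

lemma Pt_zero_of_notMem {U : (Fin d → ℝ) × ℝ → ℝ} (hU : ContDiff ℝ ∞ U) {x : Fin d → ℝ} {t : ℝ}
    (hq : (x, t) ∉ tsupport U) : Pt (fun x t => U (x, t)) x t = 0 := by
  rw [Pt_eq hU, dt_zero_of_notMem hq]
  have : ∀ i, dd i (dd i U) (x, t) = 0 := fun i =>
    dd_zero_of_notMem (fun h => hq (tsupport_dd U i h)) i
  simp [this]

lemma bdd_of_compact {F : (Fin d → ℝ) × ℝ → ℝ} (hF : Continuous F) (hc : HasCompactSupport F) :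
    ∃ B, 0 ≤ B ∧ ∀ q, |F q| ≤ B := by
  obtain ⟨B, hB⟩ := hF.bounded_above_of_compact_support hc
  exact ⟨B, (norm_nonneg _).trans (hB 0), hB⟩

/-- joint bounds for a compactly supported smooth function -/
lemma bounds_of_compact {U : (Fin d → ℝ) × ℝ → ℝ} (hU : ContDiff ℝ ∞ U)
    (hc : HasCompactSupport U) : ∃ B, 0 ≤ B ∧ ∀ x t, |U (x, t)| ≤ B ∧
      (∀ i, |dd i U (x, t)| ≤ B) ∧ |Pt (fun x t => U (x, t)) x t| ≤ B := by
  obtain ⟨B0, h0, hB0⟩ := bdd_of_compact hU.continuous hc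
  have hc1 : ∀ i, HasCompactSupport (dd i U) := fun i =>
    HasCompactSupport.of_support_subset_isCompact hc ((subset_tsupport _).trans (tsupport_dd U i))
  choose B1 h1 hB1 using fun i => bdd_of_compact (dd_smooth hU i).continuous (hc1 i)
  have hPc : Continuous (fun q : (Fin d → ℝ) × ℝ => Pt (fun x t => U (x, t)) q.1 q.2) := by
    simp_rw [Pt_eq hU]
    exact (dt_smooth hU).continuous.sub
      (continuous_finsetSum _ fun i _ => (dd_smooth (dd_smooth hU i) i).continuous)
  obtain ⟨B2, h2, hB2⟩ := bdd_of_compact hPc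
    (HasCompactSupport.of_support_subset_isCompact hc (fun q hq => by
      by_contra h
      exact hq (Pt_zero_of_notMem hU h)))
  have hs : 0 ≤ ∑ i, B1 i := Finset.sum_nonneg fun i _ => h1 i
  refine ⟨B0 + (∑ i, B1 i) + B2, by positivity, fun x t => ⟨?_, fun i => ?_, ?_⟩⟩
  · linarith [hB0 (x, t)]
  · have := Finset.single_le_sum (f := B1) (fun i _ => h1 i) (Finset.mem_univ i)
    linarith [hB1 i (x, t)]
  · linarith [hB2 (x, t)]

lemma approx {w : (Fin d → ℝ) → ℝ → ℝ} (hw : Cl univ w)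
    (hPc : Continuous fun q : (Fin d → ℝ) × ℝ => Pt w q.1 q.2) {c : (Fin d → ℝ) × ℝ}
    {K O : Set ((Fin d → ℝ) × ℝ)} (hK : IsClosed K) (hO : IsOpen O) (hKO : K ⊆ O)
    (hOc : O ⊆ Metric.closedBall c (1/4)) (hw0 : ∀ x t, (x, t) ∉ K → w x t = 0)
    {ε : ℝ} (hε : 0 < ε) :
    ∃ U : (Fin d → ℝ) × ℝ → ℝ, ContDiff ℝ ∞ U ∧ HasCompactSupport U ∧ tsupport U ⊆ O ∧
      ∀ x t, |U (x, t) - w x t| ≤ ε ∧ (∀ i, |dd i U (x, t) - pd i (fun y => w y t) x| ≤ ε) ∧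
        |Pt (fun x t => U (x, t)) x t - Pt w x t| ≤ ε := by
  obtain ⟨χ, hχ, hχ1, hχs, hχb⟩ := exists_cutoff hK hO hKO
  have hχc : HasCompactSupport χ :=
    (isCompact_closedBall c (1/4 : ℝ)).of_isClosed_subset (isClosed_tsupport _) (hχs.trans hOc)
  obtain ⟨B, hB0, hB⟩ := bounds_of_compact hχ hχc
  -- choose small parameter
  obtain ⟨δ, hδ, hδ1, hδ2, hδ3⟩ : ∃ δ > 0, B * δ ≤ ε ∧
      B * δ + B * (3 * √(δ * KB d (1/8) δ (2 * δ))) ≤ ε ∧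
      B * (2 * δ) + B * δ + 2 * (d * (B * (3 * √(δ * KB d (1/8) δ (2 * δ))))) ≤ ε := by
    have hc : ∀ᶠ δ in 𝓝[>] (0:ℝ), B * δ ≤ ε ∧
      B * δ + B * (3 * √(δ * KB d (1/8) δ (2 * δ))) ≤ ε ∧
      B * (2 * δ) + B * δ + 2 * (d * (B * (3 * √(δ * KB d (1/8) δ (2 * δ))))) ≤ ε := by
      refine Filter.Eventually.filter_mono nhdsWithin_le_nhds ?_
      refine (Filter.Eventually.and ?_ (Filter.Eventually.and ?_ ?_))
      · have : Continuous fun δ => B * δ := by fun_prop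
        exact (this.tendsto 0).eventually (ge_mem_nhds (by simpa using hε))
      · have : Continuous fun δ => B * δ + B * (3 * √(δ * KB d (1/8) δ (2 * δ))) := by
          unfold KB; fun_prop
        exact (this.tendsto 0).eventually (ge_mem_nhds (by simpa using hε))
      · have : Continuous fun δ => B * (2 * δ) + B * δ
            + 2 * (d * (B * (3 * √(δ * KB d (1/8) δ (2 * δ))))) := by
          unfold KB; fun_prop
        exact (this.tendsto 0).eventually (ge_mem_nhds (by simpa using hε))
    obtain ⟨δ, h1, h2⟩ := (hc.and self_mem_nhdsWithin).exists
    exact ⟨δ, h2, h1⟩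
  have hw0' : ∀ q, 1/4 < dist q c → w q.1 q.2 = 0 := fun q hq =>
    hw0 _ _ fun h => absurd (hOc (hKO h)) (by simpa using hq)
  have hwc : Continuous fun q : (Fin d → ℝ) × ℝ => w q.1 q.2 := by
    have := hw.c
    rwa [univ_prod_univ, continuousOn_univ] at this
  have hPw0 : ∀ q, 1/4 < dist q c → Pt w q.1 q.2 = 0 := by
    intro q hq
    have hev : ∀ᶠ p in 𝓝 q, w p.1 p.2 = 0 := by
      have hcd : Continuous fun p => dist p c := by fun_prop
      filter_upwards [hcd.continuousAt.eventually (lt_mem_nhds hq)] with p hp using hw0' p hp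
    have h1 : (fun y => w y q.2) =ᶠ[𝓝 q.1] fun _ => 0 := by
      have hc : Tendsto (fun x : Fin d → ℝ => (x, q.2)) (𝓝 q.1) (𝓝 q) := by
        have : Continuous (fun x : Fin d → ℝ => (x, q.2)) := by fun_prop
        exact this.tendsto q.1
      exact hc.eventually hev
    have h2 : w q.1 =ᶠ[𝓝 q.2] fun _ => 0 := by
      have hc : Tendsto (fun t : ℝ => (q.1, t)) (𝓝 q.2) (𝓝 q) := by
        have : Continuous (fun t : ℝ => (q.1, t)) := by fun_prop
        exact this.tendsto q.2
      exact hc.eventually hev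
    unfold Pt
    rw [lap_congr h1, h2.deriv_eq]
    have h3 : ∀ i : Fin d, pd i (fun _ : Fin d → ℝ => (0:ℝ)) = fun _ => 0 :=
      fun i => funext fun x => pd_const 0 i x
    simp [lap, h3]
  obtain ⟨V, hV, hVe⟩ := approx_torus (H := fun q => Pt w q.1 q.2 + w q.1 q.2) (hPc.add hwc)
    (c := c) (fun q hq => by rw [hPw0 q hq, hw0' q hq, add_zero]) hδ
  set Z : (Fin d → ℝ) → ℝ → ℝ := fun x t => V x t - w x t with hZdef
  have hZ : Cl univ Z := hV.cl.sub hw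
  have hZb : ∀ q : (Fin d → ℝ) × ℝ, dist q c ≤ 1/2 → |Z q.1 q.2| ≤ δ := by
    intro q hq
    rw [abs_le]
    constructor
    · have := torus_max hw hV hw0' (ε := δ) (fun p hp => (abs_le.mp (hVe p hp)).2) q hq
      simp only [hZdef]; linarith
    · have hVn : Good (fun x t => - V x t) :=
        ⟨hV.smooth.neg, fun x t m k => by rw [hV.per]⟩
      have := torus_max hw.neg hVn (c := c) (fun p hp => by rw [hw0' p hp, neg_zero]) (ε := δ)
        (fun p hp => by
          rw [Pt_neg, Pt_neg]
          have := (abs_le.mp (hVe p hp)).1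
          linarith) q hq
      simp only [hZdef]; linarith
  have hPZ : ∀ q : (Fin d → ℝ) × ℝ, dist q c ≤ 1/2 → |Pt Z q.1 q.2| ≤ 2 * δ := by
    intro q hq
    have h1 := hZb q hq
    have h2 := hVe q hq
    rw [Pt_sub isOpen_univ hV.cl hw (mem_univ _)]
    simp only [hZdef] at h1
    rw [abs_le] at h1 h2 ⊢
    constructor <;> linarith [h1.1, h1.2, h2.1, h2.2]
  have hdZ : ∀ q : (Fin d → ℝ) × ℝ, dist q c ≤ 1/4 → ∀ i,
      |pd i (fun y => Z y q.2) q.1| ≤ 3 * √(δ * KB d (1/8) δ (2 * δ)) := by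
    intro q hq i
    have hin : ∀ x ∈ Metric.closedBall q.1 (1/8 : ℝ), ∀ s ∈ Icc (q.2 - 1/8) q.2,
        dist (x, s) c ≤ 1/2 := by
      intro x hx s hs
      have h1 : dist (x, s) q ≤ 1/8 := by
        rw [Prod.dist_eq, max_le_iff]
        refine ⟨hx, ?_⟩
        rw [Real.dist_eq, abs_le]
        constructor <;> simp only <;> linarith [hs.1, hs.2]
      linarith [dist_triangle (x, s) q c]
    exact lemB isOpen_univ hZ (by norm_num) hδ (subset_univ _)
      (fun x hx s hs => hZb (x, s) (hin x hx s hs)) (fun x hx s hs => hPZ (x, s) (hin x hx s hs)) i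
  set G := 3 * √(δ * KB d (1/8) δ (2 * δ)) with hG
  have hG0 : 0 ≤ G := by positivity
  have hU : ContDiff ℝ ∞ (fun q : (Fin d → ℝ) × ℝ => χ q * V q.1 q.2) := hχ.mul hV.smooth
  have hχCl : Cl univ (fun (x : Fin d → ℝ) t => χ (x, t)) := Cl_of_contDiff hχ
  have hUw : ∀ x t, χ (x, t) * V x t - w x t = χ (x, t) * Z x t := by
    intro x t
    by_cases hq : (x, t) ∈ K
    · rw [(hχ1 _ hq).self_of_nhds]; simp [hZdef]
    · rw [hw0 x t hq]; simp [hZdef, hw0 x t hq]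
  have hUCl : Cl univ (fun (x : Fin d → ℝ) t => χ (x, t) * V x t) := hχCl.mul hV.cl
  refine ⟨_, hU, hχc.mul_right, (tsupport_mul_subset_left).trans hχs, fun x t => ?_⟩
  have hbB := hB x t
  have key : ∀ (a b A C : ℝ), |a| ≤ A → |b| ≤ C → 0 ≤ A → |a * b| ≤ A * C := by
    intro a b A C h1 h2 h3
    rw [abs_mul]; exact mul_le_mul h1 h2 (abs_nonneg _) h3
  have hd := hχ.differentiable (by norm_num)
  have hpχ : ∀ i, pd i (fun y => χ (y, t)) x = dd i χ (x, t) := fun i => pd_eq_dd (hd _) i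
  have hdiff : ∀ i, dd i (fun q : (Fin d → ℝ) × ℝ => χ q * V q.1 q.2) (x, t)
      - pd i (fun y => w y t) x
      = χ (x, t) * pd i (fun y => Z y t) x + dd i χ (x, t) * Z x t := by
    intro i
    rw [← pd_eq_dd (hU.differentiable (by norm_num) _) i]
    simp only
    rw [← pd_sub i (c2_diff isOpen_univ (hUCl.x t) (mem_univ x))
      (c2_diff isOpen_univ (hw.x t) (mem_univ x))]
    simp_rw [hUw]
    rw [pd_mul i (c2_diff isOpen_univ (hχCl.x t) (mem_univ x))
      (c2_diff isOpen_univ (hZ.x t) (mem_univ x)), hpχ]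
  have hPdiff : Pt (fun x t => χ (x, t) * V x t) x t - Pt w x t
      = χ (x, t) * Pt Z x t + Pt (fun x t => χ (x, t)) x t * Z x t
        - 2 * ∑ i, dd i χ (x, t) * pd i (fun y => Z y t) x := by
    rw [← Pt_sub isOpen_univ hUCl hw (mem_univ x)]
    simp_rw [hUw]
    rw [Pt_mul isOpen_univ hχCl hZ (mem_univ x)]
    simp_rw [hpχ]
  by_cases hq : (x, t) ∈ tsupport χ
  · have hq4 : dist (x, t) c ≤ 1/4 := hOc (hχs hq)
    have hq2 : dist (x, t) c ≤ 1/2 := by linarith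
    have z0 := hZb _ hq2
    have z1 := hdZ _ hq4
    have z2 := hPZ _ hq2
    simp only at z0 z1 z2
    refine ⟨?_, fun i => ?_, ?_⟩
    · simp only
      rw [hUw]
      exact (key _ _ _ _ hbB.1 z0 hB0).trans hδ1
    · rw [hdiff i]
      refine (abs_add_le _ _).trans ?_
      have e1 := key _ _ _ _ hbB.1 (z1 i) hB0
      have e2 := key _ _ _ _ (hbB.2.1 i) z0 hB0
      linarith
    · simp only
      rw [hPdiff]
      have e1 := key _ _ _ _ hbB.1 z2 hB0
      have e2 := key _ _ _ _ hbB.2.2 z0 hB0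
      have e3 : |∑ i, dd i χ (x, t) * pd i (fun y => Z y t) x| ≤ d * (B * G) := by
        refine (Finset.abs_sum_le_sum_abs _ _).trans ?_
        refine (Finset.sum_le_card_nsmul _ _ (B * G) fun i _ =>
          key _ _ _ _ (hbB.2.1 i) (z1 i) hB0).trans ?_
        simp
      rw [abs_le] at e1 e2 e3 ⊢
      constructor <;> linarith [e1.1, e1.2, e2.1, e2.2, e3.1, e3.2]
  · have c0 : χ (x, t) = 0 := image_eq_zero_of_notMem_tsupport hq
    have c1 : ∀ i, dd i χ (x, t) = 0 := fun i => dd_zero_of_notMem hq i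
    have c2 := Pt_zero_of_notMem hχ hq
    refine ⟨?_, fun i => ?_, ?_⟩
    · simp only
      rw [hUw, c0]; simpa using hε.le
    · rw [hdiff i, c0, c1]; simpa using hε.le
    · simp only
      rw [hPdiff, c0, c2]; simpa [c1] using hε.le

end approx
end part6

section part7
open Set MeasureTheory Filter Topology
open scoped ContDiff

section hdc
variable {d : ℕ}

/-- `f` is smooth with directional derivative `f'` in direction `e` -/
structure HD (e : (Fin d → ℝ) × ℝ) (f f' : (Fin d → ℝ) × ℝ → ℝ) : Prop where
  s : ContDiff ℝ ∞ f
  d : ∀ q, fderiv ℝ f q e = f' q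

namespace HD
variable {e : (Fin d → ℝ) × ℝ} {f f' g g' : (Fin d → ℝ) × ℝ → ℝ}

lemma df (h : HD e f f') (q) : DifferentiableAt ℝ f q := h.s.differentiable (by norm_num) q

lemma add (hf : HD e f f') (hg : HD e g g') :
    HD e (fun q => f q + g q) (fun q => f' q + g' q) :=
  ⟨hf.s.add hg.s, fun q => by
    have := ((hf.df q).hasFDerivAt.add (hg.df q).hasFDerivAt).fderiv
    have h2 : (f + g) = fun q => f q + g q := rfl
    rw [h2] at this
    rw [this, ← hf.d, ← hg.d]; rfl⟩

lemma mul (hf : HD e f f') (hg : HD e g g') :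
    HD e (fun q => f q * g q) (fun q => f' q * g q + f q * g' q) :=
  ⟨hf.s.mul hg.s, fun q => by
    have := ((hf.df q).hasFDerivAt.mul (hg.df q).hasFDerivAt).fderiv
    have h2 : (f * g) = fun q => f q * g q := rfl
    rw [h2] at this
    rw [this, ← hf.d, ← hg.d]
    simp; ring⟩

lemma cm (c : ℝ) (hf : HD e f f') : HD e (fun q => c * f q) (fun q => c * f' q) :=
  ⟨contDiff_const.mul hf.s, fun q => by
    have := ((hf.df q).hasFDerivAt.const_mul c).fderiv
    rw [this, ← hf.d]; simp⟩

lemma sum {F F' : Fin d → (Fin d → ℝ) × ℝ → ℝ} (h : ∀ i, HD e (F i) (F' i)) :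
    HD e (fun q => ∑ i, F i q) (fun q => ∑ i, F' i q) :=
  ⟨ContDiff.sum fun i _ => (h i).s, fun q => by
    have := (HasFDerivAt.fun_sum (u := Finset.univ) fun i _ => ((h i).df q).hasFDerivAt).fderiv
    rw [this, sum_apply]
    exact Finset.sum_congr rfl fun i _ => (h i).d q⟩

lemma of (hf : ContDiff ℝ ∞ f) : HD e f (fun q => fderiv ℝ f q e) := ⟨hf, fun _ => rfl⟩

lemma exp (hf : HD e f f') : HD e (fun q => Real.exp (f q)) (fun q => f' q * Real.exp (f q)) :=
  ⟨hf.s.exp, fun q => by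
    have := ((hf.df q).hasFDerivAt.exp).fderiv
    rw [this, ← hf.d]; simp; ring⟩

lemma congr' (hf : HD e f f') (h : ∀ q, f' q = g' q) : HD e f g' :=
  ⟨hf.s, fun q => (hf.d q).trans (h q)⟩

lemma smooth' (hf : HD e f f') : ContDiff ℝ ∞ f' := by
  have : f' = fun q => fderiv ℝ f q e := funext fun q => (hf.d q).symm
  rw [this]
  exact (hf.s.fderiv_right (m := ∞) (by simp)).clm_apply contDiff_const

lemma zero' (hf : HD e f f') {q} (hq : q ∉ tsupport f) : f' q = 0 := by
  rw [← hf.d, (notMem_tsupport_iff_eventuallyEq.mp hq).fderiv_eq]; simp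

lemma cs' (hf : HD e f f') (hc : HasCompactSupport f) : HasCompactSupport f' :=
  HasCompactSupport.intro hc fun _ hq => hf.zero' hq

lemma int (hf : HD e f f') (hc : HasCompactSupport f) : Integrable f' :=
  hf.smooth'.continuous.integrable_of_hasCompactSupport (hf.cs' hc)

lemma haar_vol : (volume : Measure ((Fin d → ℝ) × ℝ)).IsAddHaarMeasure := by
  rw [Measure.volume_eq_prod]; infer_instance

lemma int_zero (hf : HD e f f') (hc : HasCompactSupport f) : ∫ q, f' q = 0 := by
  haveI := haar_vol (d := d)
  have h := integral_mul_fderiv_eq_neg_fderiv_mul_of_integrable (𝕜 := ℝ)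
    (μ := (volume : Measure ((Fin d → ℝ) × ℝ)))
    (f := fun _ => (1:ℝ)) (g := f) (v := e) (by simp)
    (by simpa [hf.d] using hf.int hc)
    (by simpa using hf.s.continuous.integrable_of_hasCompactSupport hc)
    (fun x _ => by fun_prop) (fun x _ => hf.df x)
  simpa [hf.d] using h

end HD

/-- spatial basis direction -/
noncomputable def ex (i : Fin d) : (Fin d → ℝ) × ℝ := (Pi.single i 1, 0)
/-- time direction -/
noncomputable def et : (Fin d → ℝ) × ℝ := (0, 1)

lemma HD.x {U : (Fin d → ℝ) × ℝ → ℝ} (hU : ContDiff ℝ ∞ U) (i : Fin d) : HD (ex i) U (dd i U) :=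
  ⟨hU, fun _ => rfl⟩
lemma HD.tt {U : (Fin d → ℝ) × ℝ → ℝ} (hU : ContDiff ℝ ∞ U) : HD et U (dt U) :=
  ⟨hU, fun _ => rfl⟩

lemma fderiv_fderiv_apply {U : (Fin d → ℝ) × ℝ → ℝ} (hU : ContDiff ℝ ∞ U) (e e' q) :
    fderiv ℝ (fun p => fderiv ℝ U p e) q e' = fderiv ℝ (fderiv ℝ U) q e' e := by
  have h1 : DifferentiableAt ℝ (fderiv ℝ U) q :=
    (hU.fderiv_right (m := ∞) (by simp)).differentiable (by norm_num) q
  have := (h1.hasFDerivAt.clm_apply (hasFDerivAt_const e q)).fderiv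
  rw [this]; simp

lemma fderiv_symm {U : (Fin d → ℝ) × ℝ → ℝ} (hU : ContDiff ℝ ∞ U) (e e' q) :
    fderiv ℝ (fun p => fderiv ℝ U p e) q e' = fderiv ℝ (fun p => fderiv ℝ U p e') q e := by
  rw [fderiv_fderiv_apply hU, fderiv_fderiv_apply hU]
  have h2 : ContDiffAt ℝ 2 U q := (contDiff_infty.mp hU 2).contDiffAt
  exact (h2.isSymmSndFDerivAt (by simp)).eq e' e

lemma dd_symm {U : (Fin d → ℝ) × ℝ → ℝ} (hU : ContDiff ℝ ∞ U) (i j : Fin d) (q) :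
    dd i (dd j U) q = dd j (dd i U) q := fderiv_symm hU _ _ q

lemma dt_dd {U : (Fin d → ℝ) × ℝ → ℝ} (hU : ContDiff ℝ ∞ U) (i : Fin d) (q) :
    dt (dd i U) q = dd i (dt U) q := fderiv_symm hU _ _ q

/-- coordinates relative to the centre -/
def xi (y : Fin d → ℝ) (j : Fin d) (q : (Fin d → ℝ) × ℝ) : ℝ := q.1 j - y j
/-- squared distance -/
def nn (y : Fin d → ℝ) (q : (Fin d → ℝ) × ℝ) : ℝ := ∑ j, xi y j q * xi y j q
/-- time relative to the centre -/
def th (t0 : ℝ) (q : (Fin d → ℝ) × ℝ) : ℝ := q.2 - t0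
/-- shifted squared distance -/
def gg (y : Fin d → ℝ) (c : ℝ) (q : (Fin d → ℝ) × ℝ) : ℝ := c + (-1) * nn y q
/-- the Carleman weight -/
noncomputable def ph (y : Fin d → ℝ) (c κ t0 : ℝ) (q : (Fin d → ℝ) × ℝ) : ℝ :=
  (1/2) * (gg y c q * gg y c q) + (-κ) * (th t0 q * th t0 q)

lemma HD_const (e : (Fin d → ℝ) × ℝ) (c : ℝ) : HD e (fun _ => c) (fun _ => 0) :=
  ⟨contDiff_const, fun q => by simp⟩

lemma xi_x (y : Fin d → ℝ) (i j : Fin d) :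
    HD (ex i) (xi y j) (fun _ => if j = i then 1 else 0) := by
  have h : ∀ q, HasFDerivAt (xi y j)
    ((ContinuousLinearMap.proj j : (Fin d → ℝ) →L[ℝ] ℝ).comp
      (ContinuousLinearMap.fst ℝ (Fin d → ℝ) ℝ)) q := by
    intro q
    exact (((ContinuousLinearMap.proj j : (Fin d → ℝ) →L[ℝ] ℝ).comp
      (ContinuousLinearMap.fst ℝ (Fin d → ℝ) ℝ)).hasFDerivAt).sub_const (y j)
  refine ⟨?_, fun q => ?_⟩
  · unfold xi; fun_prop
  · rw [(h q).fderiv]; simp [ex, Pi.single_apply]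

lemma xi_t (y : Fin d → ℝ) (j : Fin d) : HD et (xi y j) (fun _ => 0) := by
  have h : ∀ q, HasFDerivAt (xi y j)
    ((ContinuousLinearMap.proj j : (Fin d → ℝ) →L[ℝ] ℝ).comp
      (ContinuousLinearMap.fst ℝ (Fin d → ℝ) ℝ)) q := by
    intro q
    exact (((ContinuousLinearMap.proj j : (Fin d → ℝ) →L[ℝ] ℝ).comp
      (ContinuousLinearMap.fst ℝ (Fin d → ℝ) ℝ)).hasFDerivAt).sub_const (y j)
  refine ⟨?_, fun q => ?_⟩
  · unfold xi; fun_prop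
  · rw [(h q).fderiv]; simp [et]

lemma th_x (t0 : ℝ) (i : Fin d) : HD (ex i) (th t0) (fun _ => 0) := by
  have h : ∀ q : (Fin d → ℝ) × ℝ, HasFDerivAt (th t0)
      (ContinuousLinearMap.snd ℝ (Fin d → ℝ) ℝ) q := by
    intro q
    exact (ContinuousLinearMap.snd ℝ (Fin d → ℝ) ℝ).hasFDerivAt.sub_const t0
  refine ⟨?_, fun q => ?_⟩
  · unfold th; fun_prop
  · rw [(h q).fderiv]; simp [ex]

lemma th_t (t0 : ℝ) : HD (d := d) et (th t0) (fun _ => 1) := by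
  have h : ∀ q : (Fin d → ℝ) × ℝ, HasFDerivAt (th t0)
      (ContinuousLinearMap.snd ℝ (Fin d → ℝ) ℝ) q := by
    intro q
    exact (ContinuousLinearMap.snd ℝ (Fin d → ℝ) ℝ).hasFDerivAt.sub_const t0
  refine ⟨?_, fun q => ?_⟩
  · unfold th; fun_prop
  · rw [(h q).fderiv]; simp [et]

lemma nn_x (y : Fin d → ℝ) (i : Fin d) : HD (ex i) (nn y) (fun q => 2 * xi y i q) := by
  refine (HD.sum fun j => (xi_x y i j).mul (xi_x y i j)).congr' fun q => ?_
  have : ∀ j, (((if j = i then (1:ℝ) else 0) * xi y j q + xi y j q * (if j = i then (1:ℝ) else 0))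
     = if j = i then 2 * xi y j q else 0) := by intro j; split_ifs <;> ring
  simp only [this]
  simp

lemma nn_t (y : Fin d → ℝ) : HD et (nn y) (fun _ => 0) := by
  refine (HD.sum fun j => (xi_t y j).mul (xi_t y j)).congr' fun q => ?_
  simp

lemma gg_x (y : Fin d → ℝ) (c : ℝ) (i : Fin d) : HD (ex i) (gg y c) (fun q => -2 * xi y i q) :=
  ((HD_const _ c).add ((nn_x y i).cm (-1))).congr' fun q => by ring

lemma gg_t (y : Fin d → ℝ) (c : ℝ) : HD et (gg y c) (fun _ => 0) :=
  ((HD_const _ c).add ((nn_t y).cm (-1))).congr' fun q => by ring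

lemma ph_x (y : Fin d → ℝ) (c κ t0 : ℝ) (i : Fin d) :
    HD (ex i) (ph y c κ t0) (fun q => -2 * (gg y c q * xi y i q)) :=
  ((((gg_x y c i).mul (gg_x y c i)).cm (1/2)).add
    (((th_x t0 i).mul (th_x t0 i)).cm (-κ))).congr' fun q => by ring

lemma ph_t (y : Fin d → ℝ) (c κ t0 : ℝ) :
    HD et (ph y c κ t0) (fun q => -2 * κ * th t0 q) :=
  ((((gg_t y c).mul (gg_t y c)).cm (1/2)).add
    (((th_t t0).mul (th_t t0)).cm (-κ))).congr' fun q => by ring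

end hdc
end part7

section part8
open Set MeasureTheory Filter Topology
open scoped ContDiff

section carl
variable {d : ℕ}

/-- radial derivative -/
noncomputable def TT (y : Fin d → ℝ) (v : (Fin d → ℝ) × ℝ → ℝ) (q : (Fin d → ℝ) × ℝ) : ℝ :=
  ∑ j, xi y j q * dd j v q
/-- squared gradient -/
noncomputable def GM (v : (Fin d → ℝ) × ℝ → ℝ) (q : (Fin d → ℝ) × ℝ) : ℝ :=
  ∑ j, dd j v q * dd j v q
/-- space-time Laplacian -/
noncomputable def LL (v : (Fin d → ℝ) × ℝ → ℝ) (q : (Fin d → ℝ) × ℝ) : ℝ :=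
  ∑ j, dd j (dd j v) q

/-- spatial flux -/
noncomputable def FG (y : Fin d → ℝ) (c κ t0 τ N : ℝ) (v : (Fin d → ℝ) × ℝ → ℝ) (i : Fin d)
    (q : (Fin d → ℝ) × ℝ) : ℝ :=
  (-2) * (dd i v q * dt v q) + (8 * τ) * (gg y c q * (TT y v q * dd i v q))
  + (-4 * τ) * (gg y c q * (xi y i q * GM v q)) + (-2 * τ * N) * (v q * dd i v q)
  + (16 * τ^3) * ((gg y c q * gg y c q * nn y q) * (gg y c q * (xi y i q * (v q * v q))))
  + (-8 * κ * τ^2) * (th t0 q * (gg y c q * (xi y i q * (v q * v q))))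

/-- time flux -/
noncomputable def FH (y : Fin d → ℝ) (c κ t0 τ : ℝ) (v : (Fin d → ℝ) × ℝ → ℝ)
    (q : (Fin d → ℝ) × ℝ) : ℝ :=
  GM v q + (-4 * τ^2) * ((gg y c q * gg y c q * nn y q) * (v q * v q))
  + (2 * κ * τ) * (th t0 q * (v q * v q))

variable {v : (Fin d → ℝ) × ℝ → ℝ}

lemma TT_x (y : Fin d → ℝ) (hv : ContDiff ℝ ∞ v) (i : Fin d) :
    HD (ex i) (TT y v) (fun q => dd i v q + ∑ j, xi y j q * dd i (dd j v) q) := by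
  refine (HD.sum fun j => (xi_x y i j).mul (HD.x (dd_smooth hv j) i)).congr' fun q => ?_
  rw [Finset.sum_add_distrib]
  simp

lemma GM_x (hv : ContDiff ℝ ∞ v) (i : Fin d) :
    HD (ex i) (GM v) (fun q => 2 * ∑ j, dd j v q * dd i (dd j v) q) := by
  refine (HD.sum fun j => (HD.x (dd_smooth hv j) i).mul (HD.x (dd_smooth hv j) i)).congr'
    fun q => ?_
  rw [Finset.mul_sum]
  exact Finset.sum_congr rfl fun j _ => by ring

lemma GM_t (hv : ContDiff ℝ ∞ v) :
    HD et (GM v) (fun q => 2 * ∑ j, dd j v q * dt (dd j v) q) := by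
  refine (HD.sum fun j => (HD.tt (dd_smooth hv j)).mul (HD.tt (dd_smooth hv j))).congr'
    fun q => ?_
  rw [Finset.mul_sum]
  exact Finset.sum_congr rfl fun j _ => by ring

/-- derivative of the spatial flux -/
noncomputable def FG' (y : Fin d → ℝ) (c κ t0 τ N : ℝ) (v : (Fin d → ℝ) × ℝ → ℝ) (i : Fin d)
    (q : (Fin d → ℝ) × ℝ) : ℝ :=
  (-2 * dt v q + 8 * τ * gg y c q * TT y v q - 2 * τ * N * v q) * dd i (dd i v) q
  + (-2) * (dd i v q * dt (dd i v) q)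
  + (-16 * τ * TT y v q + 32 * τ^3 * (gg y c q)^3 * nn y q * v q
      - 16 * κ * τ^2 * th t0 q * gg y c q * v q) * (xi y i q * dd i v q)
  + (8 * τ * gg y c q - 2 * τ * N) * (dd i v q * dd i v q)
  + (8 * τ * gg y c q) * (dd i v q * ∑ j, xi y j q * dd i (dd j v) q)
  + (8 * τ * GM v q + 16 * τ^3 * (2 * (gg y c q)^3 - 6 * (gg y c q)^2 * nn y q) * (v q)^2
      + 16 * κ * τ^2 * th t0 q * (v q)^2) * (xi y i q * xi y i q)
  + (-8 * τ * gg y c q) * (xi y i q * ∑ j, dd j v q * dd i (dd j v) q)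
  + (-4 * τ * gg y c q * GM v q + 16 * τ^3 * (gg y c q)^3 * nn y q * (v q)^2
      - 8 * κ * τ^2 * th t0 q * gg y c q * (v q)^2) * 1

lemma FG_x (y : Fin d → ℝ) (c κ t0 τ N : ℝ) (hv : ContDiff ℝ ∞ v) (i : Fin d) :
    HD (ex i) (FG y c κ t0 τ N v i) (FG' y c κ t0 τ N v i) := by
  have hvi := HD.x (dd_smooth hv i) i
  have hvt := HD.x (dt_smooth hv) i
  have hg := gg_x y c i
  have hx := xi_x y i i
  have hV := HD.x hv i
  have hxv := hx.mul (hV.mul hV)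
  refine ((((((hvi.mul hvt).cm (-2)).add ((hg.mul ((TT_x y hv i).mul hvi)).cm (8 * τ))).add
    ((hg.mul (hx.mul (GM_x hv i))).cm (-4 * τ))).add ((hV.mul hvi).cm (-2 * τ * N))).add
    ((((hg.mul hg).mul (nn_x y i)).mul (hg.mul hxv)).cm (16 * τ^3))).add
    (((th_x t0 i).mul (hg.mul hxv)).cm (-8 * κ * τ^2)) |>.congr' fun q => ?_
  simp only [if_true]
  rw [FG', dt_dd hv]
  ring

lemma FH_t (y : Fin d → ℝ) (c κ t0 τ : ℝ) (hv : ContDiff ℝ ∞ v) :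
    HD et (FH y c κ t0 τ v) (fun q => 2 * (∑ j, dd j v q * dt (dd j v) q)
      - 8 * τ^2 * (gg y c q)^2 * nn y q * v q * dt v q + 2 * κ * τ * (v q)^2
      + 4 * κ * τ * th t0 q * v q * dt v q) := by
  have hg := gg_t y c
  have hV := HD.tt hv
  refine (((GM_t hv).add ((((hg.mul hg).mul (nn_t y)).mul (hV.mul hV)).cm (-4 * τ^2))).add
    (((th_t t0).mul (hV.mul hV)).cm (2 * κ * τ))).congr' fun q => ?_
  ring

lemma div_id (y : Fin d → ℝ) (c κ t0 τ N : ℝ) (hv : ContDiff ℝ ∞ v) (q) :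
    2 * (-LL v q - 4 * τ^2 * (gg y c q)^2 * nn y q * v q + 2 * κ * τ * th t0 q * v q)
      * (dt v q - 4 * τ * gg y c q * TT y v q + τ * N * v q)
    = τ * (16 * (TT y v q)^2 - 8 * gg y c q * GM v q
        + 2 * (N - 4 * nn y q + 2 * d * gg y c q) * GM v q)
      + 8 * τ^3 * (gg y c q)^2 * nn y q *
        (8 * nn y q - 4 * gg y c q - (N - 4 * nn y q + 2 * d * gg y c q)) * (v q)^2
      + (-2 * κ * τ + 4 * κ * τ^2 * th t0 q * (N - 4 * nn y q + 2 * d * gg y c q)) * (v q)^2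
      + ((∑ i, FG' y c κ t0 τ N v i q) + (2 * (∑ j, dd j v q * dt (dd j v) q)
      - 8 * τ^2 * (gg y c q)^2 * nn y q * v q * dt v q + 2 * κ * τ * (v q)^2
      + 4 * κ * τ * th t0 q * v q * dt v q)) := by
  have hQ : ∑ i, (xi y i q * ∑ j, dd j v q * dd i (dd j v) q)
      = ∑ i, (dd i v q * ∑ j, xi y j q * dd i (dd j v) q) := by
    simp_rw [Finset.mul_sum]
    rw [Finset.sum_comm]
    refine Finset.sum_congr rfl fun i _ => Finset.sum_congr rfl fun j _ => ?_
    rw [dd_symm hv i j]; ring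
  have e1 : ∑ i, dd i (dd i v) q = LL v q := rfl
  have e2 : ∑ i, xi y i q * dd i v q = TT y v q := rfl
  have e3 : ∑ i, dd i v q * dd i v q = GM v q := rfl
  have e4 : ∑ i, xi y i q * xi y i q = nn y q := rfl
  simp only [FG', Finset.sum_add_distrib, ← Finset.mul_sum, hQ, e1, e2, e3, e4]
  simp only [Finset.sum_const, Finset.card_univ, Fintype.card_fin, nsmul_eq_mul, mul_one]
  ring

end carl
end part8

section part9
open Set MeasureTheory Filter Topology
open scoped ContDiff

section carl2
variable {d : ℕ}

set_option maxHeartbeats 1000000 in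
lemma carl_alg {a η D n g θ κ δ τ T Γ v S B F dv : ℝ} (ha : 0 < a) (hη : 0 < η) (hD : 0 ≤ D)
    (hDη : (D + 2) * η ≤ 1/16) (hg : g = (1 + 2*η)*a - n) (hn1 : (1-η)*a ≤ n)
    (hn2 : n ≤ (1+3*η/2)*a) (hκ : 0 ≤ κ) (hθ : |θ| ≤ δ) (hτ : 1 ≤ τ)
    (hτ2 : 2*(2*κ+36*κ*δ*a+81*a^2) ≤ τ * (η^2*a^4)) (hΓ : 0 ≤ Γ)
    (hSB : 2 * S * B = τ * (16 * T^2 - 8 * g * Γ + 2 * (8*a - 4 * n + 2 * D * g) * Γ)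
      + 8 * τ^3 * g^2 * n * (8 * n - 4 * g - (8*a - 4 * n + 2 * D * g)) * v^2
      + (-2 * κ * τ + 4 * κ * τ^2 * θ * (8*a - 4 * n + 2 * D * g)) * v^2 + dv)
    (hF : S + B = F + τ * (8*a - 4 * n + 2 * D * g) * v) :
    4*a*τ*Γ + η^2*a^4/2*τ^3*v^2 + dv ≤ F^2 := by
  have hη2 : η ≤ 1/32 := by nlinarith
  have hηa : η * a ≤ a/32 := by nlinarith
  have hηa0 : 0 < η * a := by positivity
  have hn1' : a - η*a ≤ n := by linarith
  have hn2' : n ≤ a + 3/2*(η*a) := by linarith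
  have hg' : g = a + 2*(η*a) - n := by rw [hg]; ring
  have hg1 : η*a/2 ≤ g := by linarith
  have hg2 : g ≤ 3*(η*a) := by linarith
  have hg0 : 0 ≤ g := by linarith
  have hDg0 : 0 ≤ D * g := by positivity
  have hDg : (D+2) * g ≤ 3/16 * a := by
    calc (D+2)*g ≤ (D+2)*(3*(η*a)) := by gcongr
      _ = 3 * ((D+2)*η) * a := by ring
      _ ≤ 3 * (1/16) * a := by gcongr
      _ = _ := by ring
  have hDg' : D * g + 2 * g ≤ 3/16*a := by linarith
  set m := 8*a - 4*n + 2*D*g with hm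
  have hm' : m = 8*a - 4*n + 2*(D*g) := by rw [hm]; ring
  have hm0 : 0 ≤ m := by linarith
  have hm1 : m ≤ 9*a := by linarith
  have hn0 : a/2 ≤ n := by linarith
  have hn00 : 0 ≤ n := by linarith
  have hτ0 : 0 < τ := by linarith
  have k1 : 4*a*τ*Γ ≤ τ * (16 * T^2 - 8 * g * Γ + 2 * m * Γ) := by
    have h1 : 4*a ≤ -8*g + 2*m := by linarith
    have h2 := mul_le_mul_of_nonneg_right h1 (mul_nonneg hτ0.le hΓ)
    have h3 : 0 ≤ τ * (16*T^2) := by positivity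
    linarith
  have k2 : η^2*a^4*τ^3*v^2 ≤ 8 * τ^3 * g^2 * n * (8 * n - 4 * g - m) * v^2 := by
    have h1 : a ≤ 8*n - 4*g - m := by linarith
    have h2 : (η*a/2)^2 ≤ g^2 := by gcongr
    calc η^2*a^4*τ^3*v^2 = 8*τ^3*(η*a/2)^2*(a/2)*a*v^2 := by ring
      _ ≤ 8 * τ^3 * g^2 * n * (8 * n - 4 * g - m) * v^2 := by gcongr
  have k3 : -(2*κ+36*κ*δ*a)*τ^2*v^2 ≤ (-2 * κ * τ + 4 * κ * τ^2 * θ * m) * v^2 := by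
    have h0 := abs_le.mp hθ
    have hδ : 0 ≤ δ := (abs_nonneg _).trans hθ
    have h1 : -(9*a*δ) ≤ θ*m := by
      have := abs_mul θ m
      have h3 : |θ*m| ≤ δ*(9*a) := by
        rw [this, abs_of_nonneg hm0]; gcongr
      have := (abs_le.mp h3).1
      linarith
    have h2 : τ ≤ τ^2 := by nlinarith
    have h3 := mul_le_mul_of_nonneg_left h1 (by positivity : 0 ≤ 4*κ*τ^2)
    have h4 := mul_le_mul_of_nonneg_left h2 (by positivity : 0 ≤ 2*κ)
    have : -(2*κ+36*κ*δ*a)*τ^2 ≤ (-2 * κ * τ + 4 * κ * τ^2 * θ * m) := by linarith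
    exact mul_le_mul_of_nonneg_right this (sq_nonneg v)
  have k4 : τ^2*m^2*v^2 ≤ 81*a^2*τ^2*v^2 := by
    have : m^2 ≤ (9*a)^2 := by gcongr
    calc τ^2*m^2*v^2 ≤ τ^2*(9*a)^2*v^2 := by gcongr
      _ = _ := by ring
  have k5 : (2*κ+36*κ*δ*a+81*a^2)*τ^2*v^2 ≤ η^2*a^4/2*τ^3*v^2 := by
    have h := mul_le_mul_of_nonneg_right hτ2 (by positivity : 0 ≤ τ^2*v^2/2)
    linarith
  have k6 : 2*(2*S*B) ≤ (F + τ*m*v)^2 := by rw [← hF]; linarith [sq_nonneg (S-B)]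
  have k7 : (F + τ*m*v)^2 ≤ 2*F^2 + 2*(τ^2*m^2*v^2) := by linarith [sq_nonneg (F-τ*m*v)]
  linarith

variable {U : (Fin d → ℝ) × ℝ → ℝ}

/-- conjugated function -/
noncomputable def cv (y : Fin d → ℝ) (c κ t0 τ : ℝ) (U : (Fin d → ℝ) × ℝ → ℝ)
    (q : (Fin d → ℝ) × ℝ) : ℝ := Real.exp (τ * ph y c κ t0 q) * U q

lemma cv_x (y : Fin d → ℝ) (c κ t0 τ : ℝ) (hU : ContDiff ℝ ∞ U) (i : Fin d) :
    HD (ex i) (cv y c κ t0 τ U) (fun q => Real.exp (τ * ph y c κ t0 q) *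
      (dd i U q + (-2 * τ) * (gg y c q * (xi y i q * U q)))) :=
  ((((ph_x y c κ t0 i).cm τ).exp).mul (HD.x hU i)).congr' fun q => by ring

lemma cv_t (y : Fin d → ℝ) (c κ t0 τ : ℝ) (hU : ContDiff ℝ ∞ U) :
    HD et (cv y c κ t0 τ U) (fun q => Real.exp (τ * ph y c κ t0 q) *
      (dt U q - 2 * κ * τ * th t0 q * U q)) :=
  ((((ph_t y c κ t0).cm τ).exp).mul (HD.tt hU)).congr' fun q => by ring

lemma cv_dd (y : Fin d → ℝ) (c κ t0 τ : ℝ) (hU : ContDiff ℝ ∞ U) (i : Fin d) :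
    dd i (cv y c κ t0 τ U) = (fun q => Real.exp (τ * ph y c κ t0 q) *
      (dd i U q + (-2 * τ) * (gg y c q * (xi y i q * U q)))) :=
  funext (cv_x y c κ t0 τ hU i).d

lemma cv_dt (y : Fin d → ℝ) (c κ t0 τ : ℝ) (hU : ContDiff ℝ ∞ U) (q) :
    dt (cv y c κ t0 τ U) q = Real.exp (τ * ph y c κ t0 q) *
      (dt U q - 2 * κ * τ * th t0 q * U q) := (cv_t y c κ t0 τ hU).d q

lemma cv_ddd (y : Fin d → ℝ) (c κ t0 τ : ℝ) (hU : ContDiff ℝ ∞ U) (i : Fin d) (q) :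
    dd i (dd i (cv y c κ t0 τ U)) q = Real.exp (τ * ph y c κ t0 q) *
      (dd i (dd i U) q + (-4*τ*gg y c q) * (xi y i q * dd i U q)
        + (4*τ^2*(gg y c q)^2*U q + 4*τ*U q) * (xi y i q * xi y i q)
        + (-2*τ*gg y c q * U q) * 1) := by
  rw [cv_dd y c κ t0 τ hU i]
  have h := (((ph_x y c κ t0 i).cm τ).exp).mul ((HD.x (dd_smooth hU i) i).add
    (((gg_x y c i).mul ((xi_x y i i).mul (HD.x hU i))).cm (-2*τ)))
  refine (h.d q).trans ?_
  simp only [if_true]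
  ring

lemma cv_LL (y : Fin d → ℝ) (c κ t0 τ : ℝ) (hU : ContDiff ℝ ∞ U) (q) :
    LL (cv y c κ t0 τ U) q = Real.exp (τ * ph y c κ t0 q) *
      (LL U q - 4*τ*gg y c q * TT y U q + (4*τ^2*(gg y c q)^2*U q + 4*τ*U q) * nn y q
        - 2*τ*d*gg y c q * U q) := by
  have e1 : ∑ i, dd i (dd i U) q = LL U q := rfl
  have e2 : ∑ i, xi y i q * dd i U q = TT y U q := rfl
  have e4 : ∑ i, xi y i q * xi y i q = nn y q := rfl
  rw [LL]
  simp_rw [cv_ddd y c κ t0 τ hU _ q]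
  simp only [Finset.sum_add_distrib, ← Finset.mul_sum, e1, e2, e4]
  simp only [Finset.sum_const, Finset.card_univ, Fintype.card_fin, nsmul_eq_mul, mul_one]
  ring

lemma cv_TT (y : Fin d → ℝ) (c κ t0 τ : ℝ) (hU : ContDiff ℝ ∞ U) (q) :
    TT y (cv y c κ t0 τ U) q = Real.exp (τ * ph y c κ t0 q) *
      (TT y U q - 2*τ*gg y c q * nn y q * U q) := by
  have e2 : ∑ i, xi y i q * dd i U q = TT y U q := rfl
  have e4 : ∑ i, xi y i q * xi y i q = nn y q := rfl
  rw [TT]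
  have : ∀ i, xi y i q * dd i (cv y c κ t0 τ U) q = Real.exp (τ * ph y c κ t0 q) *
     (xi y i q * dd i U q + (-2*τ*gg y c q * U q) * (xi y i q * xi y i q)) := by
    intro i; rw [cv_dd y c κ t0 τ hU i]; ring
  simp_rw [this]
  simp only [Finset.sum_add_distrib, ← Finset.mul_sum, e2, e4]
  ring

lemma cv_GM (y : Fin d → ℝ) (c κ t0 τ : ℝ) (hU : ContDiff ℝ ∞ U) (q) :
    (Real.exp (τ * ph y c κ t0 q))^2 * GM U q ≤ 2 * GM (cv y c κ t0 τ U) q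
      + 8*τ^2*(gg y c q)^2 * nn y q * (cv y c κ t0 τ U q)^2 := by
  rw [GM, GM, nn, Finset.mul_sum, Finset.mul_sum, Finset.mul_sum, Finset.sum_mul,
    ← Finset.sum_add_distrib]
  refine Finset.sum_le_sum fun i _ => ?_
  rw [cv_dd y c κ t0 τ hU i, cv]
  set E := Real.exp (τ * ph y c κ t0 q)
  nlinarith [sq_nonneg (E * (dd i U q - 4*τ*(gg y c q)*(xi y i q)*U q))]

set_option maxHeartbeats 2000000 in
lemma carleman (y : Fin d → ℝ) (t0 : ℝ) {a η κ δ : ℝ} (ha : 0 < a) (hη : 0 < η)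
    (hDη : ((d:ℝ) + 2) * η ≤ 1/16) (hκ : 0 ≤ κ) :
    ∃ C τ0 : ℝ, 0 < C ∧ 1 ≤ τ0 ∧ ∀ τ ≥ τ0, ∀ U : (Fin d → ℝ) × ℝ → ℝ, ContDiff ℝ ∞ U →
      HasCompactSupport U →
      (∀ q ∈ tsupport U, (1-η)*a ≤ nn y q ∧ nn y q ≤ (1+3*η/2)*a ∧ |th t0 q| ≤ δ) →
      τ * ∫ q, (Real.exp (τ * ph y ((1+2*η)*a) κ t0 q))^2 * ((U q)^2 + GM U q) ≤
        C * ∫ q, (Real.exp (τ * ph y ((1+2*η)*a) κ t0 q) * (dt U q - LL U q))^2 := by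
  set c := (1+2*η)*a with hc
  set K := 2*(2*κ+36*κ*δ*a+81*a^2) with hK
  set c0 := η^2*a^4/2 with hc0
  have hc0p : 0 < c0 := by positivity
  refine ⟨1/(2*a) + (1 + 2*a^3)/c0, max 1 (K/(η^2*a^4)), by positivity, le_max_left _ _, ?_⟩
  intro τ hτ U hU hUc hUs
  set C := 1/(2*a) + (1 + 2*a^3)/c0 with hC
  have hτ1 : 1 ≤ τ := (le_max_left _ _).trans hτ
  have hτ2 : K ≤ τ * (η^2*a^4) := by
    have := (le_max_right _ _).trans hτ
    rwa [div_le_iff₀ (by positivity)] at this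
  set v := cv y c κ t0 τ U with hv
  have hvs : ContDiff ℝ ∞ v := by
    exact (((ph_t y c κ t0).cm τ).exp).s.mul hU
  have hEs : ContDiff ℝ ∞ (fun q => Real.exp (τ * ph y c κ t0 q)) := (((ph_t y c κ t0).cm τ).exp).s
  have hC0 : 0 < C := by positivity
  have hv0 : ∀ q, q ∉ tsupport U → q ∉ tsupport v := by
    intro q hq
    rw [notMem_tsupport_iff_eventuallyEq] at hq ⊢
    filter_upwards [hq] with p hp
    simp only [hv, cv]; rw [hp]; simp
  have hvc : HasCompactSupport v := HasCompactSupport.intro hUc fun q hq =>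
    image_eq_zero_of_notMem_tsupport (hv0 q hq)
  have hLL0 : ∀ (w : (Fin d → ℝ) × ℝ → ℝ) q, q ∉ tsupport w → LL w q = 0 := by
    intro w q hq
    exact Finset.sum_eq_zero fun i _ => dd_zero_of_notMem (fun h => hq (tsupport_dd w i h)) i
  have hGM0 : ∀ (w : (Fin d → ℝ) × ℝ → ℝ) q, q ∉ tsupport w → GM w q = 0 := by
    intro w q hq
    exact Finset.sum_eq_zero fun i _ => by rw [dd_zero_of_notMem hq i, zero_mul]
  have hTT0 : ∀ (w : (Fin d → ℝ) × ℝ → ℝ) q, q ∉ tsupport w → TT y w q = 0 := by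
    intro w q hq
    exact Finset.sum_eq_zero fun i _ => by rw [dd_zero_of_notMem hq i, mul_zero]
  have hGMn : ∀ (w : (Fin d → ℝ) × ℝ → ℝ) q, 0 ≤ GM w q := fun w q =>
    Finset.sum_nonneg fun i _ => mul_self_nonneg _
  set dv : (Fin d → ℝ) × ℝ → ℝ := fun q => (∑ i, FG' y c κ t0 τ (8*a) v i q)
    + (2 * (∑ j, dd j v q * dt (dd j v) q)
      - 8 * τ^2 * (gg y c q)^2 * nn y q * v q * dt v q + 2 * κ * τ * (v q)^2
      + 4 * κ * τ * th t0 q * v q * dt v q) with hdv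
  have hid := div_id y c κ t0 τ (8*a) hvs
  -- integrability and vanishing of the divergence
  have hGc : ∀ i, HasCompactSupport (FG y c κ t0 τ (8*a) v i) := fun i =>
    HasCompactSupport.intro hUc fun q hq => by
      have h := hv0 q hq
      simp only [FG, dd_zero_of_notMem h, hGM0 v q h, hTT0 v q h,
        image_eq_zero_of_notMem_tsupport h]
      ring
  have hHc : HasCompactSupport (FH y c κ t0 τ v) :=
    HasCompactSupport.intro hUc fun q hq => by
      have h := hv0 q hq
      simp only [FH, hGM0 v q h, image_eq_zero_of_notMem_tsupport h]
      ring
  have hi1 : ∀ i, Integrable (FG' y c κ t0 τ (8*a) v i) := fun i =>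
    (FG_x y c κ t0 τ (8*a) hvs i).int (hGc i)
  have hi2 := (FH_t y c κ t0 τ hvs).int hHc
  have hi1' : Integrable (fun q => ∑ i, FG' y c κ t0 τ (8*a) v i q) :=
    integrable_finsetSum _ fun i _ => hi1 i
  have hdvi : Integrable dv := hi1'.add hi2
  have hdv0 : ∫ q, dv q = 0 := by
    simp only [hdv]
    rw [integral_add hi1' hi2, integral_finsetSum _ fun i _ => hi1 i,
      (FH_t y c κ t0 τ hvs).int_zero hHc,
      Finset.sum_eq_zero fun i _ => (FG_x y c κ t0 τ (8*a) hvs i).int_zero (hGc i), add_zero]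
  -- pointwise inequality
  have key : ∀ q, τ * ((Real.exp (τ * ph y c κ t0 q))^2 * ((U q)^2 + GM U q)) + C * dv q ≤
      C * (Real.exp (τ * ph y c κ t0 q) * (dt U q - LL U q))^2 := by
    intro q
    by_cases hq : q ∈ tsupport U
    · obtain ⟨h1, h2, h3⟩ := hUs q hq
      have hA := carl_alg (D := d) (n := nn y q) (g := gg y c q) (θ := th t0 q) (κ := κ) (δ := δ)
        (τ := τ) (T := TT y v q) (Γ := GM v q) (v := v q)
        (S := -LL v q - 4 * τ^2 * (gg y c q)^2 * nn y q * v q + 2 * κ * τ * th t0 q * v q)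
        (B := dt v q - 4 * τ * gg y c q * TT y v q + τ * (8*a) * v q)
        (F := Real.exp (τ * ph y c κ t0 q) * (dt U q - LL U q)) (dv := dv q)
        ha hη (by positivity) hDη (by rw [gg, hc]; ring) h1 h2 hκ h3 hτ1 hτ2 (hGMn v q) (hid q)
        (by
          simp only [hv]
          rw [cv_LL y c κ t0 τ hU, cv_TT y c κ t0 τ hU, cv_dt y c κ t0 τ hU, cv]
          ring)
      have hB := cv_GM y c κ t0 τ hU q
      have hvq : (Real.exp (τ * ph y c κ t0 q))^2 * (U q)^2 = (v q)^2 := by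
        simp only [hv, cv]; ring
      rw [← hv] at hB
      have hη2 : η ≤ 1/32 := by
        have : (0:ℝ) ≤ d := by positivity
        nlinarith
      have hηa : η * a ≤ a/32 := by nlinarith
      have hηa0 : 0 < η * a := by positivity
      have hg' : gg y c q = a + 2*(η*a) - nn y q := by rw [gg, hc]; ring
      have hg1 : 0 ≤ gg y c q := by linarith
      have hg2 : gg y c q ≤ a/8 := by linarith
      have hn0 : 0 ≤ nn y q := by linarith
      have hn1 : nn y q ≤ 2*a := by linarith
      have hgn : 8 * (gg y c q)^2 * nn y q ≤ 2*a^3 := by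
        calc 8 * (gg y c q)^2 * nn y q ≤ 8 * (a/8)^2*(2*a) := by gcongr
          _ ≤ 2*a^3 := by linarith [pow_pos ha 3]
      have hτ0 : 0 < τ := by linarith
      have hX : (Real.exp (τ * ph y c κ t0 q))^2 * ((U q)^2 + GM U q) ≤
          (v q)^2 + 2 * GM v q + 2*a^3*τ^2*(v q)^2 := by
        have := mul_le_mul_of_nonneg_right hgn (by positivity : 0 ≤ τ^2*(v q)^2)
        rw [mul_add, hvq]; linarith
      have hC1 : 2*τ*GM v q ≤ C * (4*a*τ*GM v q) := by
        have h : 1/(2*a) ≤ C := by rw [hC]; have : 0 ≤ (1+2*a^3)/c0 := by positivity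
                                   linarith
        calc 2*τ*GM v q = 1/(2*a) * (4*a*τ*GM v q) := by field_simp; ring
          _ ≤ _ := by
            have := hGMn v q
            gcongr
      have hC2 : τ*(v q)^2 + 2*a^3*τ^3*(v q)^2 ≤ C * (c0*τ^3*(v q)^2) := by
        have h : (1+2*a^3)/c0 ≤ C := by rw [hC]; have : 0 ≤ 1/(2*a) := by positivity
                                        linarith
        have hτ3 : τ ≤ τ^3 := le_self_pow₀ hτ1 (by norm_num)
        calc τ*(v q)^2 + 2*a^3*τ^3*(v q)^2 ≤ τ^3*(v q)^2 + 2*a^3*τ^3*(v q)^2 := by gcongr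
          _ = (1+2*a^3)/c0 * (c0*τ^3*(v q)^2) := by field_simp
          _ ≤ _ := by gcongr
      rw [← hc0] at hA
      have h5 := mul_le_mul_of_nonneg_left hA hC0.le
      have h6 := mul_le_mul_of_nonneg_left hX hτ0.le
      linarith
    · have h := hv0 q hq
      have hdq : dv q = 0 := by
        have := hid q
        rw [hLL0 v q h, hGM0 v q h, hTT0 v q h, image_eq_zero_of_notMem_tsupport h] at this
        rw [dt_zero_of_notMem h] at this
        simp only [hdv]
        rw [image_eq_zero_of_notMem_tsupport h, dt_zero_of_notMem h]
        linarith
      rw [hdq, hLL0 U q hq, hGM0 U q hq, image_eq_zero_of_notMem_tsupport hq,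
        dt_zero_of_notMem hq]
      simp
  have hGMs : Continuous (GM U) := by
    unfold GM
    exact continuous_finsetSum _ fun i _ =>
      (dd_smooth hU i).continuous.mul (dd_smooth hU i).continuous
  have hLLs : Continuous (LL U) := by
    unfold LL
    exact continuous_finsetSum _ fun i _ => (dd_smooth (dd_smooth hU i) i).continuous
  have I1 : Integrable (fun q => (Real.exp (τ * ph y c κ t0 q))^2 * ((U q)^2 + GM U q)) := by
    refine Continuous.integrable_of_hasCompactSupport
      ((hEs.continuous.pow 2).mul ((hU.continuous.pow 2).add hGMs))
      (HasCompactSupport.intro hUc fun q hq => ?_)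
    rw [hGM0 U q hq, image_eq_zero_of_notMem_tsupport hq]; ring
  have I2 : Integrable (fun q => (Real.exp (τ * ph y c κ t0 q) * (dt U q - LL U q))^2) := by
    refine Continuous.integrable_of_hasCompactSupport
      ((hEs.continuous.mul ((dt_smooth hU).continuous.sub hLLs)).pow 2)
      (HasCompactSupport.intro hUc fun q hq => ?_)
    rw [hLL0 U q hq, dt_zero_of_notMem hq]; ring
  have := integral_mono ((I1.const_mul τ).add (hdvi.const_mul C)) (I2.const_mul C) key
  rw [integral_add' (I1.const_mul τ) (hdvi.const_mul C)] at this
  simp only [integral_const_mul, hdv0] at this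
  linarith

end carl2
end part9

section part10
open Set MeasureTheory Filter Topology
open scoped ContDiff

section ucl
variable {d : ℕ}

set_option maxHeartbeats 1000000 in
lemma carl_concl (y : Fin d → ℝ) (t0 : ℝ) {a η κ δ : ℝ} (ha : 0 < a) (hη : 0 < η)
    (hDη : ((d:ℝ) + 2) * η ≤ 1/16) (hκ : 0 ≤ κ) {w : (Fin d → ℝ) × ℝ → ℝ}
    {c0 : (Fin d → ℝ) × ℝ} {C2 C3 B c1 M m : ℝ} {V : Set ((Fin d → ℝ) × ℝ)}
    (hC2 : 0 ≤ C2) (hC3 : 0 ≤ C3) (hB : 0 ≤ B)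
    (hU : ∀ ε, 0 < ε → ε ≤ 1 → ∃ U : (Fin d → ℝ) × ℝ → ℝ, ContDiff ℝ ∞ U ∧ HasCompactSupport U ∧
      tsupport U ⊆ Metric.closedBall c0 (1/4) ∧
      (∀ q ∈ tsupport U, (1-η)*a ≤ nn y q ∧ nn y q ≤ (1+3*η/2)*a ∧ |th t0 q| ≤ δ ∧
        ph y ((1+2*η)*a) κ t0 q ≤ M) ∧ (∀ q, |U q - w q| ≤ ε) ∧
      ∀ q ∈ tsupport U, (dt U q - LL U q)^2 ≤ C2 * ((U q)^2 + GM U q) + C3*ε^2 ∨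
        ((dt U q - LL U q)^2 ≤ B ∧ ph y ((1+2*η)*a) κ t0 q ≤ c1))
    (hV : IsOpen V) (hVne : V.Nonempty) (hVb : V ⊆ Metric.closedBall c0 (1/4)) (hm : 0 < m)
    (hVw : ∀ q ∈ V, m ≤ |w q|) (hVp : ∀ q ∈ V, c1 ≤ ph y ((1+2*η)*a) κ t0 q) : False := by
  obtain ⟨C, τ0, hC, hτ0, hcarl⟩ := carleman (d := d) y t0 (δ := δ) ha hη hDη hκ
  have hfin : volume (Metric.closedBall c0 (1/4)) < ⊤ :=
    (isCompact_closedBall c0 (1/4)).measure_lt_top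
  have hVfin : volume V < ⊤ := (measure_mono hVb).trans_lt hfin
  set S := volume.real (Metric.closedBall c0 (1/4)) with hS
  have hS0 : 0 ≤ S := measureReal_nonneg
  set s := volume.real V with hs
  have hs0 : 0 < s := by
    have hh := HD.haar_vol (d := d)
    rw [hs, measureReal_def]
    exact ENNReal.toReal_pos (hV.measure_pos volume hVne).ne' hVfin.ne
  -- choose τ
  set X := C*B*S + 1 with hX
  have hX0 : 0 < X := by positivity
  obtain ⟨τ, hτa, hτb, hτc⟩ : ∃ τ, τ0 ≤ τ ∧ 2*C*C2 ≤ τ ∧ X < τ/2*(m/2)^2*s := by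
    refine ⟨max (max τ0 (2*C*C2)) (2*(X+1)/((m/2)^2*s)), ?_, ?_, ?_⟩
    · exact (le_max_left _ _).trans (le_max_left _ _)
    · exact (le_max_right _ _).trans (le_max_left _ _)
    · have h := le_max_right (max τ0 (2*C*C2)) (2*(X+1)/((m/2)^2*s))
      rw [div_le_iff₀ (by positivity)] at h
      linarith
  have hτ0' : 0 < τ := by linarith
  set e1 := (Real.exp (τ*c1))^2 with he1
  have he1p : 0 < e1 := by positivity
  set eM := (Real.exp (τ*M))^2 with heM
  have heMp : 0 < eM := by positivity
  -- choose ε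
  set ε := min (min 1 (m/2)) (Real.sqrt (e1/(C*C3*eM*S + 1))) with hε
  have hεp : 0 < ε := by
    refine lt_min (lt_min one_pos (by positivity)) (Real.sqrt_pos.mpr (by positivity))
  have hε1 : ε ≤ 1 := (min_le_left _ _).trans (min_le_left _ _)
  have hεm : ε ≤ m/2 := (min_le_left _ _).trans (min_le_right _ _)
  have hεe : C*C3*eM*S*ε^2 ≤ e1 := by
    have h1 : ε ≤ Real.sqrt (e1/(C*C3*eM*S + 1)) := min_le_right _ _
    have h2 : ε^2 ≤ e1/(C*C3*eM*S + 1) := by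
      rw [← Real.sq_sqrt (by positivity : 0 ≤ e1/(C*C3*eM*S + 1))]
      gcongr
    rw [le_div_iff₀ (by positivity)] at h2
    have := sq_nonneg ε
    linarith
  obtain ⟨U, hUs, hUc, hUb, hUr, hUw, hUP⟩ := hU ε hεp hε1
  have hK := hcarl τ hτa U hUs hUc fun q hq => ⟨(hUr q hq).1, (hUr q hq).2.1, (hUr q hq).2.2.1⟩
  set E : (Fin d → ℝ) × ℝ → ℝ := fun q => Real.exp (τ * ph y ((1+2*η)*a) κ t0 q) with hE
  have hEp : ∀ q, 0 < E q := fun q => Real.exp_pos _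
  have hEc : Continuous E := (((ph_t y ((1+2*η)*a) κ t0).cm τ).exp).s.continuous
  have hGMs : Continuous (GM U) := by
    unfold GM
    exact continuous_finsetSum _ fun i _ =>
      (dd_smooth hUs i).continuous.mul (dd_smooth hUs i).continuous
  have hLLs : Continuous (LL U) := by
    unfold LL
    exact continuous_finsetSum _ fun i _ => (dd_smooth (dd_smooth hUs i) i).continuous
  have hGMn : ∀ q, 0 ≤ GM U q := fun q => Finset.sum_nonneg fun i _ => mul_self_nonneg _
  have hLL0 : ∀ q, q ∉ tsupport U → LL U q = 0 := by
    intro q hq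
    exact Finset.sum_eq_zero fun i _ => dd_zero_of_notMem (fun h => hq (tsupport_dd U i h)) i
  have hGM0 : ∀ q, q ∉ tsupport U → GM U q = 0 := by
    intro q hq
    exact Finset.sum_eq_zero fun i _ => by rw [dd_zero_of_notMem hq i, zero_mul]
  have I1 : Integrable (fun q => (E q)^2 * ((U q)^2 + GM U q)) := by
    refine Continuous.integrable_of_hasCompactSupport
      ((hEc.pow 2).mul ((hUs.continuous.pow 2).add hGMs))
      (HasCompactSupport.intro hUc fun q hq => ?_)
    rw [hGM0 q hq, image_eq_zero_of_notMem_tsupport hq]; ring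
  have I2 : Integrable (fun q => (E q * (dt U q - LL U q))^2) := by
    refine Continuous.integrable_of_hasCompactSupport
      ((hEc.mul ((dt_smooth hUs).continuous.sub hLLs)).pow 2)
      (HasCompactSupport.intro hUc fun q hq => ?_)
    rw [hLL0 q hq, dt_zero_of_notMem hq]; ring
  set Q := C3*ε^2*eM + B*e1 with hQ
  have hQ0 : 0 ≤ Q := by positivity
  have I3 : Integrable ((Metric.closedBall c0 (1/4)).indicator fun _ => Q) :=
    (integrable_indicator_iff Metric.isClosed_closedBall.measurableSet).mpr
      (integrableOn_const hfin.ne)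
  have hpt : ∀ q, (E q * (dt U q - LL U q))^2 ≤ C2 * ((E q)^2 * ((U q)^2 + GM U q))
      + (Metric.closedBall c0 (1/4)).indicator (fun _ => Q) q := by
    intro q
    by_cases hq : q ∈ tsupport U
    · rw [indicator_of_mem (hUb hq)]
      rcases hUP q hq with h | ⟨h, hp⟩
      · have hEM : (E q)^2 ≤ eM := by
          rw [heM, hE]
          have := (hUr q hq).2.2.2
          simp only
          gcongr
        calc (E q * (dt U q - LL U q))^2 = (E q)^2 * (dt U q - LL U q)^2 := by ring
          _ ≤ (E q)^2 * (C2 * ((U q)^2 + GM U q) + C3*ε^2) := by gcongr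
          _ = C2 * ((E q)^2 * ((U q)^2 + GM U q)) + C3*ε^2*(E q)^2 := by ring
          _ ≤ C2 * ((E q)^2 * ((U q)^2 + GM U q)) + C3*ε^2*eM := by gcongr
          _ ≤ _ := by rw [hQ]; have : 0 ≤ B*e1 := by positivity
                      linarith
      · have hEM : (E q)^2 ≤ e1 := by
          rw [he1, hE]
          simp only
          gcongr
        have h0 : 0 ≤ C2 * ((E q)^2 * ((U q)^2 + GM U q)) := by
          have := hGMn q
          positivity
        calc (E q * (dt U q - LL U q))^2 = (dt U q - LL U q)^2 * (E q)^2 := by ring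
          _ ≤ B * e1 := by gcongr
          _ ≤ _ := by rw [hQ]; have : 0 ≤ C3*ε^2*eM := by positivity
                      linarith
    · rw [hLL0 q hq, hGM0 q hq, dt_zero_of_notMem hq, image_eq_zero_of_notMem_tsupport hq]
      have : 0 ≤ (Metric.closedBall c0 (1/4)).indicator (fun _ => Q) q :=
        indicator_nonneg (fun _ _ => hQ0) q
      simpa using this
  have hinteg := integral_mono I2 ((I1.const_mul C2).add I3) hpt
  rw [integral_add' (I1.const_mul C2) I3, integral_const_mul,
    integral_indicator Metric.isClosed_closedBall.measurableSet, setIntegral_const] at hinteg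
  rw [← hS, smul_eq_mul] at hinteg
  -- lower bound
  have hlow : (m/2)^2 * e1 * s ≤ ∫ q, (E q)^2 * ((U q)^2 + GM U q) := by
    have h1 : ∫ q in V, (m/2)^2 * e1 ≤ ∫ q in V, (E q)^2 * ((U q)^2 + GM U q) := by
      refine setIntegral_mono_on (integrableOn_const hVfin.ne) I1.integrableOn
        hV.measurableSet fun q hq => ?_
      have hEM : e1 ≤ (E q)^2 := by
        rw [he1, hE]
        have := hVp q hq
        simp only
        gcongr
      have hUm : (m/2)^2 ≤ (U q)^2 := by
        have h1 := hVw q hq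
        have h2 := hUw q
        have h3 : |w q| ≤ |U q| + |U q - w q| := by
          have := abs_sub_abs_le_abs_sub (w q) (U q)
          rw [abs_sub_comm] at this
          linarith
        rw [← sq_abs (U q)]
        have : m/2 ≤ |U q| := by linarith
        gcongr
      have := hGMn q
      calc (m/2)^2 * e1 ≤ (U q)^2 * (E q)^2 := by gcongr
        _ ≤ _ := by nlinarith [mul_nonneg (sq_nonneg (E q)) this]
    have h2 : ∫ q in V, (E q)^2 * ((U q)^2 + GM U q) ≤ ∫ q, (E q)^2 * ((U q)^2 + GM U q) :=
      setIntegral_le_integral I1 (Eventually.of_forall fun q => by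
        have := hGMn q
        show 0 ≤ (E q)^2 * ((U q)^2 + GM U q)
        positivity)
    rw [setIntegral_const, ← hs, smul_eq_mul] at h1
    linarith
  set J := ∫ q, (E q)^2 * ((U q)^2 + GM U q) with hJ
  have hJ0 : 0 ≤ J := le_trans (by positivity) hlow
  have h1 : τ * J ≤ C * (C2 * J + S * Q) := hK.trans (by gcongr)
  have h2 : τ/2 * J ≤ C*S*Q := by
    have := mul_le_mul_of_nonneg_right hτb hJ0
    linarith
  have h3 : τ/2*((m/2)^2 * e1 * s) ≤ C*S*Q := le_trans (by gcongr) h2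
  have h4 : C*S*Q ≤ X * e1 := by rw [hQ, hX]; linarith
  have h5 := mul_lt_mul_of_pos_right hτc he1p
  linarith

/-- continuity of functions cut off inside `Ω` -/
lemma cont_cut {Ω : Set (Fin d → ℝ)} (hΩ : IsOpen Ω) {χ F : (Fin d → ℝ) × ℝ → ℝ}
    (hχ : tsupport χ ⊆ Ω ×ˢ univ) (hF : ContinuousOn F (Ω ×ˢ univ))
    (hF0 : ∀ q, q ∉ tsupport χ → F q = 0) : Continuous F := by
  rw [continuous_iff_continuousAt]
  intro q
  by_cases hq : q ∈ tsupport χ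
  · exact hF.continuousAt ((hΩ.prod isOpen_univ).mem_nhds (hχ hq))
  · have h : F =ᶠ[𝓝 q] fun _ => 0 := by
      filter_upwards [(isClosed_tsupport χ).isOpen_compl.mem_nhds hq] with p hp
      exact hF0 p hp
    exact continuousAt_const.congr h.symm

lemma cut_zero {χ : (Fin d → ℝ) × ℝ → ℝ} (W : (Fin d → ℝ) → ℝ → ℝ) {q : (Fin d → ℝ) × ℝ}
    (hq : q ∉ tsupport χ) :
    ∀ᶠ p in 𝓝 q, χ p * W p.1 p.2 = 0 := by
  filter_upwards [notMem_tsupport_iff_eventuallyEq.mp hq] with p hp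
  rw [hp]; simp

lemma Cl_cut {Ω : Set (Fin d → ℝ)} (hΩ : IsOpen Ω) {χ : (Fin d → ℝ) × ℝ → ℝ}
    {W : (Fin d → ℝ) → ℝ → ℝ} (hχs : ContDiff ℝ ∞ χ)
    (hχ : tsupport χ ⊆ Ω ×ˢ univ) (hW : Cl Ω W) : Cl univ (fun x t => χ (x, t) * W x t) := by
  refine ⟨?_, ?_, ?_⟩
  · refine (cont_cut (F := fun q => χ q * W q.1 q.2) hΩ hχ
      (hχs.continuous.continuousOn.mul hW.c) fun q hq => ?_).continuousOn
    exact (cut_zero W hq).self_of_nhds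
  · intro t
    rw [contDiffOn_univ, contDiff_iff_contDiffAt]
    intro x
    by_cases hq : (x, t) ∈ tsupport χ
    · have hx : x ∈ Ω := (hχ hq).1
      have h1 : ContDiff ℝ 2 (fun x => χ (x, t)) :=
        (contDiff_infty.mp hχs 2).comp (contDiff_id.prodMk contDiff_const)
      exact h1.contDiffAt.mul ((hW.x t).contDiffAt (hΩ.mem_nhds hx))
    · have hc : Tendsto (fun y : Fin d → ℝ => (y, t)) (𝓝 x) (𝓝 (x, t)) := by
        have : Continuous (fun y : Fin d → ℝ => (y, t)) := by fun_prop
        exact this.tendsto x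
      exact contDiffAt_const.congr_of_eventuallyEq (hc.eventually (cut_zero W hq))
  · intro x _ t
    by_cases hq : (x, t) ∈ tsupport χ
    · have hx : x ∈ Ω := (hχ hq).1
      have h1 : ContDiff ℝ 2 (fun t => χ (x, t)) :=
        (contDiff_infty.mp hχs 2).comp (contDiff_const.prodMk contDiff_id)
      exact (h1.differentiable (by norm_num) t).mul (hW.t x hx t)
    · have hc : Tendsto (fun s : ℝ => (x, s)) (𝓝 t) (𝓝 (x, t)) := by
        have : Continuous (fun s : ℝ => (x, s)) := by fun_prop
        exact this.tendsto t
      exact (differentiableAt_const (0:ℝ)).congr_of_eventuallyEq (hc.eventually (cut_zero W hq))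

/-- locality of `Pt` -/
lemma Pt_congr {u v : (Fin d → ℝ) → ℝ → ℝ} {x : Fin d → ℝ} {t : ℝ}
    (h : ∀ᶠ p : (Fin d → ℝ) × ℝ in 𝓝 (x, t), u p.1 p.2 = v p.1 p.2) : Pt u x t = Pt v x t := by
  have hc1 : Tendsto (fun y : Fin d → ℝ => (y, t)) (𝓝 x) (𝓝 (x, t)) := by
    have : Continuous (fun y : Fin d → ℝ => (y, t)) := by fun_prop
    exact this.tendsto x
  have hc2 : Tendsto (fun s : ℝ => (x, s)) (𝓝 t) (𝓝 (x, t)) := by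
    have : Continuous (fun s : ℝ => (x, s)) := by fun_prop
    exact this.tendsto t
  have h1 : (fun y => u y t) =ᶠ[𝓝 x] fun y => v y t := hc1.eventually h
  have h2 : u x =ᶠ[𝓝 t] v x := hc2.eventually h
  unfold Pt
  rw [lap_congr h1, h2.deriv_eq]

lemma pd_congr_st {u v : (Fin d → ℝ) → ℝ → ℝ} {x : Fin d → ℝ} {t : ℝ}
    (h : ∀ᶠ p : (Fin d → ℝ) × ℝ in 𝓝 (x, t), u p.1 p.2 = v p.1 p.2) (i : Fin d) :
    pd i (fun y => u y t) x = pd i (fun y => v y t) x := by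
  have hc1 : Tendsto (fun y : Fin d → ℝ => (y, t)) (𝓝 x) (𝓝 (x, t)) := by
    have : Continuous (fun y : Fin d → ℝ => (y, t)) := by fun_prop
    exact this.tendsto x
  have h1 : (fun y => u y t) =ᶠ[𝓝 x] fun y => v y t := hc1.eventually h
  unfold pd
  rw [h1.fderiv_eq]

lemma Pt_zero_st {u : (Fin d → ℝ) → ℝ → ℝ} {x : Fin d → ℝ} {t : ℝ}
    (h : ∀ᶠ p : (Fin d → ℝ) × ℝ in 𝓝 (x, t), u p.1 p.2 = 0) : Pt u x t = 0 := by
  rw [Pt_congr (v := fun _ _ => 0) h]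
  have h3 : ∀ i : Fin d, pd i (fun _ : Fin d → ℝ => (0:ℝ)) = fun _ => 0 :=
      fun i => funext fun x => pd_const 0 i x
  simp [Pt, lap, h3]

lemma Pt_cut_cont {Ω : Set (Fin d → ℝ)} (hΩ : IsOpen Ω) {χ : (Fin d → ℝ) × ℝ → ℝ}
    {W : (Fin d → ℝ) → ℝ → ℝ} (hχs : ContDiff ℝ ∞ χ)
    (hχ : tsupport χ ⊆ Ω ×ˢ univ) (hW : Cl Ω W)
    (hPc : ContinuousOn (fun q : (Fin d → ℝ) × ℝ => Pt W q.1 q.2) (Ω ×ˢ univ))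
    (hpc : ∀ i, ContinuousOn (fun q : (Fin d → ℝ) × ℝ => pd i (fun y => W y q.2) q.1) (Ω ×ˢ univ)) :
    Continuous (fun q : (Fin d → ℝ) × ℝ => Pt (fun x t => χ (x, t) * W x t) q.1 q.2) := by
  refine cont_cut hΩ hχ ?_ fun q hq => Pt_zero_st (cut_zero W hq)
  have hχ1 : Cl Ω (fun x t => χ (x, t)) := (Cl_of_contDiff hχs).mono (subset_univ _)
  have h : ∀ q ∈ Ω ×ˢ (univ : Set ℝ), Pt (fun x t => χ (x, t) * W x t) q.1 q.2 =
      χ q * Pt W q.1 q.2 + (dt χ q - ∑ i, dd i (dd i χ) q) * W q.1 q.2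
        - 2 * ∑ i, dd i χ q * pd i (fun y => W y q.2) q.1 := by
    intro q hq
    rw [Pt_mul hΩ hχ1 hW hq.1 q.2, Pt_eq hχs]
    have : ∀ i, pd i (fun y => χ (y, q.2)) q.1 = dd i χ q := fun i =>
      pd_eq_dd (hχs.differentiable (by norm_num) _) i
    simp [this]
  refine ContinuousOn.congr ?_ h
  refine ((hχs.continuous.continuousOn.mul hPc).add ?_).sub (continuousOn_const.mul ?_)
  · refine ContinuousOn.mul (Continuous.continuousOn ?_) hW.c
    exact (dt_smooth hχs).continuous.sub
      (continuous_finsetSum _ fun i _ => (dd_smooth (dd_smooth hχs i) i).continuous)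
  · exact continuousOn_finsetSum _ fun i _ => (dd_smooth hχs i).continuous.continuousOn.mul (hpc i)

end ucl
end part10

section part11
open Set MeasureTheory Filter Topology
open scoped ContDiff

section ucl1
variable {d : ℕ}

lemma xi_sq_le (y : Fin d → ℝ) (q : (Fin d → ℝ) × ℝ) (i : Fin d) : (xi y i q)^2 ≤ nn y q := by
  have := Finset.single_le_sum (f := fun j => xi y j q * xi y j q)
    (fun j _ => mul_self_nonneg _) (Finset.mem_univ i)
  rw [nn, sq]; exact this

lemma dist_of_nn {y : Fin d → ℝ} {q : (Fin d → ℝ) × ℝ} {r : ℝ} (hr : 0 ≤ r)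
    (h : nn y q ≤ r^2) : dist q.1 y ≤ r := by
  rw [dist_pi_le_iff hr]
  intro i
  rw [Real.dist_eq]
  exact abs_le_of_sq_le_sq ((xi_sq_le y q i).trans h) hr

lemma nn_cont (y : Fin d → ℝ) : Continuous (nn y) := (nn_t y).s.continuous
lemma th_cont (t0 : ℝ) : Continuous (th (d := d) t0) := (th_t t0).s.continuous

/-- the constant -/
noncomputable def et0 (d : ℕ) : ℝ := 1/(16*((d:ℝ)+2))

lemma et0_pos (d : ℕ) : 0 < et0 d := by unfold et0; positivity
lemma et0_eq (d : ℕ) : ((d:ℝ)+2) * et0 d ≤ 1/16 := by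
  unfold et0
  apply le_of_eq
  field_simp
lemma et0_le (d : ℕ) : et0 d ≤ 1/32 := by
  have h1 := et0_eq d
  have h2 := et0_pos d
  have : (0:ℝ) ≤ d := by positivity
  nlinarith

lemma sq_bound {d : ℕ} {P C u ε : ℝ} {b : Fin d → ℝ} (hC : 0 ≤ C) (hε : 0 ≤ ε)
    (h : |P| ≤ C * (|u| + ∑ i, |b i|) + ε * (1 + C*(1+d))) :
    P^2 ≤ 4*C^2*((d:ℝ)+1) * (u^2 + ∑ i, b i * b i) + 2*(1 + C*(1+d))^2*ε^2 := by
  have h1 : (∑ i, |b i|)^2 ≤ d * ∑ i, b i * b i := by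
    have := sq_sum_le_card_mul_sum_sq (s := (Finset.univ : Finset (Fin d))) (f := fun i => |b i|)
    simpa [sq_abs, sq] using this
  set s := ∑ i, |b i| with hs
  set g := ∑ i, b i * b i with hg
  have hg0 : 0 ≤ g := Finset.sum_nonneg fun i _ => mul_self_nonneg _
  have hs0 : 0 ≤ s := Finset.sum_nonneg fun i _ => abs_nonneg _
  have hd : (0:ℝ) ≤ d := by positivity
  have h2 : (|u| + s)^2 ≤ 2*((d:ℝ)+1)*(u^2+g) := by
    have h3 := sq_nonneg (|u| - s)
    have h4 := sq_abs u
    have h5 : 0 ≤ d * u^2 := by positivity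
    nlinarith
  have h6 : P^2 ≤ (C * (|u| + s) + ε * (1 + C*(1+d)))^2 := by
    rw [← sq_abs P]; gcongr
  have h7 : (C * (|u| + s) + ε * (1 + C*(1+d)))^2 ≤ 2*(C^2*(|u|+s)^2) + 2*(1 + C*(1+d))^2*ε^2 := by
    linarith [sq_nonneg (C * (|u| + s) - ε * (1 + C*(1+d)))]
  have h8 := mul_le_mul_of_nonneg_left h2 (by positivity : 0 ≤ 2*C^2)
  linarith

set_option maxHeartbeats 2000000 in
lemma uc1 {Ω : Set (Fin d → ℝ)} (hΩ : IsOpen Ω) {W : (Fin d → ℝ) → ℝ → ℝ} (hW : Cl Ω W)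
    (hPc : ContinuousOn (fun q : (Fin d → ℝ) × ℝ => Pt W q.1 q.2) (Ω ×ˢ univ))
    (hpc : ∀ i, ContinuousOn (fun q : (Fin d → ℝ) × ℝ => pd i (fun y => W y q.2) q.1) (Ω ×ˢ univ))
    {y : Fin d → ℝ} {t0 ρ δ C : ℝ} (hρ : 0 < ρ) (hρ8 : ρ ≤ 1/8) (hδ : 0 < δ) (hδ8 : δ ≤ 1/8)
    (hball : Metric.closedBall y (2*ρ) ⊆ Ω) (hC : 0 ≤ C)
    (hineq : ∀ x ∈ Metric.closedBall y (2*ρ), ∀ t, |t - t0| ≤ δ →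
      |Pt W x t| ≤ C * (|W x t| + ∑ i, |pd i (fun y => W y t) x|))
    (hz : ∀ x t, nn y (x, t) < ρ^2 → |t - t0| < δ → W x t = 0)
    {x : Fin d → ℝ} {t : ℝ} (hx : nn y (x, t) ≤ (1 + et0 d/2) * ρ^2) (ht : |t - t0| < δ/8) :
    W x t = 0 := by
  by_contra hne
  set η := et0 d with hη
  have hη0 : 0 < η := et0_pos d
  have hη1 : η ≤ 1/32 := et0_le d
  set a := ρ^2 with ha
  have ha0 : 0 < a := by positivity
  set e := η*a with he
  have he0 : 0 < e := by positivity
  have he1 : e ≤ a/32 := by rw [he]; nlinarith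
  set κ := 8*e^2/δ^2 with hκ
  have hκ0 : 0 ≤ κ := by positivity
  have hκδ : κ*δ^2 = 8*e^2 := by rw [hκ]; field_simp
  have hnc := nn_cont y
  have htc := th_cont (d := d) t0
  have hin : ∀ q : (Fin d → ℝ) × ℝ, nn y q ≤ 2*a → q.1 ∈ Metric.closedBall y (2*ρ) := by
    intro q hq
    rw [Metric.mem_closedBall]
    exact dist_of_nn (by positivity) (by rw [mul_pow, ← ha]; linarith)
  -- the cutoff
  obtain ⟨χ, hχs, hχ1, hχsup, hχI⟩ := exists_cutoff
    (K := {q : (Fin d → ℝ) × ℝ | nn y q ≤ a + 3/4*e ∧ |th t0 q| ≤ δ/2})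
    (O := {q : (Fin d → ℝ) × ℝ | nn y q < a + 5/4*e ∧ |th t0 q| < δ})
    ((isClosed_le hnc continuous_const).inter (isClosed_le htc.abs continuous_const))
    ((isOpen_lt hnc continuous_const).inter (isOpen_lt htc.abs continuous_const))
    (fun q hq => ⟨by linarith [hq.1], by linarith [hq.2]⟩)
  have hχΩ : tsupport χ ⊆ Ω ×ˢ univ := fun q hq =>
    ⟨hball (hin q (by linarith [(hχsup hq).1])), mem_univ _⟩
  set w : (Fin d → ℝ) → ℝ → ℝ := fun x t => χ (x, t) * W x t with hw
  have hwC : Cl univ w := Cl_cut hΩ hχs hχΩ hW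
  have hwP : Continuous (fun q : (Fin d → ℝ) × ℝ => Pt w q.1 q.2) :=
    Pt_cut_cont hΩ hχs hχΩ hW hPc hpc
  have hwc : Continuous (fun q : (Fin d → ℝ) × ℝ => w q.1 q.2) := by
    have := hwC.c
    rwa [univ_prod_univ, continuousOn_univ] at this
  set K : Set ((Fin d → ℝ) × ℝ) := {q | a ≤ nn y q} ∩ tsupport χ with hK
  set O : Set ((Fin d → ℝ) × ℝ) :=
    {q | (1-η)*a < nn y q ∧ nn y q < (1+3*η/2)*a ∧ |th t0 q| < δ} with hO
  have hKc : IsClosed K := (isClosed_le continuous_const hnc).inter (isClosed_tsupport χ)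
  have hOo : IsOpen O := (isOpen_lt continuous_const hnc).inter
    ((isOpen_lt hnc continuous_const).inter (isOpen_lt htc.abs continuous_const))
  have hKO : K ⊆ O := by
    intro q hq
    have h1 := hχsup hq.2
    have h2 : a ≤ nn y q := hq.1
    exact ⟨by linarith, by linarith [h1.1], h1.2⟩
  have hbd : ∀ q : (Fin d → ℝ) × ℝ, nn y q ≤ 2*a → |th t0 q| ≤ δ →
      q ∈ Metric.closedBall (y, t0) (1/4) := by
    intro q h1 h2
    rw [Metric.mem_closedBall, Prod.dist_eq]
    refine max_le ?_ ?_
    · have := hin q h1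
      rw [Metric.mem_closedBall] at this
      show dist q.1 y ≤ _
      linarith
    · rw [Real.dist_eq]
      unfold th at h2
      show |q.2 - t0| ≤ _
      linarith
  have hOb : O ⊆ Metric.closedBall (y, t0) (1/4) := fun q hq =>
    hbd q (by linarith [hq.2.1]) hq.2.2.le
  have hw0 : ∀ x t, (x, t) ∉ K → w x t = 0 := by
    intro x t hq
    by_cases h : (x, t) ∈ tsupport χ
    · have h1 : nn y (x, t) < a := by
        by_contra h2
        exact hq ⟨not_lt.mp h2, h⟩
      simp only [hw]
      rw [hz x t h1 (hχsup h).2, mul_zero]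
    · simp only [hw]
      rw [image_eq_zero_of_notMem_tsupport h, zero_mul]
  have hKcomp : IsCompact K :=
    (isCompact_closedBall (y, t0) (1/4)).of_isClosed_subset hKc (hKO.trans hOb)
  have hwz : ∀ q, q ∉ K → ∀ᶠ p : (Fin d → ℝ) × ℝ in 𝓝 q, w p.1 p.2 = 0 := by
    intro q hq
    filter_upwards [hKc.isOpen_compl.mem_nhds hq] with p hp
    exact hw0 p.1 p.2 hp
  obtain ⟨B, hB0, hB⟩ := bdd_of_compact hwP
    (HasCompactSupport.intro hKcomp fun q hq => Pt_zero_st (hwz q hq))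
  set c1 := 25/32*e^2 with hc1
  have hphe : ∀ q, ph y ((1+2*η)*a) κ t0 q
      = 1/2*(a + 2*e - nn y q)^2 - κ*(th t0 q)^2 := by
    intro q; simp only [ph, gg, he]; ring
  -- alternative
  have halt : ∀ q : (Fin d → ℝ) × ℝ, |Pt w q.1 q.2| ≤ C * (|w q.1 q.2| +
      ∑ i, |pd i (fun y => w y q.2) q.1|) ∨ ph y ((1+2*η)*a) κ t0 q ≤ c1 := by
    intro q
    by_cases hqK : q ∈ K
    swap
    · left
      rw [Pt_zero_st (x := q.1) (t := q.2) (hwz q hqK), abs_zero]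
      positivity
    have hq1 := hχsup hqK.2
    have hq2 : a ≤ nn y q := hqK.1
    by_cases hn : nn y q ≤ a + 3/4*e
    · by_cases hθ : |th t0 q| ≤ δ/2
      · left
        have hev : ∀ᶠ p : (Fin d → ℝ) × ℝ in 𝓝 (q.1, q.2), w p.1 p.2 = W p.1 p.2 := by
          filter_upwards [hχ1 q ⟨hn, hθ⟩] with p hp
          simp only [hw]
          rw [show (p.1, p.2) = p from rfl, hp, one_mul]
        rw [Pt_congr hev, hev.self_of_nhds]
        simp_rw [pd_congr_st hev]
        exact hineq q.1 (hin q (by linarith)) q.2 hq1.2.le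
      · right
        rw [hphe]
        have h1 : δ/2 < |th t0 q| := not_le.mp hθ
        have h2 : (δ/2)^2 ≤ (th t0 q)^2 := by
          rw [← sq_abs (th t0 q)]; gcongr
        have h3 := mul_le_mul_of_nonneg_left h2 hκ0
        have h4 : (a + 2*e - nn y q)^2 ≤ (2*e)^2 := by
          have : 0 ≤ a + 2*e - nn y q := by linarith
          gcongr; linarith
        have : 0 ≤ e^2 := by positivity
        nlinarith
    · right
      rw [hphe]
      have h4 : (a + 2*e - nn y q)^2 ≤ (5/4*e)^2 := by
        have : 0 ≤ a + 2*e - nn y q := by linarith [hq1.1]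
        gcongr; linarith
      have h5 : 0 ≤ κ*(th t0 q)^2 := by positivity
      linarith
  -- target point
  have hxt : nn y (x, t) ≤ a + e/2 := by linarith
  have hwx : w x t = W x t := by
    have h := (hχ1 (x, t) ⟨by linarith, by
      have : |th t0 ((x, t) : (Fin d → ℝ) × ℝ)| < δ/8 := ht
      linarith⟩).self_of_nhds
    simp only [hw]; rw [h, one_mul]
  have hwpos : 0 < |w x t| := by rw [hwx]; exact abs_pos.mpr hne
  have hpx : c1 < ph y ((1+2*η)*a) κ t0 (x, t) := by
    rw [hphe]
    have h4 : (3/2*e)^2 ≤ (a + 2*e - nn y (x, t))^2 := by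
      gcongr; linarith
    have h5 : (th t0 ((x, t) : (Fin d → ℝ) × ℝ))^2 ≤ (δ/8)^2 := by
      have : |th t0 ((x, t) : (Fin d → ℝ) × ℝ)| < δ/8 := ht
      rw [← sq_abs]; gcongr
    have h6 := mul_le_mul_of_nonneg_left h5 hκ0
    have : 0 < e^2 := by positivity
    nlinarith
  have hphc : Continuous (ph y ((1+2*η)*a) κ t0) := (ph_t y ((1+2*η)*a) κ t0).s.continuous
  refine carl_concl (d := d) y t0 (δ := δ) ha0 hη0 (et0_eq d) hκ0 (w := fun q => w q.1 q.2)
    (c0 := (y, t0)) (C2 := 4*C^2*((d:ℝ)+1)) (C3 := 2*(1 + C*(1+d))^2) (B := (B+1)^2) (c1 := c1)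
    (M := 5*e^2) (m := |w x t|/2)
    (V := {q | |w x t|/2 < |w q.1 q.2|} ∩ ({q | c1 < ph y ((1+2*η)*a) κ t0 q} ∩
      Metric.ball (y, t0) (1/4)))
    (by positivity) (by positivity) (by positivity) ?_ ?_ ?_ ?_ (by positivity) ?_ ?_
  · intro ε hε hε1
    obtain ⟨U, hU, hUc, hUO, hUa⟩ := approx hwC hwP hKc hOo hKO hOb hw0 hε
    refine ⟨U, hU, hUc, hUO.trans hOb, fun q hq => ?_, fun q => (hUa q.1 q.2).1, fun q hq => ?_⟩
    · obtain ⟨h1, h2, h3⟩ := hUO hq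
      refine ⟨h1.le, h2.le, h3.le, ?_⟩
      rw [hphe]
      have h4 : (a + 2*e - nn y q)^2 ≤ (3*e)^2 := by
        have : 0 ≤ a + 2*e - nn y q := by linarith
        gcongr; linarith
      have h5 : 0 ≤ κ*(th t0 q)^2 := by positivity
      have : 0 ≤ e^2 := by positivity
      linarith
    · obtain ⟨ha1, ha2, ha3⟩ := hUa q.1 q.2
      have hPe : Pt (fun x t => U (x, t)) q.1 q.2 = dt U q - LL U q := Pt_eq hU q.1 q.2
      rw [hPe] at ha3
      have hP1 : |dt U q - LL U q| ≤ |Pt w q.1 q.2| + ε := by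
        have := abs_sub_abs_le_abs_sub (dt U q - LL U q) (Pt w q.1 q.2)
        linarith
      rcases halt q with h | h
      · left
        refine sq_bound (b := fun i => dd i U q) hC hε.le ?_
        have h1 : |w q.1 q.2| ≤ |U q| + ε := by
          have := abs_sub_abs_le_abs_sub (w q.1 q.2) (U q)
          rw [abs_sub_comm] at this
          have h2 : |U q - w q.1 q.2| ≤ ε := ha1
          linarith
        have h2 : ∑ i, |pd i (fun y => w y q.2) q.1| ≤ ∑ i, |dd i U q| + d * ε := by
          have : ∑ i : Fin d, (|dd i U q| + ε) = ∑ i, |dd i U q| + d * ε := by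
            simp [Finset.sum_add_distrib]
          rw [← this]
          refine Finset.sum_le_sum fun i _ => ?_
          have h3 : |dd i U q - pd i (fun y => w y q.2) q.1| ≤ ε := ha2 i
          have := abs_sub_abs_le_abs_sub (pd i (fun y => w y q.2) q.1) (dd i U q)
          rw [abs_sub_comm] at this
          linarith
        calc |dt U q - LL U q| ≤ C * (|w q.1 q.2| + ∑ i, |pd i (fun y => w y q.2) q.1|) + ε := by
              linarith
          _ ≤ C * ((|U q| + ε) + (∑ i, |dd i U q| + d * ε)) + ε := by gcongr
          _ = _ := by ring
      · right
        refine ⟨?_, h⟩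
        rw [← sq_abs (dt U q - LL U q)]
        have := hB q
        gcongr
        linarith
  · refine (isOpen_lt continuous_const hwc.abs).inter ((isOpen_lt continuous_const hphc).inter
      Metric.isOpen_ball)
  · refine ⟨(x, t), ?_, hpx, ?_⟩
    · show |w x t|/2 < |w x t|
      linarith
    · rw [Metric.mem_ball, Prod.dist_eq]
      refine max_lt ?_ ?_
      · have h : dist x y ≤ 3/2*ρ := dist_of_nn (q := (x, t)) (by positivity) (by
          rw [mul_pow, ← ha]; linarith)
        show dist x y < _
        linarith
      · show dist t t0 < _
        rw [Real.dist_eq]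
        linarith
  · exact fun q hq => Metric.ball_subset_closedBall hq.2.2
  · exact fun q hq => le_of_lt hq.1
  · exact fun q hq => le_of_lt hq.2.1

end ucl1
end part11

section part12
open Set MeasureTheory Filter Topology
open scoped ContDiff

section ucg
variable {d : ℕ}

/-- hypotheses of the unique continuation argument -/
structure UCh (Ω : Set (Fin d → ℝ)) (W : (Fin d → ℝ) → ℝ → ℝ) : Prop where
  cl : Cl Ω W
  pc : ContinuousOn (fun q : (Fin d → ℝ) × ℝ => Pt W q.1 q.2) (Ω ×ˢ univ)
  gc : ∀ i, ContinuousOn (fun q : (Fin d → ℝ) × ℝ => pd i (fun y => W y q.2) q.1) (Ω ×ˢ univ)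
  ineq : ∀ y r, Metric.closedBall y r ⊆ Ω → ∃ C, 0 ≤ C ∧
    ∀ x ∈ Metric.closedBall y r, ∀ t, |Pt W x t| ≤ C*(|W x t|+∑ i,|pd i (fun y => W y t) x|)

lemma uc2 {Ω : Set (Fin d → ℝ)} {W : (Fin d → ℝ) → ℝ → ℝ} (hΩ : IsOpen Ω) (h : UCh Ω W)
    {y : Fin d → ℝ} {t0 R ρ0 δ : ℝ} (hR0 : 0 < R) (hR : R ≤ 1/8)
    (hb : Metric.closedBall y (2*R) ⊆ Ω) (hρ : 0 < ρ0) (hδ : 0 < δ) (hδ8 : δ ≤ 1/8)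
    (hz : ∀ x t, nn y (x,t) < ρ0^2 → |t-t0| < δ → W x t = 0) :
    ∃ δ' > 0, ∀ x t, nn y (x,t) < R^2 → |t-t0| < δ' → W x t = 0 := by
  obtain ⟨C, hC, hCi⟩ := h.ineq y (2*R) hb
  have he := et0_pos d
  have key : ∀ k : ℕ, ∃ δ' > 0, δ' ≤ 1/8 ∧ ∀ x t, nn y (x,t) < min ((1+et0 d/2)^k*ρ0^2) (R^2) →
      |t-t0| < δ' → W x t = 0 := by
    intro k
    induction k with
    | zero =>
      refine ⟨δ, hδ, hδ8, fun x t hx ht => hz x t ?_ ht⟩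
      have := lt_of_lt_of_le hx (min_le_left _ _)
      simpa using this
    | succ k ih =>
      obtain ⟨δ', hδ', hδ8', ih⟩ := ih
      refine ⟨δ'/8, by positivity, by linarith, fun x t hx ht => ?_⟩
      set m := min ((1+et0 d/2)^k*ρ0^2) (R^2) with hm
      have hm0 : 0 < m := lt_min (by positivity) (by positivity)
      have hs : (Real.sqrt m)^2 = m := Real.sq_sqrt hm0.le
      have hsR : Real.sqrt m ≤ R := by
        rw [Real.sqrt_le_left hR0.le]; exact min_le_right _ _
      have hsub : Metric.closedBall y (2*Real.sqrt m) ⊆ Metric.closedBall y (2*R) :=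
        Metric.closedBall_subset_closedBall (by linarith)
      refine uc1 hΩ h.cl h.pc h.gc (Real.sqrt_pos.mpr hm0) (hsR.trans hR) hδ' hδ8'
        (hsub.trans hb) hC (fun x hx t _ => hCi x (hsub hx) t) ?_ ?_ ht
      · intro x t hx ht
        rw [hs] at hx
        exact ih x t hx ht
      · rw [hs]
        refine hx.le.trans ?_
        rw [hm, mul_min_of_nonneg _ _ (by positivity)]
        refine min_le_min (le_of_eq (by ring)) ?_
        have : 0 ≤ et0 d/2 * R^2 := by positivity
        linarith
  obtain ⟨k, hk⟩ := pow_unbounded_of_one_lt (R^2/ρ0^2) (by linarith : 1 < 1 + et0 d/2)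
  obtain ⟨δ', h1, -, h2⟩ := key k
  refine ⟨δ', h1, fun x t hx ht => h2 x t ?_ ht⟩
  rw [div_lt_iff₀ (by positivity)] at hk
  rwa [min_eq_right hk.le]

theorem uc {Ω : Set (Fin d → ℝ)} {W : (Fin d → ℝ) → ℝ → ℝ} (hΩ : IsOpen Ω)
    (hc : IsPreconnected Ω) (h : UCh Ω W) {t0 : ℝ} {y0 : Fin d → ℝ} (hy0 : y0 ∈ Ω)
    (hz : ∀ᶠ p in 𝓝 (y0, t0), W p.1 p.2 = 0) : ∀ x ∈ Ω, W x t0 = 0 := by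
  set Z : Set (Fin d → ℝ) := {x | ∀ᶠ p in 𝓝 (x, t0), W p.1 p.2 = 0} with hZ
  have hZo : IsOpen Z := by
    have h1 : IsOpen {q : (Fin d → ℝ) × ℝ | ∀ᶠ p in 𝓝 q, W p.1 p.2 = 0} := isOpen_setOfPred_eventually_nhds
    exact h1.preimage (by fun_prop : Continuous fun x : Fin d → ℝ => (x, t0))
  have := hc.subset_of_closure_inter_subset hZo ⟨y0, hy0, hz⟩ ?_
  · intro x hx
    exact (this hx).self_of_nhds
  rintro x ⟨hxc, hxΩ⟩
  obtain ⟨r, hr, hrb⟩ := Metric.nhds_basis_closedBall.mem_iff.mp (hΩ.mem_nhds hxΩ)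
  set R := min (1/8) (r/3) with hRd
  have hR0 : 0 < R := lt_min (by norm_num) (by positivity)
  have hR8 : R ≤ 1/8 := min_le_left _ _
  have hRr : R ≤ r/3 := min_le_right _ _
  have ho : IsOpen {y : Fin d → ℝ | nn x (y, t0) < R^2} :=
    isOpen_lt ((nn_cont x).comp (by fun_prop : Continuous fun y : Fin d → ℝ => (y, t0))) continuous_const
  obtain ⟨y, hyo, hyZ⟩ := mem_closure_iff.mp hxc _ ho (by simp [nn, xi]; positivity)
  have hyo : nn x (y, t0) < R^2 := hyo
  have hsym : nn y (x, t0) = nn x (y, t0) := by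
    simp only [nn, xi]; refine Finset.sum_congr rfl fun j _ => ?_; ring
  have hdist : dist y x ≤ R := dist_of_nn (q := (y, t0)) hR0.le hyo.le
  have hb : Metric.closedBall y (2*R) ⊆ Ω := by
    refine (Metric.closedBall_subset_closedBall' ?_).trans hrb
    linarith
  have hyZ : ∀ᶠ p in 𝓝 (y, t0), W p.1 p.2 = 0 := hyZ
  obtain ⟨ε, hε, hεz⟩ := Metric.eventually_nhds_iff.mp hyZ
  obtain ⟨δ', hδ', hfin⟩ := uc2 hΩ h (y := y) (t0 := t0) (ρ0 := ε/2) (δ := min ε (1/8)) hR0 hR8 hb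
    (by positivity) (by positivity) (min_le_right _ _) (by
      intro x t hx ht
      refine hεz (y := (x,t)) ?_
      rw [Prod.dist_eq]
      refine max_lt ?_ ?_
      · exact lt_of_le_of_lt (dist_of_nn (q := (x,t)) (by positivity) hx.le) (by linarith)
      · rw [Real.dist_eq]; exact lt_of_lt_of_le ht (min_le_left _ _))
  have ho2 : IsOpen {q : (Fin d → ℝ) × ℝ | nn y q < R^2 ∧ |q.2 - t0| < δ'} :=
    (isOpen_lt (nn_cont y) continuous_const).inter
      (isOpen_lt (by fun_prop : Continuous fun q : (Fin d → ℝ) × ℝ => |q.2 - t0|) continuous_const)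
  filter_upwards [ho2.mem_nhds (x := (x,t0)) ⟨by rw [hsym]; exact hyo, by simpa using hδ'⟩] with q hq
  exact hfin q.1 q.2 hq.1 hq.2
end ucg
end part12

section part13
open Set MeasureTheory Filter Topology
open scoped ContDiff

section flip
variable {d : ℕ}

lemma lip_loc {Ω : Set (Fin d → ℝ)} {f : ((Fin d → ℝ) × ℝ × (Fin d → ℝ)) → ℝ}
    (hf : ContDiffOn ℝ 1 f (closure Ω ×ˢ ((univ : Set ℝ) ×ˢ (univ : Set (Fin d → ℝ)))))
    {a : (Fin d → ℝ) × ℝ × (Fin d → ℝ)} (ha : a.1 ∈ closure Ω) :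
    ∃ C : ℝ, 0 ≤ C ∧ ∃ U ∈ 𝓝 a, ∀ p ∈ U, ∀ q ∈ U, p.1 ∈ closure Ω → p.1 = q.1 →
      |f p - f q| ≤ C * dist p q := by
  set S := (closure Ω ×ˢ ((univ : Set ℝ) ×ˢ (univ : Set (Fin d → ℝ)))) with hS
  have haS : a ∈ S := by simp [hS, ha]
  have h1 : ContDiffWithinAt ℝ (0+1) f S a := by simpa using hf a haS
  rw [contDiffWithinAt_succ_iff_hasFDerivWithinAt' (by simp)] at h1
  obtain ⟨u, hu, -, -, f', hf', hc⟩ := h1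
  rw [insert_eq_of_mem haS] at hu
  have hcont : ContinuousWithinAt f' S a := hc.continuousWithinAt
  have hev : ∀ᶠ p in 𝓝[S] a, p ∈ u ∧ ‖f' p‖ < ‖f' a‖ + 1 :=
    Filter.Eventually.and hu (hcont.norm.eventually (gt_mem_nhds (by linarith)))
  rw [eventually_nhdsWithin_iff] at hev
  obtain ⟨ε, hε, hb⟩ := Metric.eventually_nhds_iff_ball.mp hev
  refine ⟨‖f' a‖+1, by positivity, Metric.ball a ε, Metric.ball_mem_nhds a hε, ?_⟩
  rintro ⟨x, v⟩ hp ⟨x', w⟩ hq hx hxx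
  obtain rfl : x = x' := hxx
  rw [← ball_prod_same, mem_prod] at hp hq
  have hin : ∀ v' ∈ Metric.ball a.2 ε, (x, v') ∈ u ∧ ‖f' (x,v')‖ < ‖f' a‖+1 := by
    intro v' hv'
    refine hb (x, v') ?_ (by simp [hS]; exact hx)
    rw [← ball_prod_same]; exact ⟨hp.1, hv'⟩
  have hd : ∀ v' ∈ Metric.ball a.2 ε, HasFDerivWithinAt (fun v => f (x, v))
      ((f' (x,v')).comp (ContinuousLinearMap.inr ℝ (Fin d → ℝ) (ℝ × (Fin d → ℝ))))
      (Metric.ball a.2 ε) v' := by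
    intro v' hv'
    have h2 := hf' (x, v') (hin v' hv').1
    refine HasFDerivWithinAt.comp (g := f) (t := S) v' h2 (hasFDerivAt_prodMk_right x v').hasFDerivWithinAt ?_
    intro z _
    simp [hS]; exact hx
  have := (convex_ball a.2 ε).norm_image_sub_le_of_norm_hasFDerivWithin_le (C := ‖f' a‖+1) hd (by
    intro v' hv'
    refine (ContinuousLinearMap.opNorm_comp_le _ _).trans ?_
    have h3 := ContinuousLinearMap.norm_inr_le_one ℝ (Fin d → ℝ) (ℝ × (Fin d → ℝ))
    have h4 := (hin v' hv').2.le
    have h5 := mul_le_mul h4 h3 (norm_nonneg _) (by positivity)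
    simpa using h5) hq.2 hp.2
  rw [Real.norm_eq_abs] at this
  refine this.trans ?_
  rw [← dist_eq_norm, Prod.dist_eq]
  gcongr
  exact le_max_right _ _

lemma lip_K {Ω : Set (Fin d → ℝ)} {f : ((Fin d → ℝ) × ℝ × (Fin d → ℝ)) → ℝ}
    (hf : ContDiffOn ℝ 1 f (closure Ω ×ˢ ((univ : Set ℝ) ×ˢ (univ : Set (Fin d → ℝ)))))
    {K : Set ((Fin d → ℝ) × ℝ × (Fin d → ℝ))} (hK : IsCompact K)
    (hKΩ : ∀ a ∈ K, a.1 ∈ closure Ω) :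
    ∃ C : ℝ, 0 ≤ C ∧ ∀ p ∈ K, ∀ q ∈ K, p.1 = q.1 → |f p - f q| ≤ C * dist p q := by
  have hcont : ContinuousOn f K := hf.continuousOn.mono fun a ha => by simp [hKΩ a ha]
  obtain ⟨M, hM⟩ := hK.exists_bound_of_continuousOn hcont
  have key : ∃ C : ℝ, 0 ≤ C ∧ ∀ z ∈ K ×ˢ K, z ∈ K ×ˢ K → z.1.1 = z.2.1 →
      |f z.1 - f z.2| ≤ C * dist z.1 z.2 := by
    refine (hK.prod hK).induction_on (p := fun s => ∃ C : ℝ, 0 ≤ C ∧ ∀ z ∈ s, z ∈ K ×ˢ K →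
      z.1.1 = z.2.1 → |f z.1 - f z.2| ≤ C * dist z.1 z.2) ⟨0, le_rfl, by simp⟩ ?_ ?_ ?_
    · rintro s t hst ⟨C, hC, h⟩
      exact ⟨C, hC, fun z hz => h z (hst hz)⟩
    · rintro s t ⟨C, hC, h⟩ ⟨C', hC', h'⟩
      refine ⟨C + C', by positivity, ?_⟩
      rintro z (hz | hz) hzK hz1
      · refine (h z hz hzK hz1).trans ?_
        gcongr; linarith
      · refine (h' z hz hzK hz1).trans ?_
        gcongr; linarith
    · rintro ⟨p, q⟩ ⟨hp, hq⟩
      simp only at hp hq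
      by_cases hpq : p = q
      · subst hpq
        obtain ⟨C, hC, U, hU, h⟩ := lip_loc hf (hKΩ p hp)
        refine ⟨U ×ˢ U, mem_nhdsWithin_of_mem_nhds (prod_mem_nhds hU hU), C, hC, ?_⟩
        rintro z ⟨hz1, hz2⟩ hzK hz
        exact h z.1 hz1 z.2 hz2 (hKΩ _ hzK.1) hz
      · have hd : 0 < dist p q := dist_pos.mpr hpq
        have ho : IsOpen {z : ((Fin d → ℝ) × ℝ × (Fin d → ℝ)) × ((Fin d → ℝ) × ℝ × (Fin d → ℝ)) |
            dist p q / 2 < dist z.1 z.2} := isOpen_lt continuous_const (by fun_prop)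
        have hM0 : 0 ≤ M := (norm_nonneg _).trans (hM p hp)
        refine ⟨_, mem_nhdsWithin_of_mem_nhds (ho.mem_nhds (x := (p,q)) (half_lt_self hd)),
          4*M/dist p q, by positivity, ?_⟩
        intro z hz hzK _
        have hz : dist p q / 2 < dist z.1 z.2 := hz
        have h1 := hM _ hzK.1
        have h2 := hM _ hzK.2
        rw [Real.norm_eq_abs] at h1 h2
        have h3 : |f z.1 - f z.2| ≤ 2*M := (abs_sub _ _).trans (by linarith)
        refine h3.trans ?_
        rw [div_mul_eq_mul_div, le_div_iff₀ hd]
        have := mul_le_mul_of_nonneg_left hz.le hM0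
        linarith
  obtain ⟨C, hC, h⟩ := key
  exact ⟨C, hC, fun p hp q hq hpq => h (p,q) ⟨hp,hq⟩ ⟨hp,hq⟩ hpq⟩
end flip
end part13

section part14
open Set MeasureTheory Filter Topology
open scoped ContDiff

section sol
variable {d : ℕ}

/-- classical bounded solution -/
structure Sol (Ω : Set (Fin d → ℝ)) (f : ((Fin d → ℝ) × ℝ × (Fin d → ℝ)) → ℝ) (R : ℝ)
    (p : (Fin d → ℝ) → ℝ → ℝ) : Prop where
  c : ContinuousOn (fun q : (Fin d → ℝ) × ℝ => p q.1 q.2) (closure Ω ×ˢ (univ : Set ℝ))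
  x : ∀ t : ℝ, ContDiffOn ℝ 2 (fun x => p x t) Ω
  t : ∀ x ∈ Ω, ContDiff ℝ 1 (p x)
  eq : ∀ x ∈ Ω, ∀ t : ℝ,
      deriv (p x) t = lap (fun y => p y t) x
        + f (x, p x t, fun i => pd i (fun y => p y t) x)
  bc : ∀ x ∈ frontier Ω, ∀ t : ℝ, p x t = 0
  bnd : ∀ x ∈ Ω, ∀ t : ℝ, |p x t| ≤ R ∧ ∀ i, |pd i (fun y => p y t) x| ≤ R

/-- standing hypotheses -/
structure Dat (Ω : Set (Fin d → ℝ)) (f : ((Fin d → ℝ) × ℝ × (Fin d → ℝ)) → ℝ) : Prop where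
  o : IsOpen Ω
  b : Bornology.IsBounded Ω
  f : ContDiffOn ℝ 1 f (closure Ω ×ˢ ((univ : Set ℝ) ×ˢ (univ : Set (Fin d → ℝ))))

/-- jet -/
noncomputable def jet (p : (Fin d → ℝ) → ℝ → ℝ) (x : Fin d → ℝ) (t : ℝ) :
    (Fin d → ℝ) × ℝ × (Fin d → ℝ) := (x, p x t, fun i => pd i (fun y => p y t) x)

variable {Ω : Set (Fin d → ℝ)} {f : ((Fin d → ℝ) × ℝ × (Fin d → ℝ)) → ℝ} {R : ℝ}
  {p q : (Fin d → ℝ) → ℝ → ℝ}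

lemma Sol.cl (h : Sol Ω f R p) : Cl Ω p :=
  ⟨h.c.mono (prod_mono subset_closure le_rfl), h.x, fun x hx => (h.t x hx).differentiable (by norm_num)⟩

lemma Sol.shift (h : Sol Ω f R p) (s : ℝ) : Sol Ω f R (fun x t => p x (t + s)) where
  c := h.c.comp (f := fun q : (Fin d → ℝ) × ℝ => (q.1, q.2 + s)) (by fun_prop)
    (fun q hq => ⟨hq.1, mem_univ _⟩)
  x := fun t => h.x (t+s)
  t := fun x hx => (h.t x hx).comp (by fun_prop)
  eq := fun x hx t => by
    rw [deriv_comp_add_const (f := p x)]; exact h.eq x hx (t+s)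
  bc := fun x hx t => h.bc x hx (t+s)
  bnd := fun x hx t => h.bnd x hx (t+s)

lemma Sol.Pt (h : Sol Ω f R p) {x : Fin d → ℝ} (hx : x ∈ Ω) (t : ℝ) : Pt p x t = f (jet p x t) := by
  unfold _root_.Pt jet; rw [h.eq x hx t]; ring

/-- compact range of jets -/
def KK (Ω : Set (Fin d → ℝ)) (R : ℝ) : Set ((Fin d → ℝ) × ℝ × (Fin d → ℝ)) :=
  closure Ω ×ˢ (Metric.closedBall (0:ℝ) R ×ˢ Metric.closedBall (0 : Fin d → ℝ) R)

lemma KK_compact (hb : Bornology.IsBounded Ω) : IsCompact (KK Ω R) :=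
  hb.isCompact_closure.prod ((isCompact_closedBall _ _).prod (isCompact_closedBall _ _))

lemma Sol.jet_mem (h : Sol Ω f R p) {x : Fin d → ℝ} (hx : x ∈ Ω) (t : ℝ) : jet p x t ∈ KK Ω R := by
  obtain ⟨h1, h2⟩ := h.bnd x hx t
  have hR : 0 ≤ R := (abs_nonneg _).trans h1
  refine ⟨subset_closure hx, ?_, ?_⟩
  · simpa [jet] using h1
  · rw [mem_closedBall_zero_iff, pi_norm_le_iff_of_nonneg hR]
    exact h2

lemma Sol.bound (hD : Dat Ω f) (h : Sol Ω f R p) : ∃ M, ∀ x ∈ Ω, ∀ t, |_root_.Pt p x t| ≤ M := by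
  have hcont : ContinuousOn f (KK Ω R) := hD.f.continuousOn.mono fun a ha => by simp [ha.1]
  obtain ⟨M, hM⟩ := (KK_compact hD.b).exists_bound_of_continuousOn hcont
  refine ⟨M, fun x hx t => ?_⟩
  rw [h.Pt hx]
  exact hM _ (h.jet_mem hx t)

lemma Sol.gc (hD : Dat Ω f) (h : Sol Ω f R p) (i : Fin d) :
    ContinuousOn (fun q : (Fin d → ℝ) × ℝ => pd i (fun y => p y q.2) q.1) (Ω ×ˢ univ) := by
  obtain ⟨M, hM⟩ := h.bound hD
  exact pd_joint hD.o h.cl hM i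

lemma Sol.jc (hD : Dat Ω f) (h : Sol Ω f R p) :
    ContinuousOn (fun q : (Fin d → ℝ) × ℝ => jet p q.1 q.2) (Ω ×ˢ univ) := by
  unfold jet
  exact continuousOn_fst.prodMk (h.cl.c.prodMk (continuousOn_pi.mpr fun i => h.gc hD i))

lemma Sol.pc (hD : Dat Ω f) (h : Sol Ω f R p) :
    ContinuousOn (fun q : (Fin d → ℝ) × ℝ => _root_.Pt p q.1 q.2) (Ω ×ˢ univ) := by
  have := hD.f.continuousOn.comp (h.jc hD) (fun q hq => by simp [jet, subset_closure hq.1])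
  refine this.congr fun q hq => ?_
  exact h.Pt hq.1 q.2

lemma Sol.ineq (hD : Dat Ω f) (h : Sol Ω f R p) (h' : Sol Ω f R q) : ∃ C, 0 ≤ C ∧ ∀ x ∈ Ω, ∀ t,
    |_root_.Pt (fun x t => p x t - q x t) x t| ≤ C * max |p x t - q x t|
      ‖fun i => pd i (fun y => p y t - q y t) x‖ := by
  obtain ⟨C, hC, hL⟩ := lip_K hD.f (KK_compact hD.b (R := R)) (fun a ha => ha.1)
  refine ⟨C, hC, fun x hx t => ?_⟩
  rw [Pt_sub hD.o h.cl h'.cl hx, h.Pt hx, h'.Pt hx]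
  refine (hL _ (h.jet_mem hx t) _ (h'.jet_mem hx t) rfl).trans (le_of_eq ?_)
  congr 1
  rw [jet, jet, Prod.dist_eq, Prod.dist_eq]
  simp only [dist_self]
  rw [dist_eq_norm, dist_eq_norm, Real.norm_eq_abs]
  have : (fun i => pd i (fun y => p y t - q y t) x) =
      (fun i => pd i (fun y => p y t) x) - (fun i => pd i (fun y => q y t) x) := by
    funext i
    exact pd_sub i (c2_diff hD.o (h.x t) hx) (c2_diff hD.o (h'.x t) hx)
  rw [this, max_eq_right (le_max_of_le_left (abs_nonneg _))]

lemma Sol.uch (hD : Dat Ω f) (h : Sol Ω f R p) (h' : Sol Ω f R q) :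
    UCh Ω (fun x t => p x t - q x t) where
  cl := h.cl.sub h'.cl
  pc := ((h.pc hD).sub (h'.pc hD)).congr fun z hz => Pt_sub hD.o h.cl h'.cl hz.1 z.2
  gc := fun i => ((h.gc hD i).sub (h'.gc hD i)).congr fun z hz =>
    pd_sub i (c2_diff hD.o (h.x z.2) hz.1) (c2_diff hD.o (h'.x z.2) hz.1)
  ineq := fun y r hyr => by
    obtain ⟨C, hC, hL⟩ := h.ineq hD h'
    refine ⟨C, hC, fun x hx t => (hL x (hyr hx) t).trans ?_⟩
    have hs : 0 ≤ ∑ i, |pd i (fun y => p y t - q y t) x| := Finset.sum_nonneg fun i _ => abs_nonneg _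
    refine mul_le_mul_of_nonneg_left (max_le (by linarith) ?_) hC
    rw [pi_norm_le_iff_of_nonneg (by positivity)]
    intro i
    have := Finset.single_le_sum (f := fun i => |pd i (fun y => p y t - q y t) x|)
      (fun j _ => abs_nonneg _) (Finset.mem_univ i)
    rw [Real.norm_eq_abs]
    have h0 := abs_nonneg (p x t - q x t)
    linarith

lemma Sol.fwd_le (hD : Dat Ω f) (h : Sol Ω f R p) (h' : Sol Ω f R q) {t0 : ℝ}
    (h0 : ∀ x ∈ Ω, p x t0 = q x t0) {x : Fin d → ℝ} (hx : x ∈ Ω) {t1 : ℝ} (ht : t0 ≤ t1) :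
    p x t1 ≤ q x t1 := by
  by_contra hlt
  rw [not_le] at hlt
  obtain ⟨C, hC, hL⟩ := h.ineq hD h'
  set w : (Fin d → ℝ) → ℝ → ℝ := fun x t => p x t - q x t with hw
  have hwc : Cl Ω w := h.cl.sub h'.cl
  have hK : IsCompact (closure Ω ×ˢ Icc t0 t1) := hD.b.isCompact_closure.prod isCompact_Icc
  have hzc : ContinuousOn (fun z : (Fin d → ℝ) × ℝ => Real.exp (-(C+1)*z.2) * w z.1 z.2)
      (closure Ω ×ˢ Icc t0 t1) := by
    refine ContinuousOn.mul (by fun_prop) ?_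
    exact (h.c.sub h'.c).mono (prod_mono le_rfl (subset_univ _))
  obtain ⟨⟨a, s⟩, ⟨ha, hs⟩, hmax⟩ := hK.exists_isMaxOn
    ⟨(x, t1), subset_closure hx, ht, le_rfl⟩ hzc
  simp only at ha hs
  have hmax' : ∀ b ∈ closure Ω, ∀ r ∈ Icc t0 t1,
      Real.exp (-(C+1)*r) * w b r ≤ Real.exp (-(C+1)*s) * w a s :=
    fun b hb r hr => hmax (show (b, r) ∈ closure Ω ×ˢ Icc t0 t1 from ⟨hb, hr⟩)
  have hpos : 0 < w a s := by
    have h1 := hmax' x (subset_closure hx) t1 ⟨ht, le_rfl⟩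
    have h2 : 0 < Real.exp (-(C+1)*t1) * w x t1 := mul_pos (Real.exp_pos _) (sub_pos.mpr hlt)
    exact pos_of_mul_pos_right (h2.trans_le h1) (Real.exp_pos _).le
  have haΩ : a ∈ Ω := by
    by_contra hn
    have : a ∈ frontier Ω := by
      rw [frontier, hD.o.interior_eq]; exact ⟨ha, hn⟩
    simp [hw, h.bc a this s, h'.bc a this s] at hpos
  have hst : t0 < s := by
    rcases hs.1.lt_or_eq with h1 | h1
    · exact h1
    · exfalso
      rw [← h1] at hpos
      simp [hw, h0 a haΩ] at hpos
  have hlm : IsLocalMax (fun y => w y s) a := by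
    filter_upwards [hD.o.mem_nhds haΩ] with b hb
    exact le_of_mul_le_mul_left (hmax' b (subset_closure hb) s hs) (Real.exp_pos _)
  have hlap := lap_nonpos_of_max hD.o (hwc.x s) haΩ hlm
  have hgr : (fun i => pd i (fun y => p y s - q y s) a) = 0 := by
    funext i; exact pd_eq_zero_of_max hlm i
  have hi := hL a haΩ s
  rw [hgr, norm_zero, max_eq_left (abs_nonneg _)] at hi
  have hi2 := (le_abs_self _).trans hi
  change deriv (w a) s - lap (fun y => w y s) a ≤ C * |w a s| at hi2
  rw [abs_of_pos hpos] at hi2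
  have hd : HasDerivAt (fun r : ℝ => Real.exp (-(C+1)*(s+r)) * w a (s+r))
      (Real.exp (-(C+1)*s) * (deriv (w a) s - (C+1) * w a s)) 0 := by
    have h1 : HasDerivAt (fun r : ℝ => s + r) 1 0 := by simpa using (hasDerivAt_id (0:ℝ)).const_add s
    have h2 : HasDerivAt (w a) (deriv (w a) s) (s + 0) := by
      rw [add_zero]; exact (hwc.t a haΩ s).hasDerivAt
    have h3 := (HasDerivAt.comp (0:ℝ) h2 h1)
    have h4 := ((h1.const_mul (-(C+1))).exp).mul h3
    refine h4.congr_deriv ?_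
    simp; ring
  have := left_max_deriv hd (by
    have h1 : ∀ᶠ r in 𝓝[<] (0:ℝ), r ∈ Ioo (t0 - s) 0 := Ioo_mem_nhdsLT (by linarith)
    filter_upwards [h1] with r hr
    rw [add_zero]
    exact hmax' a ha (s+r) ⟨by linarith [hr.1], by linarith [hr.2, hs.2]⟩)
  have h5 := nonneg_of_mul_nonneg_right this (Real.exp_pos _)
  linarith

lemma Sol.fwd (hD : Dat Ω f) (h : Sol Ω f R p) (h' : Sol Ω f R q) {t0 : ℝ}
    (h0 : ∀ x ∈ Ω, p x t0 = q x t0) {x : Fin d → ℝ} (hx : x ∈ Ω) {t1 : ℝ} (ht : t0 ≤ t1) :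
    p x t1 = q x t1 :=
  le_antisymm (h.fwd_le hD h' h0 hx ht) (h'.fwd_le hD h (fun x hx => (h0 x hx).symm) hx ht)

end sol
end part14

section part15
open Set MeasureTheory Filter Topology
open scoped ContDiff

section tools

lemma baireO {E : Type*} [TopologicalSpace E] [BaireSpace E] {ι : Type*} [Countable ι] {O : Set E}
    (ho : IsOpen O) (hne : O.Nonempty) (A : ι → Set E) (hA : ∀ i, IsOpen (O \ A i))
    (hcov : ∀ x ∈ O, ∃ i, x ∈ A i) :
    ∃ i, ∃ U, IsOpen U ∧ U.Nonempty ∧ U ⊆ O ∧ U ⊆ A i := by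
  have hd := dense_iUnion_interior_of_closed (f := fun i => (O \ A i)ᶜ)
    (fun i => (hA i).isClosed_compl) (by
      rw [eq_univ_iff_forall]
      intro x
      rw [mem_iUnion]
      by_cases hx : x ∈ O
      · obtain ⟨i, hi⟩ := hcov x hx
        exact ⟨i, fun h => h.2 hi⟩
      · obtain ⟨y, hy⟩ := hne
        obtain ⟨i, hi⟩ := hcov y hy
        exact ⟨i, fun h => hx h.1⟩)
  obtain ⟨x, hxO, hx⟩ := hd.inter_open_nonempty O ho hne
  rw [mem_iUnion] at hx
  obtain ⟨i, hi⟩ := hx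
  refine ⟨i, O ∩ interior (O \ A i)ᶜ, ho.inter isOpen_interior, ⟨x, hxO, hi⟩, inter_subset_left, ?_⟩
  rintro y ⟨hy, hy2⟩
  by_contra hn
  exact (interior_subset hy2) ⟨hy, hn⟩

lemma sard1 {k : ℝ → ℝ} (hk : Differentiable ℝ k) : volume (k '' {s | deriv k s = 0}) = 0 := by
  refine MeasureTheory.addHaar_image_eq_zero_of_det_fderivWithin_eq_zero volume
    (f' := fun _ => 0) (fun x hx => ?_) (fun x _ => by simp [ContinuousLinearMap.det])
  have h := (hk x).hasDerivAt
  rw [show deriv k x = 0 from hx] at h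
  have h2 := h.hasFDerivAt.hasFDerivWithinAt (s := {s | deriv k s = 0})
  simpa using h2

lemma sard_const {g k : ℝ → ℝ} (hk : Differentiable ℝ k) {J : Set ℝ} (hJ : IsPreconnected J)
    (hg : ContinuousOn g J) (h : ∀ t ∈ J, ∃ s, g t = k s ∧ deriv k s = 0) :
    ∀ t ∈ J, ∀ s ∈ J, g t = g s := by
  have key : ∀ t ∈ J, ∀ s ∈ J, ¬ g t < g s := by
    intro t ht s hs hlt
    have h1 : Icc (g t) (g s) ⊆ k '' {s | deriv k s = 0} := by
      refine ((hJ.image g hg).Icc_subset (mem_image_of_mem g ht) (mem_image_of_mem g hs)).trans ?_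
      rintro _ ⟨r, hr, rfl⟩
      obtain ⟨s, h1, h2⟩ := h r hr
      exact ⟨s, h2, h1.symm⟩
    have h2 := measure_mono_null h1 (sard1 hk)
    rw [Real.volume_Icc, ENNReal.ofReal_eq_zero] at h2
    linarith
  intro t ht s hs
  exact le_antisymm (not_lt.mp (key s hs t ht)) (not_lt.mp (key t ht s hs))

variable {d : ℕ}
variable {Ω : Set (Fin d → ℝ)} {f : ((Fin d → ℝ) × ℝ × (Fin d → ℝ)) → ℝ} {R : ℝ}
  {p q : (Fin d → ℝ) → ℝ → ℝ}

lemma case1_end (hD : Dat Ω f) (hc : IsPreconnected Ω) (h : Sol Ω f R p) {w : ℝ} (hw : 0 < w)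
    (hper : ∀ x ∈ closure Ω, ∀ t : ℝ, p x (t + w) = p x t)
    (hmin : ∀ w' : ℝ, 0 < w' → (∀ x ∈ closure Ω, ∀ t : ℝ, p x (t + w') = p x t) → w ≤ w')
    {y0 : Fin d → ℝ} (hy0 : y0 ∈ Ω) {t0 ε : ℝ} (hε : 0 < ε)
    (hz : ∀ x ∈ Metric.ball y0 ε, ∀ t ∈ Metric.ball t0 ε, ∀ s ∈ Metric.ball t0 ε, p x t = p x s) :
    False := by
  set τ := min (ε/2) (w/2) with hτ
  have hτ0 : 0 < τ := lt_min (by positivity) (by positivity)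
  have hτε : τ ≤ ε/2 := min_le_left _ _
  have hτw : τ ≤ w/2 := min_le_right _ _
  have hs := h.shift τ
  have huc := uc hD.o hc (hs.uch hD h) (t0 := t0) hy0 (by
    have : Metric.ball y0 ε ×ˢ Metric.ball t0 (ε/2) ∈ 𝓝 (y0, t0) :=
      prod_mem_nhds (Metric.ball_mem_nhds _ hε) (Metric.ball_mem_nhds _ (by positivity))
    filter_upwards [this] with z hz'
    have h2 := hz'.2
    rw [Metric.mem_ball, Real.dist_eq, abs_lt] at h2
    rw [sub_eq_zero]
    refine hz z.1 hz'.1 _ ?_ _ ?_ <;> rw [Metric.mem_ball, Real.dist_eq, abs_lt] <;>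
      constructor <;> linarith)
  have hfw : ∀ x ∈ Ω, ∀ t, t0 ≤ t → p x (t + τ) = p x t := fun x hx t ht =>
    hs.fwd hD h (fun x hx => sub_eq_zero.mp (huc x hx)) hx ht
  have hpern : ∀ x ∈ Ω, ∀ n : ℕ, ∀ t, p x (t + n*w) = p x t := by
    intro x hx n
    induction n with
    | zero => intro t; simp
    | succ n ih =>
      intro t
      rw [← ih t, ← hper x (subset_closure hx) (t + n*w)]
      congr 1; push_cast; ring
  have hall : ∀ x ∈ closure Ω, ∀ t, p x (t + τ) = p x t := by
    intro x hx t
    by_cases hxΩ : x ∈ Ω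
    · obtain ⟨n, hn⟩ := exists_nat_ge ((t0 - t)/w)
      rw [div_le_iff₀ hw] at hn
      have h1 := hfw x hxΩ (t + n*w) (by linarith)
      rw [hpern x hxΩ n, show t + n*w + τ = (t+τ) + n*w by ring, hpern x hxΩ n] at h1
      exact h1
    · have : x ∈ frontier Ω := by
        rw [frontier, hD.o.interior_eq]; exact ⟨hx, hxΩ⟩
      rw [h.bc x this, h.bc x this]
  have := hmin τ hτ0 hall
  linarith

/-- time rigidity -/
lemma sigma_shift {u v σ : ℝ → ℝ} {a b L : ℝ} (hL : 0 < L)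
    (hu : Differentiable ℝ u) (hv : Differentiable ℝ v)
    (h1 : ∀ t ∈ Icc a b, u t = v (σ t)) (h2 : ∀ t ∈ Icc a b, deriv u t = deriv v (σ t))
    (h3 : ∀ t ∈ Icc a b, ∀ s', |s' - σ t| ≤ 1/L → |s' - σ t| ≤ L * |v s' - v (σ t)|)
    (h4 : ∀ t ∈ Icc a b, ∀ t' ∈ Icc a b, |σ t' - σ t| ≤ 1/L) :
    ∃ τ, ∀ t ∈ Ioo a b, σ t = t + τ := by
  have hd : ∀ t ∈ Ioo a b, HasDerivAt σ 1 t := by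
    intro t ht
    have htI : t ∈ Icc a b := Ioo_subset_Icc_self ht
    have hnear : ∀ᶠ t' in 𝓝 t, t' ∈ Icc a b := Icc_mem_nhds ht.1 ht.2
    have hO : (fun t' => σ t' - σ t) =O[𝓝 t] (fun t' => t' - t) := by
      have e1 : (fun t' => σ t' - σ t) =O[𝓝 t] (fun t' => u t' - u t) := by
        refine Asymptotics.IsBigO.of_bound L ?_
        filter_upwards [hnear] with t' ht'
        rw [Real.norm_eq_abs, Real.norm_eq_abs, h1 t' ht', h1 t htI]
        exact h3 t htI _ (h4 t htI t' ht')
      exact e1.trans (hu t).hasDerivAt.isBigO_sub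
    have hcont : Tendsto σ (𝓝 t) (𝓝 (σ t)) := by
      have e2 : Tendsto (fun t' => t' - t) (𝓝 t) (𝓝 0) := by
        have : ContinuousAt (fun t' => t' - t) t := by fun_prop
        simpa [ContinuousAt] using this
      have := hO.trans_tendsto e2
      simpa using this.add_const (σ t)
    set c := deriv v (σ t) with hc
    have hc0 : c ≠ 0 := by
      intro hc0
      have hv0 := (hv (σ t)).hasDerivAt
      rw [← hc, hc0, hasDerivAt_iff_isLittleO] at hv0
      have e3 := hv0.def (c := 1/(2*L)) (by positivity)
      have e4 : ∀ᶠ s' in 𝓝 (σ t), |s' - σ t| ≤ 1/L := by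
        have := Metric.closedBall_mem_nhds (σ t) (by positivity : 0 < 1/L)
        filter_upwards [this] with s hs
        simpa [Real.dist_eq] using hs
      have e5 : ∀ᶠ s' in 𝓝 (σ t), s' = σ t := by
        filter_upwards [e3, e4] with s' e3 e4
        have e6 := h3 t htI s' e4
        simp only [smul_zero, sub_zero, Real.norm_eq_abs] at e3
        have e7 := mul_le_mul_of_nonneg_left e3 hL.le
        have e8 : L * (1/(2*L) * |s' - σ t|) = |s' - σ t|/2 := by field_simp
        have e9 : |s' - σ t| ≤ 0 := by linarith
        exact sub_eq_zero.mp (abs_nonpos_iff.mp e9)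
      obtain ⟨ε, hε, hb⟩ := Metric.eventually_nhds_iff.mp e5
      have := @hb (σ t + ε/2) (by rw [Real.dist_eq, add_sub_cancel_left, abs_of_pos] <;> linarith)
      linarith
    have f1 := hasDerivAt_iff_isLittleO.mp (hu t).hasDerivAt
    have f2 := ((hasDerivAt_iff_isLittleO.mp (hv (σ t)).hasDerivAt).comp_tendsto hcont).trans_isBigO hO
    rw [h2 t htI] at f1
    have f3 := (f1.sub f2).const_mul_left c⁻¹
    rw [hasDerivAt_iff_isLittleO]
    refine f3.congr' ?_ EventuallyEq.rfl
    filter_upwards [hnear] with t' ht'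
    simp only [Function.comp, smul_eq_mul, ← hc]
    rw [h1 t' ht', h1 t htI]
    field_simp
    ring
  by_cases hne : (Ioo a b).Nonempty
  · obtain ⟨t0, ht0⟩ := hne
    refine ⟨σ t0 - t0, fun t ht => ?_⟩
    have hd' : ∀ t ∈ Ioo a b, HasDerivWithinAt (fun t => σ t - t) 0 (Ioo a b) t := fun t ht => by
      have := ((hd t ht).sub (hasDerivAt_id t)).hasDerivWithinAt (s := Ioo a b)
      exact this.congr_deriv (by ring)
    have := (convex_Ioo a b).is_const_of_fderivWithin_eq_zero (𝕜 := ℝ) (f := fun t => σ t - t)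
      (fun t ht => (hd' t ht).differentiableWithinAt) (fun t ht => by
        have h5 := (hd' t ht).hasFDerivWithinAt.fderivWithin (isOpen_Ioo.uniqueDiffWithinAt ht)
        rw [h5]; ext; simp) ht ht0
    linarith
  · exact ⟨0, fun t ht => (hne ⟨t, ht⟩).elim⟩
end tools
end part15

section part16
open Set MeasureTheory Filter Topology
open scoped ContDiff

section casetwo
variable {d : ℕ}
variable {Ω : Set (Fin d → ℝ)} {f : ((Fin d → ℝ) × ℝ × (Fin d → ℝ)) → ℝ} {R : ℝ}
  {p q : (Fin d → ℝ) → ℝ → ℝ}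

lemma ev_ne {X Y : Type*} [TopologicalSpace X] [TopologicalSpace Y] [T2Space Y] {g k : X → Y}
    {z : X} (h1 : ContinuousAt g z) (h2 : ContinuousAt k z) (h : g z ≠ k z) :
    ∀ᶠ y in 𝓝 z, g y ≠ k y := by
  have h3 : {r : Y × Y | r.1 ≠ r.2} ∈ 𝓝 (g z, k z) :=
    (isClosed_eq continuous_fst continuous_snd).isOpen_compl.mem_nhds h
  exact (h1.prodMk h2).eventually h3

lemma Sol.jcA (hD : Dat Ω f) (h : Sol Ω f R p) {x : Fin d → ℝ} (hx : x ∈ Ω) (t : ℝ) :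
    ContinuousAt (fun q : (Fin d → ℝ) × ℝ => jet p q.1 q.2) (x, t) :=
  (h.jc hD).continuousAt ((hD.o.prod isOpen_univ).mem_nhds ⟨hx, mem_univ _⟩)

lemma Sol.cA (hD : Dat Ω f) (h : Sol Ω f R p) {x : Fin d → ℝ} (hx : x ∈ Ω) (t : ℝ) :
    ContinuousAt (fun q : (Fin d → ℝ) × ℝ => p q.1 q.2) (x, t) :=
  h.cl.c.continuousAt ((hD.o.prod isOpen_univ).mem_nhds ⟨hx, mem_univ _⟩)

lemma jet_ne_open (hD : Dat Ω f) (h : Sol Ω f R p) (h' : Sol Ω f R q) {x : Fin d → ℝ} (hx : x ∈ Ω)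
    {t s : ℝ} (hne : jet p x t ≠ jet q x s) :
    ∀ᶠ z in 𝓝 ((x, t), s), jet p z.1.1 z.1.2 ≠ jet q z.1.1 z.2 := by
  have c1 : ContinuousAt (fun z : ((Fin d → ℝ) × ℝ) × ℝ => jet p z.1.1 z.1.2) ((x,t),s) :=
    ContinuousAt.comp (f := fun z : ((Fin d → ℝ) × ℝ) × ℝ => z.1) (x := ((x,t),s))
      (h.jcA hD hx t) continuousAt_fst
  have c2 : ContinuousAt (fun z : ((Fin d → ℝ) × ℝ) × ℝ => jet q z.1.1 z.2) ((x,t),s) :=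
    ContinuousAt.comp (f := fun z : ((Fin d → ℝ) × ℝ) × ℝ => (z.1.1, z.2)) (x := ((x,t),s))
      (h'.jcA hD hx s) (by fun_prop)
  exact ev_ne c1 c2 hne

lemma jet_ne_open_K (hD : Dat Ω f) (h : Sol Ω f R p) (h' : Sol Ω f R q) {x : Fin d → ℝ} (hx : x ∈ Ω)
    {t : ℝ} {K : Set ℝ} (hK : IsCompact K) (hne : ∀ s ∈ K, jet p x t ≠ jet q x s) :
    ∀ᶠ z in 𝓝 (x, t), ∀ s ∈ K, jet p z.1 z.2 ≠ jet q z.1 s :=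
  hK.eventually_forall_of_forall_eventually fun s hs => jet_ne_open hD h h' hx (hne s hs)

/-- quantitative match -/
def GG (p q : (Fin d → ℝ) → ℝ → ℝ) (L : ℝ) (x : Fin d → ℝ) (t s : ℝ) : Prop :=
  jet p x t = jet q x s ∧ ∀ h, |h| ≤ 1/L → |h| ≤ L * |q x (s+h) - q x s|

lemma GG_open_K (hD : Dat Ω f) (h : Sol Ω f R p) (h' : Sol Ω f R q) {x : Fin d → ℝ} (hx : x ∈ Ω)
    {t L : ℝ} {K : Set ℝ} (hK : IsCompact K) (hne : ∀ s ∈ K, ¬ GG p q L x t s) :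
    ∀ᶠ z in 𝓝 (x, t), ∀ s ∈ K, ¬ GG p q L z.1 z.2 s := by
  refine hK.eventually_forall_of_forall_eventually fun s hs => ?_
  by_cases hj : jet p x t = jet q x s
  · have h1 : ∃ e, |e| ≤ 1/L ∧ L * |q x (s+e) - q x s| < |e| := by
      by_contra hcon
      push Not at hcon
      exact hne s hs ⟨hj, hcon⟩
    obtain ⟨e, he, hlt⟩ := h1
    have c1 : ContinuousAt (fun z : ((Fin d → ℝ) × ℝ) × ℝ => q z.1.1 (z.2+e)) ((x,t),s) :=
      ContinuousAt.comp (f := fun z : ((Fin d → ℝ) × ℝ) × ℝ => (z.1.1, z.2+e)) (x := ((x,t),s))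
        (h'.cA hD hx (s+e)) (by fun_prop)
    have c2 : ContinuousAt (fun z : ((Fin d → ℝ) × ℝ) × ℝ => q z.1.1 z.2) ((x,t),s) :=
      ContinuousAt.comp (f := fun z : ((Fin d → ℝ) × ℝ) × ℝ => (z.1.1, z.2)) (x := ((x,t),s))
        (h'.cA hD hx s) (by fun_prop)
    have c3 := ((c1.sub c2).abs.const_mul L).eventually (gt_mem_nhds hlt)
    filter_upwards [c3] with z hz hG
    exact absurd (hG.2 e he) (not_le.mpr hz)
  · filter_upwards [jet_ne_open hD h h' hx hj] with z hz hG
    exact hz hG.1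

/-- closed pieces -/
def PP (p q : (Fin d → ℝ) → ℝ → ℝ) (n k : ℕ) (x : Fin d → ℝ) (t : ℝ) : Prop :=
  ∃ s ∈ Icc ((k:ℝ)/((n:ℝ)+1)) (((k:ℝ)+1)/((n:ℝ)+1)), GG p q ((n:ℝ)+1) x t s

lemma PP_open (hD : Dat Ω f) (h : Sol Ω f R p) (h' : Sol Ω f R q) {x : Fin d → ℝ} (hx : x ∈ Ω)
    {t : ℝ} {n k : ℕ} (hn : ¬ PP p q n k x t) : ∀ᶠ z in 𝓝 (x, t), ¬ PP p q n k z.1 z.2 := by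
  have := GG_open_K hD h h' hx (t := t) (L := (n:ℝ)+1) isCompact_Icc
    (K := Icc ((k:ℝ)/((n:ℝ)+1)) (((k:ℝ)+1)/((n:ℝ)+1))) (fun s hs hG => hn ⟨s, hs, hG⟩)
  filter_upwards [this] with z hz
  rintro ⟨s, hs, hG⟩
  exact hz s hs hG

lemma exists_PP (h' : Sol Ω f R q) {x : Fin d → ℝ} (hx : x ∈ Ω) {t s : ℝ} (hs : 0 ≤ s)
    (hj : jet p x t = jet q x s) (hd : deriv (q x) s ≠ 0) : ∃ n k, PP p q n k x t := by
  have hder := (h'.cl.t x hx s).hasDerivAt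
  set c := deriv (q x) s with hc
  have hc0 : 0 < |c| := abs_pos.mpr hd
  have h1 := (hasDerivAt_iff_isLittleO_nhds_zero.mp hder).def (c := |c|/2) (by positivity)
  obtain ⟨ε, hε, hb⟩ := Metric.eventually_nhds_iff.mp h1
  obtain ⟨n, hn⟩ := exists_nat_gt (max (1/ε) (2/|c|))
  have hn1 : 1/ε < n := (le_max_left _ _).trans_lt hn
  have hn2 : 2/|c| < n := (le_max_right _ _).trans_lt hn
  have hn0 : (0:ℝ) < (n:ℝ)+1 := by positivity
  refine ⟨n, ⌊s*((n:ℝ)+1)⌋₊, s, ⟨?_, ?_⟩, hj, ?_⟩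
  · rw [div_le_iff₀ hn0]
    exact Nat.floor_le (by positivity)
  · rw [le_div_iff₀ hn0]
    exact (Nat.lt_floor_add_one _).le
  · intro e he
    rw [le_div_iff₀ hn0] at he
    rw [div_lt_iff₀ hε] at hn1
    rw [div_lt_iff₀ hc0] at hn2
    have hee : |e| < ε := by
      by_contra hcon
      rw [not_lt] at hcon
      have := mul_le_mul_of_nonneg_right hcon hn0.le
      linarith
    have h2 := @hb e (by simpa using hee)
    rw [Real.norm_eq_abs, Real.norm_eq_abs, smul_eq_mul] at h2
    have h3 := abs_sub_abs_le_abs_sub (e*c) (q x (s+e) - q x s)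
    rw [abs_mul, abs_sub_comm (e*c)] at h3
    have h4 : |e| * |c| / 2 ≤ |q x (s+e) - q x s| := by linarith
    have h5 := mul_le_mul_of_nonneg_left h4 hn0.le
    have h6 := mul_le_mul_of_nonneg_left hn2.le (abs_nonneg e)
    have h7 : 0 ≤ |e| * |c| := by positivity
    linarith

lemma fderiv_zero_of_pd {g : (Fin d → ℝ) → ℝ} {x : Fin d → ℝ} (h : ∀ i, pd i g x = 0) :
    fderiv ℝ g x = 0 := by
  ext v
  have := (fderiv ℝ g x).toLinearMap.pi_apply_eq_sum_univ v
  simp only [ContinuousLinearMap.coe_coe] at this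
  rw [this]
  refine Finset.sum_eq_zero fun i _ => ?_
  have h1 : (fun j => if i = j then (1:ℝ) else 0) = Pi.single i 1 := by
    funext j
    simp [Pi.single_apply, eq_comm]
  rw [h1]
  have := h i
  unfold pd at this
  rw [this]; simp

/-- end of case two -/
lemma case2_end (hD : Dat Ω f) (hc : IsPreconnected Ω) (h : Sol Ω f R p) (h' : Sol Ω f R q)
    (hdiff : ∀ t s : ℝ, ∃ x ∈ Ω, p x t ≠ q x s)
    {y0 : Fin d → ℝ} {r a b : ℝ} (hr : 0 < r) (hB : Metric.ball y0 r ⊆ Ω) (hab : a < b) {n k : ℕ}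
    (hP : ∀ x ∈ Metric.ball y0 r, ∀ t ∈ Icc a b, PP p q n k x t) : False := by
  set L : ℝ := (n:ℝ)+1 with hL
  have hL0 : 0 < L := by positivity
  have hy0 : y0 ∈ Metric.ball y0 r := Metric.mem_ball_self hr
  choose! s hsI hsG using hP
  have hnear : ∀ x ∈ Metric.ball y0 r, ∀ t ∈ Icc a b, ∀ x' ∈ Metric.ball y0 r, ∀ t' ∈ Icc a b,
      |s x t - s x' t'| ≤ 1/L := by
    intro x hx t ht x' hx' t' ht'
    have e1 := hsI x hx t ht
    have e2 := hsI x' hx' t' ht'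
    rw [← hL, add_div] at e1 e2
    rw [abs_le]
    constructor <;> linarith [e1.1, e1.2, e2.1, e2.2]
  have hG2 : ∀ x ∈ Metric.ball y0 r, ∀ t ∈ Icc a b, ∀ s', |s' - s x t| ≤ 1/L →
      |s' - s x t| ≤ L * |q x s' - q x (s x t)| := by
    intro x hx t ht s' hs'
    have := (hsG x hx t ht).2 (s' - s x t) hs'
    rwa [add_sub_cancel] at this
  -- the selection does not depend on `x`
  have hconst : ∀ x ∈ Metric.ball y0 r, ∀ t ∈ Icc a b, s x t = s y0 t := by
    intro x hx t ht
    have hF : ∀ z ∈ Metric.ball y0 r, HasFDerivAt (fun z => s z t) (0 : (Fin d → ℝ) →L[ℝ] ℝ) z := by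
      intro z hz
      have hzj := (hsG z hz t ht).1
      have hd1 := c2_diff hD.o (h.x t) (hB hz)
      have hd2 := c2_diff hD.o (h'.x (s z t)) (hB hz)
      have hjv : p z t = q z (s z t) := congrArg (fun j => j.2.1) hzj
      have hjg : ∀ i, pd i (fun y => p y t) z = pd i (fun y => q y (s z t)) z := fun i =>
        congrFun (congrArg (fun j => j.2.2) hzj) i
      have hg0 : fderiv ℝ (fun y => p y t - q y (s z t)) z = 0 := by
        refine fderiv_zero_of_pd fun i => ?_
        rw [pd_sub i hd1 hd2, hjg i, sub_self]
      have hgd := (hd1.sub hd2).hasFDerivAt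
      rw [show fderiv ℝ ((fun y => p y t) - fun y => q y (s z t)) z = 0 from hg0] at hgd
      rw [hasFDerivAt_iff_isLittleO] at hgd ⊢
      refine Asymptotics.IsBigO.trans_isLittleO (Asymptotics.IsBigO.of_bound L ?_) hgd
      filter_upwards [Metric.isOpen_ball.mem_nhds hz] with y hy
      have e1 := hG2 y hy t ht (s z t) (hnear z hz t ht y hy t ht)
      have hyv : p y t = q y (s y t) := congrArg (fun j => j.2.1) (hsG y hy t ht).1
      simp only [zero_apply, sub_zero, Pi.sub_apply, hjv, sub_self,
        Real.norm_eq_abs]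
      rw [abs_sub_comm, hyv, abs_sub_comm (q y (s y t))]
      exact e1
    refine (convex_ball y0 r).is_const_of_fderivWithin_eq_zero (𝕜 := ℝ) (f := fun z => s z t)
      (fun z hz => (hF z hz).differentiableAt.differentiableWithinAt) (fun z hz => ?_) hx hy0
    rw [fderivWithin_of_isOpen Metric.isOpen_ball hz, (hF z hz).fderiv]
  have hval : ∀ x ∈ Metric.ball y0 r, ∀ t ∈ Icc a b, p x t = q x (s y0 t) := by
    intro x hx t ht
    rw [← hconst x hx t ht]
    exact congrArg (fun j => j.2.1) (hsG x hx t ht).1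
  have hder : ∀ t ∈ Icc a b, deriv (p y0) t = deriv (q y0) (s y0 t) := by
    intro t ht
    have e1 := h.eq y0 (hB hy0) t
    have e2 := h'.eq y0 (hB hy0) (s y0 t)
    have e3 : lap (fun y => p y t) y0 = lap (fun y => q y (s y0 t)) y0 := by
      refine lap_congr ?_
      filter_upwards [Metric.isOpen_ball.mem_nhds hy0] with y hy
      exact hval y hy t ht
    have e4 : f (jet p y0 t) = f (jet q y0 (s y0 t)) := by rw [(hsG y0 hy0 t ht).1]
    unfold jet at e4
    rw [e1, e2, e3, e4]
  obtain ⟨τ, hτ⟩ := sigma_shift hL0 (h.cl.t y0 (hB hy0)) (h'.cl.t y0 (hB hy0)) (hval y0 hy0) hder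
    (hG2 y0 hy0) (fun t ht t' ht' => hnear y0 hy0 t' ht' y0 hy0 t ht)
  have hm : (a+b)/2 ∈ Ioo a b := ⟨by linarith, by linarith⟩
  have huc := uc hD.o hc (h.uch hD (h'.shift τ)) (t0 := (a+b)/2) (hB hy0) (by
    have : Metric.ball y0 r ×ˢ Ioo a b ∈ 𝓝 (y0, (a+b)/2) :=
      prod_mem_nhds (Metric.ball_mem_nhds _ hr) (Ioo_mem_nhds hm.1 hm.2)
    filter_upwards [this] with z hz
    rw [sub_eq_zero, hval z.1 hz.1 z.2 (Ioo_subset_Icc_self hz.2), hτ z.2 hz.2])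
  obtain ⟨x, hx, hne⟩ := hdiff ((a+b)/2) ((a+b)/2+τ)
  exact hne (sub_eq_zero.mp (huc x hx))
end casetwo
end part16

section part17
open Set MeasureTheory Filter Topology
open scoped ContDiff

section final
variable {d : ℕ}
variable {Ω : Set (Fin d → ℝ)} {f : ((Fin d → ℝ) × ℝ × (Fin d → ℝ)) → ℝ} {R : ℝ}
  {p q : (Fin d → ℝ) → ℝ → ℝ}

/-- match at a critical time -/
def TTc (p q : (Fin d → ℝ) → ℝ → ℝ) (w : ℝ) (x : Fin d → ℝ) (t : ℝ) : Prop :=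
  ∃ s ∈ Icc 0 w, p x t = q x s ∧ deriv (q x) s = 0

lemma TTc_open (h : Sol Ω f R p) (h' : Sol Ω f R q) {x : Fin d → ℝ} (hx : x ∈ Ω) {t w : ℝ}
    (hn : ¬ TTc p q w x t) : ∀ᶠ t' in 𝓝 t, ¬ TTc p q w x t' := by
  have c1 : Continuous (p x) := (h.t x hx).continuous
  have c2 : Continuous (q x) := (h'.t x hx).continuous
  have c3 : Continuous (deriv (q x)) := (h'.t x hx).continuous_deriv le_rfl
  have : ∀ᶠ t' in 𝓝 t, ∀ s ∈ Icc 0 w, ¬ (p x t' = q x s ∧ deriv (q x) s = 0) := by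
    refine isCompact_Icc.eventually_forall_of_forall_eventually fun s hs => ?_
    by_cases hj : p x t = q x s
    · have hd : deriv (q x) s ≠ 0 := fun h0 => hn ⟨s, hs, hj, h0⟩
      have : ContinuousAt (fun z : ℝ × ℝ => deriv (q x) z.2) (t, s) := by fun_prop
      filter_upwards [this.eventually_ne hd] with z hz hh
      exact hz hh.2
    · have e1 : ContinuousAt (fun z : ℝ × ℝ => p x z.1) (t, s) := by fun_prop
      have e2 : ContinuousAt (fun z : ℝ × ℝ => q x z.2) (t, s) := by fun_prop
      filter_upwards [ev_ne e1 e2 hj] with z hz hh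
      exact hz hh.1
  filter_upwards [this] with t' ht'
  rintro ⟨s, hs, hh⟩
  exact ht' s hs hh

lemma case2 (hD : Dat Ω f) (hc : IsPreconnected Ω) (h : Sol Ω f R p) (h' : Sol Ω f R q)
    (hdiff : ∀ t s : ℝ, ∃ x ∈ Ω, p x t ≠ q x s) {w : ℝ}
    {y0 : Fin d → ℝ} {r : ℝ} (hr : 0 < r) (hB : Metric.ball y0 r ⊆ Ω) {J : Set ℝ} (hJ : IsOpen J)
    (hN : ∀ x ∈ Metric.ball y0 r, ∀ t ∈ J, ∃ s ∈ Icc 0 w, jet p x t = jet q x s)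
    (hT : ∀ x ∈ Metric.ball y0 r, ∃ t ∈ J, ¬ TTc p q w x t) : False := by
  have step1 : ∀ x ∈ Metric.ball y0 r, ∃ i : ℕ × ℕ × ℚ × ℚ, (i.2.2.1:ℝ) < i.2.2.2 ∧
      ∀ t ∈ Icc (i.2.2.1:ℝ) i.2.2.2, PP p q i.1 i.2.1 x t := by
    intro x hx
    obtain ⟨t, htJ, htT⟩ := hT x hx
    have hO : IsOpen {t | t ∈ J ∧ ¬ TTc p q w x t} := by
      rw [isOpen_iff_eventually]
      rintro t ⟨h1, h2⟩
      have e0 : ∀ᶠ t' in 𝓝 t, t' ∈ J := hJ.mem_nhds h1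
      exact e0.and (TTc_open h h' (hB hx) h2)
    obtain ⟨⟨n, k⟩, U, hU, ⟨t1, ht1⟩, hUO, hUA⟩ := baireO hO ⟨t, htJ, htT⟩
      (fun i : ℕ × ℕ => {t | PP p q i.1 i.2 x t}) (by
        intro i
        rw [isOpen_iff_eventually]
        rintro t ⟨h1, h2⟩
        have e1 : ∀ᶠ t' in 𝓝 t, t' ∈ {t | t ∈ J ∧ ¬ TTc p q w x t} := hO.mem_nhds h1
        have e2 := PP_open hD h h' (hB hx) (t := t) (n := i.1) (k := i.2) h2
        have e3 : ContinuousAt (fun t' : ℝ => (x, t')) t := by fun_prop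
        exact e1.and (e3.eventually e2)) (by
        rintro t ⟨h1, h2⟩
        obtain ⟨s, hs, hj⟩ := hN x hx t h1
        have hd : deriv (q x) s ≠ 0 := fun h0 => h2 ⟨s, hs, congrArg (fun j => j.2.1) hj, h0⟩
        obtain ⟨n, k, hP⟩ := exists_PP h' (hB hx) hs.1 hj hd
        exact ⟨(n, k), hP⟩)
    obtain ⟨ε, hε, hb⟩ := Metric.isOpen_iff.mp hU t1 ht1
    obtain ⟨a, ha1, ha2⟩ := exists_rat_btwn (show t1 - ε < t1 by linarith)
    obtain ⟨b, hb1, hb2⟩ := exists_rat_btwn (show t1 < t1 + ε by linarith)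
    refine ⟨(n, k, a, b), ha2.trans hb1, fun t ht => hUA (hb ?_)⟩
    rw [Metric.mem_ball, Real.dist_eq, abs_lt]
    have i1 : (a:ℝ) ≤ t := ht.1
    have i2 : t ≤ (b:ℝ) := ht.2
    constructor <;> linarith
  obtain ⟨i, U, hU, ⟨x1, hx1⟩, hUO, hUA⟩ := baireO (Metric.isOpen_ball (x := y0) (ε := r))
    ⟨y0, Metric.mem_ball_self hr⟩
    (fun i : ℕ × ℕ × ℚ × ℚ => {x | (i.2.2.1:ℝ) < i.2.2.2 ∧
      ∀ t ∈ Icc (i.2.2.1:ℝ) i.2.2.2, PP p q i.1 i.2.1 x t}) (by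
      intro i
      rw [isOpen_iff_eventually]
      rintro x ⟨h1, h2⟩
      have e1 : ∀ᶠ x' in 𝓝 x, x' ∈ Metric.ball y0 r := Metric.isOpen_ball.mem_nhds h1
      refine e1.and ?_
      by_cases hlt : (i.2.2.1:ℝ) < i.2.2.2
      · have h3 : ∃ t ∈ Icc (i.2.2.1:ℝ) i.2.2.2, ¬ PP p q i.1 i.2.1 x t := by
          by_contra hcon
          push Not at hcon
          exact h2 ⟨hlt, hcon⟩
        obtain ⟨t, ht, hP⟩ := h3
        have e2 := PP_open hD h h' (hB h1) hP
        have e3 : ContinuousAt (fun x' : Fin d → ℝ => (x', t)) x := by fun_prop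
        filter_upwards [e3.eventually e2] with x' hx' hcon
        exact hx' (hcon.2 t ht)
      · exact Eventually.of_forall fun x' hcon => hlt hcon.1) step1
  obtain ⟨ε, hε, hb⟩ := Metric.isOpen_iff.mp hU x1 hx1
  exact case2_end hD hc h h' hdiff hε (hb.trans (hUO.trans hB)) (hUA hx1).1
    (fun x hx t ht => (hUA (hb hx)).2 t ht)

lemma not_open (hD : Dat Ω f) (hc : IsPreconnected Ω) (h : Sol Ω f R p) (h' : Sol Ω f R q)
    {w1 : ℝ} (hw1 : 0 < w1)
    (hper : ∀ x ∈ closure Ω, ∀ t : ℝ, p x (t + w1) = p x t)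
    (hmin : ∀ w' : ℝ, 0 < w' → (∀ x ∈ closure Ω, ∀ t : ℝ, p x (t + w') = p x t) → w1 ≤ w')
    (hdiff : ∀ t s : ℝ, ∃ x ∈ Ω, p x t ≠ q x s) {w : ℝ}
    {y0 : Fin d → ℝ} {t0 r : ℝ} (hr : 0 < r) (hB : Metric.ball y0 r ⊆ Ω)
    (hN : ∀ x ∈ Metric.ball y0 r, ∀ t ∈ Metric.ball t0 r, ∃ s ∈ Icc 0 w, jet p x t = jet q x s) :
    False := by
  by_cases H : ∃ y ∈ Metric.ball y0 r, ∃ ρ > 0, Metric.ball y ρ ⊆ Metric.ball y0 r ∧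
      ∀ z ∈ Metric.ball y ρ, ∃ t ∈ Metric.ball t0 r, ¬ TTc p q w z t
  · obtain ⟨y, hy, ρ, hρ, hsub, hT⟩ := H
    exact case2 hD hc h h' hdiff hρ (hsub.trans hB) Metric.isOpen_ball
      (fun x hx t ht => hN x (hsub hx) t ht) hT
  · push Not at H
    have hconst : ∀ z ∈ Ω, (∀ t ∈ Metric.ball t0 r, TTc p q w z t) →
        ∀ t ∈ Metric.ball t0 r, ∀ s ∈ Metric.ball t0 r, p z t = p z s := by
      intro z hz hT
      refine sard_const (h'.cl.t z hz) (convex_ball t0 r).isPreconnected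
        (h.t z hz).continuous.continuousOn fun t ht => ?_
      obtain ⟨s, -, hs⟩ := hT t ht
      exact ⟨s, hs⟩
    refine case1_end hD hc h hw1 hper hmin (hB (Metric.mem_ball_self hr)) (t0 := t0) hr ?_
    intro x hx t ht s hs
    by_contra hne
    have c1 : ContinuousAt (fun x' => p x' t) x := (c2_diff hD.o (h.x t) (hB hx)).continuousAt
    have c2 : ContinuousAt (fun x' => p x' s) x := (c2_diff hD.o (h.x s) (hB hx)).continuousAt
    have e1 := ev_ne c1 c2 hne
    have e2 : ∀ᶠ x' in 𝓝 x, x' ∈ Metric.ball y0 r := Metric.isOpen_ball.mem_nhds hx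
    obtain ⟨ρ, hρ, hb⟩ := Metric.eventually_nhds_iff_ball.mp (e1.and e2)
    obtain ⟨z, hz, hzT⟩ := H x hx ρ hρ (fun z hz => (hb z hz).2)
    exact (hb z hz).1 (hconst z (hB (hb z hz).2) hzT t ht s hs)

lemma main_sep (hD : Dat Ω f) (hc : IsPreconnected Ω) (h : Sol Ω f R p) (h' : Sol Ω f R q)
    {w1 w2 : ℝ} (hw1 : 0 < w1) (hw2 : 0 < w2)
    (hper : ∀ x ∈ closure Ω, ∀ t : ℝ, p x (t + w1) = p x t)
    (hmin : ∀ w' : ℝ, 0 < w' → (∀ x ∈ closure Ω, ∀ t : ℝ, p x (t + w') = p x t) → w1 ≤ w')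
    (hper2 : ∀ x ∈ closure Ω, ∀ t : ℝ, q x (t + w2) = q x t)
    (hdiff : ∀ t s : ℝ, ∃ x ∈ Ω, p x t ≠ q x s) :
    ∃ D : Set ((Fin d → ℝ) × ℝ), IsOpen D ∧ D ⊆ Ω ×ˢ (univ : Set ℝ) ∧
      Ω ×ˢ (univ : Set ℝ) ⊆ closure D ∧
      ∀ z ∈ D, ∀ t : ℝ,
        ¬ (p z.1 z.2 = q z.1 t ∧
           ∀ i, pd i (fun y => p y z.2) z.1 = pd i (fun y => q y t) z.1) := by
  refine ⟨{z | z.1 ∈ Ω ∧ ∀ s ∈ Icc 0 w2, jet p z.1 z.2 ≠ jet q z.1 s}, ?_, ?_, ?_, ?_⟩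
  · rw [isOpen_iff_eventually]
    rintro ⟨x, t⟩ ⟨h1, h2⟩
    have e1 : ∀ᶠ z : (Fin d → ℝ) × ℝ in 𝓝 (x, t), z.1 ∈ Ω :=
      continuousAt_fst.eventually (hD.o.mem_nhds h1)
    exact e1.and (jet_ne_open_K hD h h' h1 isCompact_Icc h2)
  · rintro z hz
    exact ⟨hz.1, mem_univ _⟩
  · rintro ⟨x, t⟩ ⟨hx, -⟩
    by_contra hn
    rw [mem_closure_iff_nhds_basis Metric.nhds_basis_ball] at hn
    push Not at hn
    obtain ⟨ε, hε, hb⟩ := hn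
    obtain ⟨r, hr, hrb⟩ := Metric.isOpen_iff.mp hD.o x hx
    have hx : x ∈ Ω := hx
    refine not_open hD hc h h' hw1 hper hmin hdiff (w := w2) (y0 := x) (t0 := t)
      (r := min ε r) (lt_min hε hr) ((Metric.ball_subset_ball (min_le_right _ _)).trans hrb) ?_
    intro y hy s hs
    by_contra hcon
    push Not at hcon
    refine hb (y, s) ⟨hrb (Metric.ball_subset_ball (min_le_right _ _) hy), hcon⟩ ?_
    rw [← ball_prod_same]
    exact ⟨Metric.ball_subset_ball (min_le_left _ _) hy, Metric.ball_subset_ball (min_le_left _ _) hs⟩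
  · rintro ⟨x, t⟩ ⟨hx, hD2⟩ s ⟨hv, hg⟩
    have hp : ∀ x ∈ Ω, Function.Periodic (q x) w2 := fun x hx t => hper2 x (subset_closure hx) t
    set m := ⌊s/w2⌋ with hm
    have hsh : ∀ y ∈ Ω, q y (s - m * w2) = q y s := by
      intro y hy
      exact (hp y hy).sub_int_mul_eq m
    have hmem : s - m*w2 ∈ Icc 0 w2 := by
      have e1 := Int.floor_le (s/w2)
      have e2 := (Int.lt_floor_add_one (s/w2)).le
      rw [← hm] at e1 e2
      rw [le_div_iff₀ hw2] at e1
      rw [div_le_iff₀ hw2] at e2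
      constructor <;> linarith
    refine hD2 _ hmem ?_
    unfold jet
    have hxΩ : x ∈ Ω := hx
    have hpd : ∀ i, pd i (fun y => q y (s - m*w2)) x = pd i (fun y => q y s) x := by
      intro i
      refine pd_congr ?_ i
      filter_upwards [hD.o.mem_nhds hxΩ] with y hy
      exact hsh y hy
    simp only at hv hg ⊢
    rw [hsh x hxΩ, hv]
    congr 2
    funext i
    rw [hg i, hpd i]
end final
end part17

/-- Proposition `prop-1to1-CR`: separation of two distinct periodic
orbits at a dense open set of points. -/
theorem separation_of_periodic_orbits
    (d : ℕ) (hd : 2 ≤ d) (γ : NNReal) (hγ0 : 0 < γ) (hγ1 : γ ≤ 1)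
    (Ω : Set (Fin d → ℝ)) (hΩo : IsOpen Ω) (hΩc : IsConnected Ω)
    (hΩb : Bornology.IsBounded Ω) (hΩreg : HasC2HolderBoundary Ω γ)
    (f : ((Fin d → ℝ) × ℝ × (Fin d → ℝ)) → ℝ)
    (hf : ContDiffOn ℝ (⊤ : ℕ∞) f
      (closure Ω ×ˢ ((univ : Set ℝ) ×ˢ (univ : Set (Fin d → ℝ)))))
    -- `p₁` is a classical periodic solution of minimal period `ω₁`
    (p₁ : (Fin d → ℝ) → ℝ → ℝ)
    (hp₁c : ContinuousOn (fun q : (Fin d → ℝ) × ℝ => p₁ q.1 q.2)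
      (closure Ω ×ˢ (univ : Set ℝ)))
    (hp₁x : ∀ t : ℝ, ContDiffOn ℝ 2 (fun x => p₁ x t) Ω)
    (hp₁t : ∀ x ∈ Ω, ContDiff ℝ 1 (p₁ x))
    (hp₁eq : ∀ x ∈ Ω, ∀ t : ℝ,
      deriv (p₁ x) t = lap (fun y => p₁ y t) x
        + f (x, p₁ x t, fun i => pd i (fun y => p₁ y t) x))
    (hp₁bc : ∀ x ∈ frontier Ω, ∀ t : ℝ, p₁ x t = 0)
    (ω₁ : ℝ) (hω₁ : 0 < ω₁)
    (hper₁ : ∀ x ∈ closure Ω, ∀ t : ℝ, p₁ x (t + ω₁) = p₁ x t)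
    (hmin₁ : ∀ ω' : ℝ, 0 < ω' → (∀ x ∈ closure Ω, ∀ t : ℝ, p₁ x (t + ω') = p₁ x t) → ω₁ ≤ ω')
    (hp₁bnd : ∃ R : ℝ, ∀ x ∈ Ω, ∀ t : ℝ, |p₁ x t| ≤ R ∧ ∀ i, |pd i (fun y => p₁ y t) x| ≤ R)
    -- `p₂` is a classical periodic solution of minimal period `ω₂`
    (p₂ : (Fin d → ℝ) → ℝ → ℝ)
    (hp₂c : ContinuousOn (fun q : (Fin d → ℝ) × ℝ => p₂ q.1 q.2)
      (closure Ω ×ˢ (univ : Set ℝ)))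
    (hp₂x : ∀ t : ℝ, ContDiffOn ℝ 2 (fun x => p₂ x t) Ω)
    (hp₂t : ∀ x ∈ Ω, ContDiff ℝ 1 (p₂ x))
    (hp₂eq : ∀ x ∈ Ω, ∀ t : ℝ,
      deriv (p₂ x) t = lap (fun y => p₂ y t) x
        + f (x, p₂ x t, fun i => pd i (fun y => p₂ y t) x))
    (hp₂bc : ∀ x ∈ frontier Ω, ∀ t : ℝ, p₂ x t = 0)
    (ω₂ : ℝ) (hω₂ : 0 < ω₂)
    (hper₂ : ∀ x ∈ closure Ω, ∀ t : ℝ, p₂ x (t + ω₂) = p₂ x t)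
    (hmin₂ : ∀ ω' : ℝ, 0 < ω' → (∀ x ∈ closure Ω, ∀ t : ℝ, p₂ x (t + ω') = p₂ x t) → ω₂ ≤ ω')
    (hp₂bnd : ∃ R : ℝ, ∀ x ∈ Ω, ∀ t : ℝ, |p₂ x t| ≤ R ∧ ∀ i, |pd i (fun y => p₂ y t) x| ≤ R)
    -- `p₁` and `p₂` do not describe the same periodic orbit
    (hdiff : ∀ t s : ℝ, ∃ x ∈ Ω, p₁ x t ≠ p₂ x s) :
    ∃ D : Set ((Fin d → ℝ) × ℝ), IsOpen D ∧ D ⊆ Ω ×ˢ (univ : Set ℝ) ∧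
      Ω ×ˢ (univ : Set ℝ) ⊆ closure D ∧
      ∀ q ∈ D, ∀ t : ℝ,
        ¬ (p₁ q.1 q.2 = p₂ q.1 t ∧
           ∀ i, pd i (fun y => p₁ y q.2) q.1 = pd i (fun y => p₂ y t) q.1) := by
  obtain ⟨R1, hR1⟩ := hp₁bnd
  obtain ⟨R2, hR2⟩ := hp₂bnd
  have hD : Dat Ω f := ⟨hΩo, hΩb, hf.of_le (by exact_mod_cast le_top)⟩
  have h1 : Sol Ω f (max R1 R2) p₁ := ⟨hp₁c, hp₁x, hp₁t, hp₁eq, hp₁bc, fun x hx t =>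
    ⟨(hR1 x hx t).1.trans (le_max_left _ _), fun i => ((hR1 x hx t).2 i).trans (le_max_left _ _)⟩⟩
  have h2 : Sol Ω f (max R1 R2) p₂ := ⟨hp₂c, hp₂x, hp₂t, hp₂eq, hp₂bc, fun x hx t =>
    ⟨(hR2 x hx t).1.trans (le_max_right _ _), fun i => ((hR2 x hx t).2 i).trans (le_max_right _ _)⟩⟩
  exact main_sep hD hΩc.isPreconnected h1 h2 hω₁ hω₂ hper₁ hmin₁ hper₂ hdiff
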